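/- There is an absolute constant K > 0 such that the following holds for every sufficiently large prime p and every θ ∈ (0,1] with θ > (log log p)^{−2/3}: if f : 𝔽_p → [0,1] satisfies 𝔼(f) ≥ θ and Λ(f) ≤ Λ(h) for every h : 𝔽_p → [0,1] with 𝔼(h) ≥ θ, and C := { n ∈ 𝔽_p : f(n) ≥ 1/2 }, then there exists a set B ⊆ 𝔽_p with |B| > p^{1/2} such that Σ_{n ∈ 𝔽_p} | (1_C ∗ 1_B)(n) − |B|·1_C(n) | ≤ K·p·|B|·(log log p)^{−2/3}. That is, the set on which f is approximately an indicator function is roughly a sumset C + B. -/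

import Mathlib

noncomputable def Lam (p : ℕ) [NeZero p] (f : ZMod p → ℝ) : ℝ :=
  ((p : ℝ) ^ 2)⁻¹ * ∑ n : ZMod p, ∑ d : ZMod p, f n * f (n + d) * f (n + 2 * d)

noncomputable def Ex (p : ℕ) [NeZero p] (f : ZMod p → ℝ) : ℝ :=
  (p : ℝ)⁻¹ * ∑ n : ZMod p, f n

noncomputable def conv (p : ℕ) [NeZero p] (u v : ZMod p → ℝ) (m : ZMod p) : ℝ :=
  ∑ k : ZMod p, u k * v (m - k)

noncomputable def ind (p : ℕ) [NeZero p] (S : Finset (ZMod p)) : ZMod p → ℝ :=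
  fun n => if n ∈ S then 1 else 0

namespace Roth3

open Finset

/-! ## Characters -/

noncomputable def ee {p : ℕ} [NeZero p] (x : ZMod p) : ℂ := ZMod.stdAddChar x

lemma ee_add {p : ℕ} [NeZero p] (x y : ZMod p) : ee (x + y) = ee x * ee y := by
  unfold ee; exact AddChar.map_add_eq_mul _ _ _

lemma ee_zero {p : ℕ} [NeZero p] : ee (0 : ZMod p) = 1 := by
  unfold ee; exact AddChar.map_zero_eq_one _

lemma ee_norm {p : ℕ} [NeZero p] (x : ZMod p) : ‖ee x‖ = 1 := by
  unfold ee; exact AddChar.norm_apply _ _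

lemma ee_neg {p : ℕ} [NeZero p] (x : ZMod p) : ee (-x) = (starRingEnd ℂ) (ee x) := by
  unfold ee; exact AddChar.map_neg_eq_conj _ _

lemma ee_mul_neg {p : ℕ} [NeZero p] (x : ZMod p) : ee x * ee (-x) = 1 := by
  rw [← ee_add, add_neg_cancel, ee_zero]

lemma ee_sum {p : ℕ} [NeZero p] {ι : Type*} (s : Finset ι) (f : ι → ZMod p) :
    ee (∑ i ∈ s, f i) = ∏ i ∈ s, ee (f i) := by
  classical
  induction s using Finset.induction_on with
  | empty => simp [ee_zero]
  | insert a s ha ih => rw [Finset.sum_insert ha, Finset.prod_insert ha, ee_add, ih]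

lemma sum_ee {p : ℕ} [NeZero p] (ξ : ZMod p) :
    ∑ x : ZMod p, ee (ξ * x) = if ξ = 0 then (p : ℂ) else 0 := by
  have h := AddChar.sum_mulShift (ψ := (ZMod.stdAddChar : AddChar (ZMod p) ℂ)) ξ
    (ZMod.isPrimitive_stdAddChar p)
  unfold ee
  simp_rw [mul_comm ξ]
  rw [h]; split_ifs <;> simp [ZMod.card]

lemma sum_ee' {p : ℕ} [NeZero p] (x : ZMod p) :
    ∑ ξ : ZMod p, ee (ξ * x) = if x = 0 then (p : ℂ) else 0 := by
  simp_rw [mul_comm _ x]; exact sum_ee x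

/-! ## Fourier coefficients (normalised) -/

noncomputable def ft {p : ℕ} [NeZero p] (w : ZMod p → ℂ) (ξ : ZMod p) : ℂ :=
  (p : ℂ)⁻¹ * ∑ y : ZMod p, w y * ee (-(ξ * y))

lemma ft_inv {p : ℕ} [NeZero p] (w : ZMod p → ℂ) (x : ZMod p) :
    w x = ∑ ξ : ZMod p, ft w ξ * ee (ξ * x) := by
  have hp : (p : ℂ) ≠ 0 := by exact_mod_cast NeZero.ne p
  unfold ft
  have : ∑ ξ : ZMod p, ((p : ℂ)⁻¹ * ∑ y : ZMod p, w y * ee (-(ξ * y))) * ee (ξ * x)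
      = (p : ℂ)⁻¹ * ∑ y : ZMod p, w y * ∑ ξ : ZMod p, ee (ξ * (x - y)) := by
    simp_rw [mul_sum, sum_mul]
    rw [sum_comm]
    refine sum_congr rfl fun y _ => sum_congr rfl fun ξ _ => ?_
    rw [show ξ * (x - y) = -(ξ * y) + ξ * x by ring, ee_add]; ring
  rw [this]
  simp_rw [sum_ee', sub_eq_zero]
  simp only [mul_ite, mul_zero, Finset.sum_ite_eq, Finset.mem_univ, if_true]
  field_simp

lemma ft_parseval {p : ℕ} [NeZero p] (w : ZMod p → ℂ) :
    ∑ ξ : ZMod p, ‖ft w ξ‖ ^ 2 = (p : ℝ)⁻¹ * ∑ x : ZMod p, ‖w x‖ ^ 2 := by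
  have hp : (p : ℂ) ≠ 0 := by exact_mod_cast NeZero.ne p
  have key : ((∑ ξ : ZMod p, ‖ft w ξ‖ ^ 2 : ℝ) : ℂ) =
      (((p : ℝ)⁻¹ * ∑ x : ZMod p, ‖w x‖ ^ 2 : ℝ) : ℂ) := by
    push_cast
    simp_rw [← Complex.mul_conj']
    have h1 : ∀ ξ : ZMod p, (starRingEnd ℂ) (ft w ξ)
        = (p : ℂ)⁻¹ * ∑ y : ZMod p, (starRingEnd ℂ) (w y) * ee (ξ * y) := by
      intro ξ
      unfold ft
      simp only [map_mul, map_inv₀, map_natCast, map_sum]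
      congr 1
      refine sum_congr rfl fun y _ => ?_
      rw [← ee_neg, neg_neg]
    simp_rw [h1]
    have h2 : ∀ y : ZMod p, w y * (starRingEnd ℂ) (w y)
        = (∑ ξ : ZMod p, ft w ξ * ee (ξ * y)) * (starRingEnd ℂ) (w y) := by
      intro y; rw [← ft_inv w y]
    simp_rw [h2, mul_sum, sum_mul]
    rw [sum_comm]
    refine sum_congr rfl fun y _ => ?_
    rw [mul_sum]
    refine sum_congr rfl fun ξ _ => ?_
    ring
  exact_mod_cast key

/-! ## Bohr sets -/

open Classical in
noncomputable def bohr {p : ℕ} [NeZero p] (Γ : Finset (ZMod p)) (r : ℝ) : Finset (ZMod p) :=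
  univ.filter fun x => ∀ γ ∈ Γ, ‖ee (γ * x) - 1‖ ≤ r

lemma mem_bohr {p : ℕ} [NeZero p] {Γ : Finset (ZMod p)} {r : ℝ} {x : ZMod p} :
    x ∈ bohr Γ r ↔ ∀ γ ∈ Γ, ‖ee (γ * x) - 1‖ ≤ r := by
  simp [bohr]

lemma ee_sub_one_add {p : ℕ} [NeZero p] (x y : ZMod p) :
    ‖ee (x + y) - 1‖ ≤ ‖ee x - 1‖ + ‖ee y - 1‖ := by
  have : ee (x + y) - 1 = ee x * (ee y - 1) + (ee x - 1) := by rw [ee_add]; ring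
  rw [this]
  refine (norm_add_le _ _).trans ?_
  rw [norm_mul, ee_norm, one_mul, add_comm]

lemma ee_sub_one_neg {p : ℕ} [NeZero p] (x : ZMod p) : ‖ee (-x) - 1‖ = ‖ee x - 1‖ := by
  rw [ee_neg, ← map_one (starRingEnd ℂ), ← map_sub, RCLike.norm_conj, map_one]

lemma ee_sub {p : ℕ} [NeZero p] (x y : ZMod p) : ‖ee (x - y) - 1‖ = ‖ee x - ee y‖ := by
  have : ee x - ee y = ee y * (ee (x - y) - 1) := by
    rw [mul_sub, ← ee_add]; simp
  rw [this, norm_mul, ee_norm, one_mul]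

lemma bohr_add {p : ℕ} [NeZero p] {Γ : Finset (ZMod p)} {r s : ℝ} {x y : ZMod p}
    (hx : x ∈ bohr Γ r) (hy : y ∈ bohr Γ s) : x + y ∈ bohr Γ (r + s) := by
  rw [mem_bohr] at *
  intro γ hγ
  rw [mul_add]
  exact (ee_sub_one_add _ _).trans (add_le_add (hx γ hγ) (hy γ hγ))

lemma bohr_neg {p : ℕ} [NeZero p] {Γ : Finset (ZMod p)} {r : ℝ} {x : ZMod p}
    (hx : x ∈ bohr Γ r) : -x ∈ bohr Γ r := by
  rw [mem_bohr] at *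
  intro γ hγ
  rw [mul_neg, ee_sub_one_neg]; exact hx γ hγ

lemma bohr_sub {p : ℕ} [NeZero p] {Γ : Finset (ZMod p)} {r s : ℝ} {x y : ZMod p}
    (hx : x ∈ bohr Γ r) (hy : y ∈ bohr Γ s) : x - y ∈ bohr Γ (r + s) := by
  rw [sub_eq_add_neg]; exact bohr_add hx (bohr_neg hy)

lemma bohr_mono {p : ℕ} [NeZero p] {Γ : Finset (ZMod p)} {r s : ℝ} (h : r ≤ s) :
    bohr Γ r ⊆ bohr Γ s := by
  intro x hx
  rw [mem_bohr] at *
  exact fun γ hγ => (hx γ hγ).trans h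

lemma bohr_anti {p : ℕ} [NeZero p] {Γ Δ : Finset (ZMod p)} {r : ℝ} (h : Γ ⊆ Δ) :
    bohr Δ r ⊆ bohr Γ r := by
  intro x hx
  rw [mem_bohr] at *
  exact fun γ hγ => hx γ (h hγ)

lemma zero_mem_bohr {p : ℕ} [NeZero p] {Γ : Finset (ZMod p)} {r : ℝ} (h : 0 ≤ r) :
    (0 : ZMod p) ∈ bohr Γ r := by
  rw [mem_bohr]; intro γ _; simpa [ee_zero] using h

lemma bohr_card_pos {p : ℕ} [NeZero p] {Γ : Finset (ZMod p)} {r : ℝ} (h : 0 ≤ r) :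
    0 < ((bohr Γ r).card : ℝ) := by
  exact_mod_cast Finset.card_pos.mpr ⟨0, zero_mem_bohr h⟩

lemma bohr_two {p : ℕ} [NeZero p] (Γ : Finset (ZMod p)) : bohr Γ 2 = univ := by
  ext x
  simp only [mem_bohr, mem_univ, iff_true]
  intro γ _
  refine (norm_sub_le _ _).trans ?_
  rw [ee_norm, norm_one]; norm_num

lemma bohr_half {p : ℕ} [NeZero p] (Γ : Finset (ZMod p)) {r : ℝ} (hr : 0 < r) :
    (bohr Γ r).card ≤ 49 ^ Γ.card * (bohr Γ (r / 2)).card := by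
  classical
  let F : ZMod p → (Γ → ℤ × ℤ) := fun x γ =>
    (⌊((ee ((γ : ZMod p) * x) - 1).re + r) / (r / 3)⌋, ⌊((ee ((γ : ZMod p) * x) - 1).im + r) / (r / 3)⌋)
  have h1 : (bohr Γ r).card ≤ (bohr Γ (r / 2)).card * ((bohr Γ r).image F).card := by
    refine Finset.card_le_mul_card_image _ _ ?_
    intro b hb
    obtain ⟨x0, hx0, rfl⟩ := Finset.mem_image.mp hb
    refine Finset.card_le_card_of_injOn (fun y => y - x0) ?_ (fun a _ b _ h => by simpa using h)
    intro y hy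
    simp only [coe_filter, Set.mem_ofPred_eq] at hy
    simp only [mem_coe]
    rw [mem_bohr]
    intro γ hγ
    rw [mul_sub, ee_sub]
    have h := congrFun hy.2 ⟨γ, hγ⟩
    simp only [F, Prod.mk.injEq] at h
    obtain ⟨ha, hb⟩ := h
    have ha' := Int.abs_sub_lt_one_of_floor_eq_floor ha
    have hb' := Int.abs_sub_lt_one_of_floor_eq_floor hb
    rw [← sub_div, abs_div, div_lt_one (by positivity), abs_of_pos (show (0:ℝ) < r / 3 by positivity)] at ha' hb'
    have e1 : (ee (γ * y) - 1).re + r - ((ee (γ * x0) - 1).re + r) = (ee (γ * y) - ee (γ * x0)).re := by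
      simp
    have e2 : (ee (γ * y) - 1).im + r - ((ee (γ * x0) - 1).im + r) = (ee (γ * y) - ee (γ * x0)).im := by
      simp
    rw [e1] at ha'; rw [e2] at hb'
    set z := ee (γ * y) - ee (γ * x0)
    have hz : ‖z‖ ^ 2 = z.re ^ 2 + z.im ^ 2 := by
      rw [Complex.sq_norm, Complex.normSq_apply]; ring
    have h3 : z.re ^ 2 ≤ (r / 3) ^ 2 := sq_le_sq' (by linarith [abs_lt.mp ha']) (abs_lt.mp ha').2.le
    have h4 : z.im ^ 2 ≤ (r / 3) ^ 2 := sq_le_sq' (by linarith [abs_lt.mp hb']) (abs_lt.mp hb').2.le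
    exact abs_le_of_sq_le_sq' (by nlinarith) (by positivity) |>.2
  have h2 : ((bohr Γ r).image F).card ≤ 49 ^ Γ.card := by
    have hsub : (bohr Γ r).image F ⊆
        Fintype.piFinset (fun _ : Γ => (Finset.Icc (0 : ℤ) 6) ×ˢ (Finset.Icc (0 : ℤ) 6)) := by
      intro b hb
      obtain ⟨x, hx, rfl⟩ := Finset.mem_image.mp hb
      rw [Fintype.mem_piFinset]
      rintro ⟨γ, hγ⟩
      have hn := mem_bohr.mp hx γ hγ
      have h1 := abs_le.mp ((Complex.abs_re_le_norm _).trans hn)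
      have h2 := abs_le.mp ((Complex.abs_im_le_norm _).trans hn)
      simp only [F, mem_product, Finset.mem_Icc]
      have aux : ∀ t : ℝ, -r ≤ t → t ≤ r → 0 ≤ ⌊(t + r) / (r / 3)⌋ ∧ ⌊(t + r) / (r / 3)⌋ ≤ 6 := by
        intro t ht1 ht2
        constructor
        · exact Int.floor_nonneg.mpr (div_nonneg (by linarith) (by positivity))
        · have : (t + r) / (r / 3) ≤ 6 := by
            rw [div_le_iff₀ (by positivity)]; linarith
          have h6 : ((⌊(t + r) / (r / 3)⌋ : ℤ) : ℝ) ≤ ((6 : ℤ) : ℝ) := by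
            push_cast; exact (Int.floor_le _).trans this
          exact_mod_cast h6
      exact ⟨aux _ h1.1 h1.2, aux _ h2.1 h2.2⟩
    refine (Finset.card_le_card hsub).trans ?_
    rw [Fintype.card_piFinset]
    simp
  calc (bohr Γ r).card ≤ (bohr Γ (r / 2)).card * ((bohr Γ r).image F).card := h1
    _ ≤ (bohr Γ (r / 2)).card * 49 ^ Γ.card := Nat.mul_le_mul_left _ h2
    _ = _ := mul_comm _ _

lemma bohr_lower {p : ℕ} [NeZero p] (Γ : Finset (ZMod p)) (j : ℕ) :
    p ≤ 49 ^ (Γ.card * j) * (bohr Γ (2 / 2 ^ j)).card := by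
  induction j with
  | zero => simp [bohr_two]
  | succ j ih =>
    have h := bohr_half Γ (r := 2 / 2 ^ j) (by positivity)
    have e : (2 : ℝ) / 2 ^ j / 2 = 2 / 2 ^ (j + 1) := by rw [div_div, pow_succ]
    rw [e] at h
    calc p ≤ 49 ^ (Γ.card * j) * (bohr Γ (2 / 2 ^ j)).card := ih
      _ ≤ 49 ^ (Γ.card * j) * (49 ^ Γ.card * (bohr Γ (2 / 2 ^ (j + 1))).card) :=
          Nat.mul_le_mul_left _ h
      _ = _ := by rw [← mul_assoc, ← pow_add, Nat.mul_succ]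

/-- existence of regular radii -/
lemma bohr_regular {p : ℕ} [NeZero p] (Γ : Finset (ZMod p)) (d h : ℕ) (hd : Γ.card ≤ d) (hd1 : 1 ≤ d)
    (hh : 1 ≤ h) {R : ℝ} (hR : 0 < R) :
    ∃ r, R / 2 ≤ r ∧ r ≤ R ∧
      ((bohr Γ (r + R / (16 * d * h))).card : ℝ) ≤ (1 + 1 / (h : ℝ)) * (bohr Γ r).card := by
  by_contra hcon
  push Not at hcon
  have hd0 : (0 : ℝ) < d := by exact_mod_cast hd1
  have hh0 : (0 : ℝ) < h := by exact_mod_cast hh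
  set κ : ℝ := R / (16 * d * h) with hκ
  have hκ0 : 0 < κ := by positivity
  have hind : ∀ j : ℕ, j ≤ 8 * d * h →
      (1 + 1 / (h : ℝ)) ^ j * (bohr Γ (R / 2)).card ≤ (bohr Γ (R / 2 + j * κ)).card := by
    intro j
    induction j with
    | zero => intro _; simp
    | succ j ih =>
      intro hj
      have h1 := ih (by omega)
      have hjr : (j : ℝ) * κ ≤ R / 2 := by
        have : (j : ℝ) ≤ 8 * d * h := by exact_mod_cast (by omega : j ≤ 8 * d * h)
        calc (j : ℝ) * κ ≤ 8 * d * h * κ := by gcongr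
          _ = R / 2 := by rw [hκ]; field_simp; norm_num
      have h2 := hcon (R / 2 + j * κ) (by nlinarith [Nat.cast_nonneg (α := ℝ) j]) (by linarith)
      have e : R / 2 + ((j + 1 : ℕ) : ℝ) * κ = R / 2 + j * κ + κ := by push_cast; ring
      rw [e, pow_succ]
      have hp : 0 < 1 + 1 / (h : ℝ) := by positivity
      nlinarith
  have h1 := hind (8 * d * h) le_rfl
  have e : R / 2 + ((8 * d * h : ℕ) : ℝ) * κ = R := by
    rw [hκ]; push_cast; field_simp; norm_num
  rw [e] at h1
  have h2 : (2 : ℝ) ≤ (1 + 1 / (h : ℝ)) ^ h := by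
    have := one_add_mul_le_pow (a := 1 / (h : ℝ)) (by have : 0 < 1 / (h : ℝ) := by positivity
                                                      linarith) h
    rw [mul_one_div_cancel hh0.ne'] at this
    linarith
  have h3 : (256 : ℝ) ^ d ≤ (1 + 1 / (h : ℝ)) ^ (8 * d * h) := by
    rw [show 8 * d * h = h * (8 * d) by ring, pow_mul]
    calc (256 : ℝ) ^ d = 2 ^ (8 * d) := by rw [pow_mul]; norm_num
      _ ≤ _ := by gcongr
  have h4 : ((bohr Γ R).card : ℝ) ≤ 49 ^ d * (bohr Γ (R / 2)).card := by
    have := bohr_half Γ hR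
    calc ((bohr Γ R).card : ℝ) ≤ 49 ^ Γ.card * (bohr Γ (R / 2)).card := by exact_mod_cast this
      _ ≤ _ := by gcongr; norm_num
  have h5 : 0 < ((bohr Γ (R / 2)).card : ℝ) := bohr_card_pos (by positivity)
  have h6 : (49 : ℝ) ^ d < 256 ^ d := by
    apply pow_lt_pow_left₀ (by norm_num) (by norm_num) (by omega)
  nlinarith

/-- shifts of a regular Bohr set -/
lemma bohr_shift {p : ℕ} [NeZero p] {Γ : Finset (ZMod p)} {r s η : ℝ}
    (h : ((bohr Γ (r + s)).card : ℝ) ≤ (1 + η) * (bohr Γ r).card) (hs : 0 ≤ s)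
    {t : ZMod p} (ht : t ∈ bohr Γ s) :
    (((bohr Γ r).filter (fun x => x + t ∉ bohr Γ r)).card : ℝ) ≤ η * (bohr Γ r).card := by
  have h1 : ((bohr Γ r).filter (fun x => x + t ∉ bohr Γ r)).card
      ≤ (bohr Γ (r + s) \ bohr Γ r).card := by
    refine Finset.card_le_card_of_injOn (fun x => x + t) ?_ (fun a _ b _ h => by simpa using h)
    intro x hx
    simp only [coe_filter, Set.mem_ofPred_eq] at hx
    simp only [coe_sdiff, Set.mem_sdiff, mem_coe]
    exact ⟨bohr_add hx.1 ht, hx.2⟩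
  have h2 : (bohr Γ (r + s) \ bohr Γ r).card + (bohr Γ r).card = (bohr Γ (r + s)).card :=
    Finset.card_sdiff_add_card_eq_card (bohr_mono (by linarith))
  have h1' : (((bohr Γ r).filter (fun x => x + t ∉ bohr Γ r)).card : ℝ)
      ≤ ((bohr Γ (r + s) \ bohr Γ r).card : ℝ) := by exact_mod_cast h1
  have h2' : ((bohr Γ (r + s) \ bohr Γ r).card : ℝ) + (bohr Γ r).card = (bohr Γ (r + s)).card := by
    exact_mod_cast h2
  linarith

/-! ## Moments and positivity -/

open Classical in
noncomputable def ic {p : ℕ} (A : Finset (ZMod p)) (y : ZMod p) : ℝ := if y ∈ A then 1 else 0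

noncomputable def cvv {p : ℕ} [NeZero p] (f : ZMod p → ℝ) (c : ZMod p) : ℝ := ∑ y, f y * f (c - y)
noncomputable def crr {p : ℕ} [NeZero p] (f : ZMod p → ℝ) (v : ZMod p) : ℝ := ∑ y, f y * f (y + v)

lemma ic_nonneg {p : ℕ} (A : Finset (ZMod p)) (y : ZMod p) : 0 ≤ ic A y := by
  unfold ic; split_ifs <;> norm_num

lemma ic_le_one {p : ℕ} (A : Finset (ZMod p)) (y : ZMod p) : ic A y ≤ 1 := by
  unfold ic; split_ifs <;> norm_num

lemma ic_sum {p : ℕ} [NeZero p] (A : Finset (ZMod p)) : ∑ y, ic A y = A.card := by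
  classical
  unfold ic; simp

lemma ic_mul_sum {p : ℕ} [NeZero p] (A : Finset (ZMod p)) (g : ZMod p → ℝ) :
    ∑ y, ic A y * g y = ∑ y ∈ A, g y := by
  classical
  unfold ic; simp

lemma pow_expand {p : ℕ} [NeZero p] (a : ZMod p → ℂ) (v : ZMod p) (P : ℕ) :
    (∑ ξ, a ξ * ee (ξ * v)) ^ P = ∑ x : Fin P → ZMod p, (∏ i, a (x i)) * ee ((∑ i, x i) * v) := by
  rw [Fintype.sum_pow]
  refine sum_congr rfl fun x _ => ?_
  rw [prod_mul_distrib, sum_mul, ee_sum]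

lemma pos_dom {p : ℕ} [NeZero p] {ι : Type*} (Q : Finset ι) (π : ι → ZMod p)
    (hpos : ∀ ξ : ZMod p, ∃ r : ℝ, 0 ≤ r ∧ ∑ q ∈ Q, ee (ξ * π q) = (r : ℂ)) (a : ZMod p → ℂ) (P : ℕ) :
    ‖∑ q ∈ Q, (∑ ξ, a ξ * ee (ξ * π q)) ^ P‖ ≤
      (∑ q ∈ Q, (∑ ξ, (‖a ξ‖ : ℂ) * ee (ξ * π q)) ^ P).re := by
  choose r hr0 hr using hpos
  have key : ∀ b : ZMod p → ℂ, ∑ q ∈ Q, (∑ ξ, b ξ * ee (ξ * π q)) ^ P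
      = ∑ x : Fin P → ZMod p, (∏ i, b (x i)) * (r (∑ i, x i) : ℂ) := by
    intro b
    simp_rw [pow_expand]
    rw [sum_comm]
    refine sum_congr rfl fun x _ => ?_
    rw [← mul_sum, hr]
  rw [key, key]
  refine (norm_sum_le _ _).trans (le_of_eq ?_)
  rw [Complex.re_sum]
  refine sum_congr rfl fun x _ => ?_
  rw [norm_mul, norm_prod, Complex.norm_real, Real.norm_of_nonneg (hr0 _)]
  rw [show (∏ i, ((‖a (x i)‖ : ℝ) : ℂ)) * (r (∑ i, x i) : ℂ)
    = (((∏ i, ‖a (x i)‖) * r (∑ i, x i) : ℝ) : ℂ) by push_cast; rfl]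
  rw [Complex.ofReal_re]

lemma cvv_ft {p : ℕ} [NeZero p] (f : ZMod p → ℝ) (c : ZMod p) :
    (cvv f c : ℂ) = ∑ ξ, (p * ft (fun x => (f x : ℂ)) ξ ^ 2) * ee (ξ * c) := by
  have hp : (p : ℂ) ≠ 0 := by exact_mod_cast NeZero.ne p
  unfold cvv
  push_cast
  have h1 : ∀ y, (f y : ℂ) * (f (c - y) : ℂ)
      = ∑ ξ, ft (fun x => (f x : ℂ)) ξ * ee (ξ * c) * ((f y : ℂ) * ee (-(ξ * y))) := by
    intro y
    rw [show (f (c - y) : ℂ) = ∑ ξ, ft (fun x => (f x : ℂ)) ξ * ee (ξ * (c - y)) from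
      ft_inv (fun x => (f x : ℂ)) (c - y), mul_sum]
    refine sum_congr rfl fun ξ _ => ?_
    rw [show ξ * (c - y) = ξ * c + -(ξ * y) by ring, ee_add]; ring
  simp_rw [h1]
  rw [sum_comm]
  refine sum_congr rfl fun ξ _ => ?_
  rw [← mul_sum]
  have : ∑ y, (f y : ℂ) * ee (-(ξ * y)) = p * ft (fun x => (f x : ℂ)) ξ := by
    unfold ft; rw [← mul_assoc, mul_inv_cancel₀ hp, one_mul]
  rw [this]; ring

lemma crr_ft {p : ℕ} [NeZero p] (f : ZMod p → ℝ) (c : ZMod p) :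
    (crr f c : ℂ) = ∑ ξ, ((p * ‖ft (fun x => (f x : ℂ)) ξ‖ ^ 2 : ℝ) : ℂ) * ee (ξ * c) := by
  have hp : (p : ℂ) ≠ 0 := by exact_mod_cast NeZero.ne p
  unfold crr
  push_cast
  have h1 : ∀ y, (f y : ℂ) * (f (y + c) : ℂ)
      = ∑ ξ, ft (fun x => (f x : ℂ)) ξ * ee (ξ * c) * ((f y : ℂ) * ee (ξ * y)) := by
    intro y
    rw [show (f (y + c) : ℂ) = ∑ ξ, ft (fun x => (f x : ℂ)) ξ * ee (ξ * (y + c)) from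
      ft_inv (fun x => (f x : ℂ)) (y + c), mul_sum]
    refine sum_congr rfl fun ξ _ => ?_
    rw [show ξ * (y + c) = ξ * c + (ξ * y) by ring, ee_add]; ring
  simp_rw [h1]
  rw [sum_comm]
  refine sum_congr rfl fun ξ _ => ?_
  rw [← mul_sum]
  have : ∑ y, (f y : ℂ) * ee (ξ * y) = p * (starRingEnd ℂ) (ft (fun x => (f x : ℂ)) ξ) := by
    unfold ft; rw [map_mul, map_sum]; simp only [map_mul, Complex.conj_ofReal, map_inv₀, map_natCast]
    rw [← mul_assoc, mul_inv_cancel₀ hp, one_mul]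
    refine sum_congr rfl fun y _ => ?_
    rw [← ee_neg, neg_neg]
  rw [this, ← Complex.mul_conj']; ring

lemma cvv_le_crr {p : ℕ} [NeZero p] {ι : Type*} (Q : Finset ι) (π : ι → ZMod p)
    (hpos : ∀ ξ : ZMod p, ∃ r : ℝ, 0 ≤ r ∧ ∑ q ∈ Q, ee (ξ * π q) = (r : ℂ)) (f : ZMod p → ℝ)
    (u : ZMod p) (P : ℕ) :
    ∑ q ∈ Q, cvv f (u + π q) ^ P ≤ ∑ q ∈ Q, crr f (π q) ^ P ∧ 0 ≤ ∑ q ∈ Q, crr f (π q) ^ P := by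
  have h := pos_dom Q π hpos
    (fun ξ => (p * ft (fun x => (f x : ℂ)) ξ ^ 2) * ee (ξ * u)) P
  have h1 : ∀ q, (∑ ξ, (p * ft (fun x => (f x : ℂ)) ξ ^ 2) * ee (ξ * u) * ee (ξ * π q))
      = (cvv f (u + π q) : ℂ) := by
    intro q
    rw [cvv_ft]
    refine sum_congr rfl fun ξ _ => ?_
    rw [mul_add, ee_add]; ring
  have h2 : ∀ q, (∑ ξ, ((‖(p * ft (fun x => (f x : ℂ)) ξ ^ 2) * ee (ξ * u)‖ : ℝ) : ℂ) * ee (ξ * π q))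
      = (crr f (π q) : ℂ) := by
    intro q
    rw [crr_ft]
    refine sum_congr rfl fun ξ _ => ?_
    rw [norm_mul, norm_mul, ee_norm, norm_pow, Complex.norm_natCast, mul_one]
  simp_rw [h1, h2] at h
  have h3 : (∑ q ∈ Q, (crr f (π q) : ℂ) ^ P).re = ∑ q ∈ Q, crr f (π q) ^ P := by
    rw [show (∑ q ∈ Q, (crr f (π q) : ℂ) ^ P) = ((∑ q ∈ Q, crr f (π q) ^ P : ℝ) : ℂ) by push_cast; rfl,
      Complex.ofReal_re]
  have h4 : ‖∑ q ∈ Q, (cvv f (u + π q) : ℂ) ^ P‖ = |∑ q ∈ Q, cvv f (u + π q) ^ P| := by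
    rw [show (∑ q ∈ Q, (cvv f (u + π q) : ℂ) ^ P) = ((∑ q ∈ Q, cvv f (u + π q) ^ P : ℝ) : ℂ) by
      push_cast; rfl, Complex.norm_real, Real.norm_eq_abs]
  rw [h3, h4] at h
  exact ⟨(le_abs_self _).trans h, (abs_nonneg _).trans h⟩

lemma two_sum {p : ℕ} [NeZero p] (B : Finset (ZMod p)) (ξ : ZMod p) :
    ∑ x ∈ B ×ˢ B, ee (ξ * (x.1 - x.2)) = ((‖∑ b ∈ B, ee (ξ * b)‖ ^ 2 : ℝ) : ℂ) := by
  push_cast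
  rw [← Complex.mul_conj', map_sum, sum_mul_sum, sum_product]
  refine sum_congr rfl fun x _ => sum_congr rfl fun y _ => ?_
  rw [← ee_neg, ← ee_add]
  congr 1; ring

/-- positivity for the four-fold index set -/
lemma fourfold_pos {p : ℕ} [NeZero p] (B1 B2 : Finset (ZMod p)) (ξ : ZMod p) :
    ∃ r : ℝ, 0 ≤ r ∧ ∑ q ∈ (B1 ×ˢ B1) ×ˢ (B2 ×ˢ B2),
      ee (ξ * (q.1.1 - q.1.2 + q.2.1 - q.2.2)) = (r : ℂ) := by
  refine ⟨‖∑ b ∈ B1, ee (ξ * b)‖ ^ 2 * ‖∑ b ∈ B2, ee (ξ * b)‖ ^ 2, by positivity, ?_⟩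
  rw [Complex.ofReal_mul, ← two_sum, ← two_sum, sum_mul_sum, sum_product]
  refine sum_congr rfl fun x _ => sum_congr rfl fun y _ => ?_
  rw [← ee_add]
  congr 1; ring

lemma shift_dev {p : ℕ} [NeZero p] (A B : Finset (ZMod p)) (hAB : A ⊆ B) (g : ZMod p → ZMod p) (t : ℝ)
    (h : ((B.filter fun y => g y ∉ B).card : ℝ) ≤ t) :
    (A.card : ℝ) - t ≤ ∑ y, ic A y * ic B (g y) ∧ ∑ y, ic A y * ic B (g y) ≤ A.card := by
  classical
  rw [ic_mul_sum]
  constructor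
  · have h1 : (A.card : ℝ) = ∑ y ∈ A, ic B (g y) + ((A.filter fun y => g y ∉ B).card : ℝ) := by
      unfold ic
      rw [sum_boole]
      have := card_filter_add_card_filter_not (s := A) (fun y => g y ∈ B)
      exact_mod_cast this.symm
    have h2 : ((A.filter fun y => g y ∉ B).card : ℝ) ≤ (B.filter fun y => g y ∉ B).card := by
      exact_mod_cast card_le_card (filter_subset_filter _ hAB)
    linarith
  · calc _ ≤ ∑ y ∈ A, (1 : ℝ) := sum_le_sum fun y _ => ic_le_one _ _
      _ = _ := by simp

lemma choose_bd (P : ℕ) (hP : 1 ≤ P) : (63 : ℝ) ^ P ≤ (64 * P).choose P := by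
  have h := @Nat.pow_le_choose ℝ _ _ _ P (64 * P)
  refine le_trans ?_ h
  have h1 : (P.factorial : ℝ) ≤ (P : ℝ) ^ P := by exact_mod_cast Nat.factorial_le_pow P
  rw [le_div_iff₀ (by positivity)]
  calc (63 : ℝ) ^ P * P.factorial ≤ 63 ^ P * (P : ℝ) ^ P := by gcongr
    _ = (63 * P : ℝ) ^ P := by rw [mul_pow]
    _ ≤ _ := by
      gcongr
      rw [show 64 * P + 1 - P = 63 * P + 1 by omega]; push_cast; linarith

lemma binom_lower {ι : Type*} (Q : Finset ι) (X : ι → ℝ) (M : ℝ) (hM : 0 ≤ M) (P : ℕ) (hP : 1 ≤ P)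
    (hX : ∀ j, 0 ≤ ∑ q ∈ Q, X q ^ j) (hXP : Q.card * (M / 16) ^ P ≤ ∑ q ∈ Q, X q ^ P) :
    Q.card * ((63 / 16) ^ P * M ^ (64 * P)) ≤ ∑ q ∈ Q, (X q + M) ^ (64 * P) := by
  have h1 : ∑ q ∈ Q, (X q + M) ^ (64 * P)
      = ∑ j ∈ range (64 * P + 1), ((64 * P).choose j * M ^ (64 * P - j)) * ∑ q ∈ Q, X q ^ j := by
    simp_rw [add_pow]
    rw [sum_comm]
    refine sum_congr rfl fun j _ => ?_
    rw [mul_sum]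
    refine sum_congr rfl fun q _ => ?_
    ring
  rw [h1]
  have h2 := single_le_sum (f := fun j => ((64 * P).choose j * M ^ (64 * P - j)) * ∑ q ∈ Q, X q ^ j)
    (s := range (64 * P + 1)) (fun j _ => mul_nonneg (by positivity) (hX j))
    (show P ∈ range (64 * P + 1) by rw [mem_range]; omega)
  refine le_trans ?_ h2
  have h3 : (63 : ℝ) ^ P * M ^ (64 * P - P) * (Q.card * (M / 16) ^ P)
      ≤ ((64 * P).choose P * M ^ (64 * P - P)) * ∑ q ∈ Q, X q ^ P := by
    gcongr
    exact choose_bd P hP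
  refine le_trans (le_of_eq ?_) h3
  have h4 : M ^ (64 * P) = M ^ (64 * P - P) * M ^ P := by rw [← pow_add]; congr 1; omega
  rw [h4, div_pow, div_pow]; ring

lemma moment_final {ι : Type*} (Q : Finset ι) (X Y : ι → ℝ) (M : ℝ) (hM : 0 ≤ M) (P : ℕ) (hP : 1 ≤ P)
    (hY : ∀ q ∈ Q, 0 ≤ Y q)
    (hXY : ∀ q ∈ Q, |X q + M| ≤ Y q + M / 500)
    (h : Q.card * ((63 / 16) ^ P * M ^ (64 * P)) ≤ ∑ q ∈ Q, (X q + M) ^ (64 * P)) :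
    Q.card * (1.01 * M) ^ (64 * P) ≤ ∑ q ∈ Q, Y q ^ (64 * P) := by
  have h1 : ∀ q ∈ Q, (X q + M) ^ (64 * P) ≤ 1.002 ^ (64 * P) * (Y q ^ (64 * P) + M ^ (64 * P)) := by
    intro q hq
    have ha : (X q + M) ^ (64 * P) ≤ (Y q + M / 500) ^ (64 * P) := by
      rw [← Even.pow_abs (show Even (64 * P) from ⟨32 * P, by ring⟩)]
      exact pow_le_pow_left₀ (abs_nonneg _) (hXY q hq) _
    refine ha.trans ?_
    have hy := hY q hq
    rcases le_total M (Y q) with hc | hc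
    · calc (Y q + M / 500) ^ (64 * P) ≤ (1.002 * Y q) ^ (64 * P) := by
            apply pow_le_pow_left₀ (by positivity); linarith
        _ = 1.002 ^ (64 * P) * (Y q ^ (64 * P)) := by rw [mul_pow]
        _ ≤ _ := by gcongr; linarith [pow_nonneg hM (64 * P)]
    · calc (Y q + M / 500) ^ (64 * P) ≤ (1.002 * M) ^ (64 * P) := by
            apply pow_le_pow_left₀ (by positivity); linarith
        _ = 1.002 ^ (64 * P) * (M ^ (64 * P)) := by rw [mul_pow]
        _ ≤ _ := by gcongr; linarith [pow_nonneg hy (64 * P)]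
  have h2 := h.trans (sum_le_sum h1)
  rw [← mul_sum, sum_add_distrib, sum_const, nsmul_eq_mul] at h2
  have h3 : (1.002 : ℝ) ^ (64 * P) ≤ 1.137 ^ P := by
    rw [pow_mul]; gcongr; norm_num
  have h4 : (1.01 : ℝ) ^ (64 * P) ≤ 1.9 ^ P := by
    rw [pow_mul]; gcongr; norm_num
  have h5 : (1.137 : ℝ) ^ P * (1 + 1.9 ^ P) ≤ (63 / 16) ^ P := by
    have : (1 + 1.9 ^ P : ℝ) ≤ 2.9 ^ P := by
      have := pow_add_pow_le (x := (1 : ℝ)) (y := 1.9) (by norm_num) (by norm_num) (n := P) (by omega)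
      norm_num at this ⊢; linarith
    calc (1.137 : ℝ) ^ P * (1 + 1.9 ^ P) ≤ (1.137 : ℝ) ^ P * 2.9 ^ P := by gcongr
      _ = (1.137 * 2.9) ^ P := by rw [mul_pow]
      _ ≤ _ := by gcongr; norm_num
  set S := ∑ q ∈ Q, Y q ^ (64 * P) with hS
  have hS0 : 0 ≤ S := sum_nonneg fun q hq => pow_nonneg (hY q hq) _
  set m := (Q.card : ℝ) * M ^ (64 * P) with hm
  have hm0 : 0 ≤ m := by positivity
  have h6 : (63 / 16) ^ P * m ≤ 1.137 ^ P * (S + m) := by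
    calc (63 / 16) ^ P * m = Q.card * ((63 / 16) ^ P * M ^ (64 * P)) := by rw [hm]; ring
      _ ≤ 1.002 ^ (64 * P) * (S + m) := h2
      _ ≤ _ := by gcongr
  have h7 : (1.137 : ℝ) ^ P * ((1 + 1.9 ^ P) * m) ≤ 1.137 ^ P * (S + m) := by
    refine le_trans ?_ h6
    rw [← mul_assoc]; gcongr
  have h8 := le_of_mul_le_mul_left h7 (by positivity)
  calc _ = 1.01 ^ (64 * P) * m := by rw [hm, mul_pow]; ring
    _ ≤ 1.9 ^ P * m := by gcongr
    _ ≤ S := by linarith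

/-- expansion bounds -/
lemma bal_expand {p : ℕ} [NeZero p] (A B : Finset (ZMod p)) (α : ℝ) (g : ZMod p → ZMod p) :
    ∑ y, (ic A y - α * ic B y) * (ic A (g y) - α * ic B (g y))
      = ∑ y, ic A y * ic A (g y) - α * (∑ y, ic A y * ic B (g y)) - α * (∑ y, ic B y * ic A (g y))
        + α ^ 2 * ∑ y, ic B y * ic B (g y) := by
  rw [mul_sum, mul_sum, mul_sum, ← sum_sub_distrib, ← sum_sub_distrib, ← sum_add_distrib]
  refine sum_congr rfl fun y _ => ?_
  ring

set_option maxHeartbeats 2000000 in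
lemma moment_lift {p : ℕ} [NeZero p] {ι : Type*} (Q : Finset ι) (π : ι → ZMod p)
    (hpos : ∀ ξ : ZMod p, ∃ r : ℝ, 0 ≤ r ∧ ∑ q ∈ Q, ee (ξ * π q) = (r : ℂ))
    (A B C D E : Finset (ZMod p)) (hAB : A ⊆ B) (hCD : C ⊆ D) (hC : C.Nonempty) (hB : B.Nonempty)
    (α η : ℝ) (hα : (A.card : ℝ) = α * B.card) (hη0 : 0 ≤ η) (hη : η ≤ α / 1000)
    (hsym : ∀ y ∈ B, -y ∈ B)
    (hD : ∀ v ∈ D, ((B.filter fun y => y - v ∉ B).card : ℝ) ≤ η * B.card)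
    (hQ1 : ∀ q ∈ Q, ((B.filter fun y => y - π q ∉ B).card : ℝ) ≤ η * B.card)
    (hQ2 : ∀ q ∈ Q, ((B.filter fun y => y + π q ∉ B).card : ℝ) ≤ η * B.card)
    (P : ℕ) (hP : 1 ≤ P) (hPe : Even P) (hDC : (D.card : ℝ) ≤ 2 ^ P * C.card)
    (hE : ∀ c ∈ D, ∀ q ∈ Q, c - π q ∈ E) (hED : (E.card : ℝ) ≤ 2 * D.card)
    (hfew : ∑ c ∈ C, cvv (ic A) c ≤ 1 / 2 * (α * A.card) * C.card) :
    Q.card * (1.01 * (α * A.card)) ^ (64 * P) ≤ ∑ q ∈ Q, crr (ic A) (π q) ^ (64 * P) := by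
  classical
  have hα0 : 0 ≤ α := by linarith
  set M := α * (A.card : ℝ) with hM
  have hM0 : 0 ≤ M := by positivity
  have hBc : (0 : ℝ) ≤ B.card := by positivity
  have hMη : 2 * α * (η * B.card) ≤ M / 500 := by
    rw [hM, hα]
    have : α * B.card * η ≤ α * B.card * (α / 1000) := by gcongr
    nlinarith
  have hMB : α ^ 2 * B.card = M := by rw [hM, hα]; ring
  set f : ZMod p → ℝ := fun y => ic A y - α * ic B y with hf
  -- convolution bound
  have hcv : ∀ c ∈ D, cvv f c ≤ cvv (ic A) c - M + M / 500 := by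
    intro c hc
    have e := bal_expand A B α (fun y => c - y)
    have hB' : ((B.filter fun y => c - y ∉ B).card : ℝ) ≤ η * B.card := by
      refine le_trans ?_ (hD c hc)
      have hss : (B.filter fun y => c - y ∉ B) ⊆ (B.filter fun y => y - c ∉ B) := by
        intro y hy
        rw [mem_filter] at hy ⊢
        refine ⟨hy.1, fun h2 => hy.2 ?_⟩
        have := hsym _ h2
        rwa [neg_sub] at this
      exact_mod_cast card_le_card hss
    have s1 := shift_dev A B hAB (fun y => c - y) _ hB'
    have s2 : ∑ y, ic B y * ic A (c - y) = ∑ y, ic A y * ic B (c - y) := by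
      rw [← (Equiv.subLeft c).sum_comp]
      refine sum_congr rfl fun y _ => ?_
      simp only [Equiv.subLeft_apply, sub_sub_cancel]; ring
    have s3 := shift_dev B B subset_rfl (fun y => c - y) _ hB'
    have e' : cvv f c = cvv (ic A) c - α * (∑ y, ic A y * ic B (c - y)) - α * (∑ y, ic B y * ic A (c - y))
        + α ^ 2 * ∑ y, ic B y * ic B (c - y) := e
    rw [e', s2]
    have h1 := mul_le_mul_of_nonneg_left s1.1 hα0
    have h2 := mul_le_mul_of_nonneg_left s3.2 (sq_nonneg α)
    nlinarith
  have hcr : ∀ q ∈ Q, |crr f (π q) + M| ≤ crr (ic A) (π q) + M / 500 := by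
    intro q hq
    have e' : crr f (π q) = crr (ic A) (π q) - α * (∑ y, ic A y * ic B (y + π q))
        - α * (∑ y, ic B y * ic A (y + π q))
        + α ^ 2 * ∑ y, ic B y * ic B (y + π q) := bal_expand A B α (fun y => y + π q)
    have s1 := shift_dev A B hAB (fun y => y + π q) _ (hQ2 q hq)
    have s2 : ∑ y, ic B y * ic A (y + π q) = ∑ y, ic A y * ic B (y - π q) := by
      rw [← (Equiv.subRight (π q)).sum_comp]
      refine sum_congr rfl fun y _ => ?_
      simp only [Equiv.subRight_apply, sub_add_cancel]; ring
    have s2' := shift_dev A B hAB (fun y => y - π q) _ (hQ1 q hq)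
    have s3 := shift_dev B B subset_rfl (fun y => y + π q) _ (hQ2 q hq)
    rw [e', s2]
    have h1 := mul_le_mul_of_nonneg_left s1.1 hα0
    have h1' := mul_le_mul_of_nonneg_left s1.2 hα0
    have h2 := mul_le_mul_of_nonneg_left s2'.1 hα0
    have h2' := mul_le_mul_of_nonneg_left s2'.2 hα0
    have h3 := mul_le_mul_of_nonneg_left s3.1 (sq_nonneg α)
    have h3' := mul_le_mul_of_nonneg_left s3.2 (sq_nonneg α)
    have hα1 : α ≤ 1 := by
      have : (A.card : ℝ) ≤ B.card := by exact_mod_cast card_le_card hAB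
      have hBp : (0 : ℝ) < B.card := by exact_mod_cast hB.card_pos
      rw [hα] at this
      nlinarith
    have hcr0 : 0 ≤ crr (ic A) (π q) := sum_nonneg fun y _ => mul_nonneg (ic_nonneg _ _) (ic_nonneg _ _)
    have h4 : α ^ 2 * (η * B.card) ≤ α * (η * B.card) := by
      have : 0 ≤ η * B.card := by positivity
      nlinarith [mul_nonneg hα0 this]
    rw [abs_le]
    constructor <;> nlinarith
  -- Jensen
  have hCp : (0 : ℝ) < C.card := by exact_mod_cast hC.card_pos
  have j1 : ∑ c ∈ C, cvv f c ≤ -(M / 4) * C.card := by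
    calc ∑ c ∈ C, cvv f c ≤ ∑ c ∈ C, (cvv (ic A) c + (- M + M / 500)) :=
          sum_le_sum fun c hc => by linarith [hcv c (hCD hc)]
      _ = ∑ c ∈ C, cvv (ic A) c + C.card * (- M + M / 500) := by
          rw [sum_add_distrib, sum_const, nsmul_eq_mul]
      _ ≤ _ := by nlinarith
  have j2 : C.card * (M / 4) ^ P ≤ ∑ c ∈ C, cvv f c ^ P := by
    have h1 := Real.pow_arith_mean_le_arith_mean_pow_of_even C (fun _ => (C.card : ℝ)⁻¹) (fun c => cvv f c)
      (fun _ _ => by positivity) (by rw [sum_const, nsmul_eq_mul, mul_inv_cancel₀ hCp.ne']) hPe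
    rw [← mul_sum, ← mul_sum, mul_pow] at h1
    have h2 : (M / 4 * C.card) ^ P ≤ (∑ c ∈ C, cvv f c) ^ P := by
      rw [← Even.pow_abs hPe (∑ c ∈ C, cvv f c)]
      apply pow_le_pow_left₀ (by positivity)
      rw [le_abs]; right; linarith
    have h3 : (M / 4) ^ P ≤ (C.card : ℝ)⁻¹ * ∑ c ∈ C, cvv f c ^ P := by
      refine le_trans ?_ h1
      calc (M / 4) ^ P = ((C.card : ℝ)⁻¹) ^ P * (M / 4 * C.card) ^ P := by
            rw [← mul_pow]; congr 1; field_simp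
        _ ≤ _ := by gcongr
    rw [← div_eq_inv_mul, le_div_iff₀ hCp] at h3
    linarith
  have j3 : D.card * (M / 8) ^ P ≤ ∑ c ∈ D, cvv f c ^ P := by
    calc D.card * (M / 8) ^ P ≤ (2 ^ P * C.card) * (M / 8) ^ P := by gcongr
      _ = C.card * (M / 4) ^ P := by
        rw [show M / 4 = 2 * (M / 8) by ring, mul_pow]; ring
      _ ≤ _ := j2
      _ ≤ _ := sum_le_sum_of_subset_of_nonneg hCD fun c _ _ => hPe.pow_nonneg _
  have hDp : (0 : ℝ) < D.card := by exact_mod_cast (hC.mono hCD).card_pos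
  -- choose u
  have j4 : Q.card * (M / 16) ^ P ≤ ∑ q ∈ Q, crr f (π q) ^ P := by
    by_contra hcon
    push Not at hcon
    have a1 : ∀ u ∈ E, ∑ q ∈ Q, cvv f (u + π q) ^ P ≤ ∑ q ∈ Q, crr f (π q) ^ P :=
      fun u _ => (cvv_le_crr Q π hpos f u P).1
    have a2 : ∑ u ∈ E, ∑ q ∈ Q, cvv f (u + π q) ^ P ≤ E.card * ∑ q ∈ Q, crr f (π q) ^ P := by
      refine (sum_le_sum a1).trans ?_
      rw [sum_const, nsmul_eq_mul]
    have a3 : Q.card * (D.card * (M / 8) ^ P) ≤ ∑ u ∈ E, ∑ q ∈ Q, cvv f (u + π q) ^ P := by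
      rw [sum_comm, ← nsmul_eq_mul, ← sum_const]
      refine sum_le_sum fun q hq => j3.trans ?_
      have hi : ∑ u ∈ D.image (fun c => c - π q), cvv f (u + π q) ^ P = ∑ c ∈ D, cvv f c ^ P := by
        rw [sum_image (by intro x _ y _ h; simpa using h)]
        simp
      rw [← hi]
      apply sum_le_sum_of_subset_of_nonneg
      · intro u hu
        rw [mem_image] at hu
        obtain ⟨c, hc, rfl⟩ := hu
        exact hE c hc q hq
      · intro u _ _; exact hPe.pow_nonneg _
    have hE0 : (0 : ℝ) ≤ ∑ q ∈ Q, crr f (π q) ^ P := (cvv_le_crr Q π hpos f 0 P).2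
    have a4 : Q.card * (D.card * (M / 8) ^ P) ≤ 2 * D.card * ∑ q ∈ Q, crr f (π q) ^ P :=
      (a3.trans a2).trans (by gcongr)
    have a5 : Q.card * (M / 8) ^ P ≤ 2 * ∑ q ∈ Q, crr f (π q) ^ P := by
      refine le_of_mul_le_mul_left ?_ hDp
      linarith
    have a6 : 2 * (M / 16) ^ P ≤ (M / 8) ^ P := by
      rw [show M / 8 = 2 * (M / 16) by ring, mul_pow]
      gcongr
      calc (2 : ℝ) = 2 ^ 1 := by norm_num
        _ ≤ 2 ^ P := by gcongr; norm_num
    have a7 : (Q.card : ℝ) * (2 * (M / 16) ^ P) ≤ Q.card * (M / 8) ^ P := by gcongr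
    linarith
  have j5 := binom_lower Q (fun q => crr f (π q)) M hM0 P hP
    (fun j => (cvv_le_crr Q π hpos f 0 j).2) j4
  exact moment_final Q (fun q => crr f (π q)) (fun q => crr (ic A) (π q)) M hM0 P hP
    (fun q _ => sum_nonneg fun y _ => mul_nonneg (ic_nonneg _ _) (ic_nonneg _ _)) hcr j5

/-! ## Sifting -/

lemma ic_shift_sum {p : ℕ} [NeZero p] (A : Finset (ZMod p)) (t : ZMod p) :
    ∑ y, ic A (y + t) = A.card := by
  rw [← ic_sum A]
  exact Equiv.sum_comp (Equiv.addRight t) (ic A)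

lemma crr_pow {p : ℕ} [NeZero p] (A : Finset (ZMod p)) (u b1 b2 : ZMod p) (k : ℕ) :
    crr (ic A) (u + b1 - b2) ^ k
      = ∑ x : Fin k → ZMod p, (∏ i, ic A (x i + (u + b1))) * (∏ i, ic A (x i + b2)) := by
  have : crr (ic A) (u + b1 - b2) = ∑ y, ic A (y + (u + b1)) * ic A (y + b2) := by
    unfold crr
    rw [← Equiv.sum_comp (Equiv.addRight b2)]
    refine sum_congr rfl fun y _ => ?_
    simp only [Equiv.coe_addRight]
    rw [mul_comm]; congr 2; ring
  rw [this, Fintype.sum_pow]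
  refine sum_congr rfl fun x _ => ?_
  rw [prod_mul_distrib]

lemma sum_prod_ic {p : ℕ} [NeZero p] (A : Finset (ZMod p)) (t : ZMod p) (k : ℕ) :
    ∑ x : Fin k → ZMod p, (∏ i, ic A (x i + t)) = (A.card : ℝ) ^ k := by
  rw [← ic_shift_sum A t, Fintype.sum_pow]

lemma weights_card {p k : ℕ} [NeZero p] (A B : Finset (ZMod p)) (t : ZMod p) (x : Fin k → ZMod p)
    (g : ZMod p → ℝ) : 
    ∑ b ∈ B, (∏ i, ic A (x i + (t + b))) * g b = ∑ b ∈ B.filter (fun b => ∀ i, x i + (t + b) ∈ A), g b := by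
  classical
  rw [sum_filter]
  refine sum_congr rfl fun b _ => ?_
  unfold ic
  rw [prod_ite_zero]
  simp

lemma sift_core {p : ℕ} [NeZero p] (A B1 B2 : Finset (ZMod p)) (hA : A.Nonempty) (hB1 : B1.Nonempty)
    (hB2 : B2.Nonempty)
    (α : ℝ) (hα : 0 < α) (k : ℕ) (hk : 1600 ≤ k) (u : ZMod p)
    (h : (B1.card : ℝ) * B2.card * (1.01 * (α * A.card)) ^ k
      ≤ ∑ b1 ∈ B1, ∑ b2 ∈ B2, crr (ic A) (u + b1 - b2) ^ k) :
    ∃ A1 A2 : Finset (ZMod p), A1 ⊆ B1 ∧ A2 ⊆ B2 ∧ α ^ k / 8 * B1.card ≤ A1.card ∧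
      α ^ k / 8 * B2.card ≤ A2.card ∧
      ∑ a1 ∈ A1, ∑ a2 ∈ A2, (if crr (ic A) (u + a1 - a2) < 1.005 * (α * A.card) then (1 : ℝ) else 0)
        ≤ 1 / 1000 * (A1.card * A2.card) := by
  classical
  set M := α * (A.card : ℝ) with hM
  have hAp : (0 : ℝ) < A.card := by exact_mod_cast hA.card_pos
  have hB1p : (0 : ℝ) < B1.card := by exact_mod_cast hB1.card_pos
  have hB2p : (0 : ℝ) < B2.card := by exact_mod_cast hB2.card_pos
  have hMp : 0 < M := by positivity
  set bd : ZMod p → ℝ := fun v => if crr (ic A) v < 1.005 * M then (1 : ℝ) else 0 with hbd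
  have hbd0 : ∀ v, 0 ≤ bd v := fun v => by simp only [hbd]; split_ifs <;> norm_num
  set A1 : (Fin k → ZMod p) → Finset (ZMod p) :=
    fun x => B1.filter (fun b => ∀ i, x i + (u + b) ∈ A) with hA1
  set A2 : (Fin k → ZMod p) → Finset (ZMod p) :=
    fun x => B2.filter (fun b => ∀ i, x i + (0 + b) ∈ A) with hA2
  -- general weighted identity
  have key : ∀ g : ZMod p → ℝ, ∑ b1 ∈ B1, ∑ b2 ∈ B2, crr (ic A) (u + b1 - b2) ^ k * g (u + b1 - b2)
      = ∑ x, ∑ a1 ∈ A1 x, ∑ a2 ∈ A2 x, g (u + a1 - a2) := by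
    intro g
    have e : ∀ x, ∑ a1 ∈ A1 x, ∑ a2 ∈ A2 x, g (u + a1 - a2)
        = ∑ b1 ∈ B1, ∑ b2 ∈ B2, (∏ i, ic A (x i + (u + b1))) * (∏ i, ic A (x i + b2)) * g (u + b1 - b2) := by
      intro x
      rw [hA1, ← weights_card]
      refine sum_congr rfl fun b1 _ => ?_
      rw [hA2, ← weights_card, mul_sum]
      refine sum_congr rfl fun b2 _ => ?_
      rw [zero_add]; ring
    simp_rw [e]
    rw [sum_comm (s := univ) (t := B1)]
    refine sum_congr rfl fun b1 _ => ?_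
    rw [sum_comm (s := univ) (t := B2)]
    refine sum_congr rfl fun b2 _ => ?_
    rw [crr_pow, sum_mul]
  have kone := key (fun _ => 1)
  simp only [mul_one, sum_const, nsmul_eq_mul] at kone
  set T := ∑ x, ((A1 x).card : ℝ) * (A2 x).card with hT
  have hTl : (B1.card : ℝ) * B2.card * (1.01 * M) ^ k ≤ T := by rw [← kone]; exact h
  have hTp : 0 < T := lt_of_lt_of_le (by positivity) hTl
  -- bad part
  have hbad : ∑ x, ∑ a1 ∈ A1 x, ∑ a2 ∈ A2 x, bd (u + a1 - a2) ≤ 1 / 2000 * T := by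
    rw [← key]
    calc ∑ b1 ∈ B1, ∑ b2 ∈ B2, crr (ic A) (u + b1 - b2) ^ k * bd (u + b1 - b2)
        ≤ ∑ b1 ∈ B1, ∑ b2 ∈ B2, (1.005 * M) ^ k := by
          refine sum_le_sum fun b1 _ => sum_le_sum fun b2 _ => ?_
          simp only [hbd]
          split_ifs with hc
          · rw [mul_one]
            exact pow_le_pow_left₀ (sum_nonneg fun y _ => mul_nonneg (ic_nonneg _ _) (ic_nonneg _ _)) hc.le _
          · rw [mul_zero]; positivity
      _ = (1.005 / 1.01) ^ k * (B1.card * B2.card * (1.01 * M) ^ k) := by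
          rw [sum_const, sum_const, nsmul_eq_mul, nsmul_eq_mul, div_pow, mul_pow _ M, mul_pow _ M]
          field_simp
      _ ≤ 1 / 2000 * T := by
          have : (1.005 / 1.01 : ℝ) ^ k ≤ 1 / 2000 := by
            refine (pow_le_pow_of_le_one (by norm_num) (by norm_num) hk).trans ?_
            have h8 : (1.005 / 1.01 : ℝ) ^ 200 ≤ 0.3708 := by norm_num
            calc (1.005 / 1.01 : ℝ) ^ 1600 = ((1.005 / 1.01 : ℝ) ^ 200) ^ 8 := by rw [← pow_mul]
              _ ≤ 0.3708 ^ 8 := by gcongr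
              _ ≤ _ := by norm_num
          gcongr
  -- small part
  have hs1 : ∑ x, ((A1 x).card : ℝ) = B1.card * (A.card : ℝ) ^ k := by
    have : ∀ x, ((A1 x).card : ℝ) = ∑ b ∈ B1, (∏ i, ic A (x i + (u + b))) := by
      intro x
      have := weights_card A B1 u x (fun _ => 1)
      simp only [mul_one, sum_const, nsmul_eq_mul] at this
      rw [this]
    simp_rw [this]
    rw [sum_comm]
    simp_rw [sum_prod_ic]
    rw [sum_const, nsmul_eq_mul]
  have hs2 : ∑ x, ((A2 x).card : ℝ) = B2.card * (A.card : ℝ) ^ k := by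
    have : ∀ x, ((A2 x).card : ℝ) = ∑ b ∈ B2, (∏ i, ic A (x i + (0 + b))) := by
      intro x
      have := weights_card A B2 0 x (fun _ => 1)
      simp only [mul_one, sum_const, nsmul_eq_mul] at this
      rw [this]
    simp_rw [this]
    rw [sum_comm]
    simp_rw [sum_prod_ic]
    rw [sum_const, nsmul_eq_mul]
  by_contra hcon
  push Not at hcon
  set τ := α ^ k / 8 with hτ
  have hτp : 0 < τ := by positivity
  have pt : ∀ x, ((A1 x).card : ℝ) * (A2 x).card ≤ τ * B1.card * (A2 x).card + τ * B2.card * (A1 x).card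
      + 1000 * ∑ a1 ∈ A1 x, ∑ a2 ∈ A2 x, bd (u + a1 - a2) := by
    intro x
    have n1 : (0 : ℝ) ≤ (A1 x).card := by positivity
    have n2 : (0 : ℝ) ≤ (A2 x).card := by positivity
    have n3 : 0 ≤ ∑ a1 ∈ A1 x, ∑ a2 ∈ A2 x, bd (u + a1 - a2) :=
      sum_nonneg fun _ _ => sum_nonneg fun _ _ => hbd0 _
    have n4 : 0 ≤ τ * B1.card * (A2 x).card := by positivity
    have n5 : 0 ≤ τ * B2.card * (A1 x).card := by positivity
    by_cases c1 : τ * B1.card ≤ (A1 x).card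
    · by_cases c2 : τ * B2.card ≤ (A2 x).card
      · have := hcon (A1 x) (A2 x) (filter_subset _ _) (filter_subset _ _) c1 c2
        have h' : 1 / 1000 * (((A1 x).card : ℝ) * (A2 x).card)
          < ∑ a1 ∈ A1 x, ∑ a2 ∈ A2 x, bd (u + a1 - a2) := this
        linarith
      · push Not at c2
        have := mul_le_mul_of_nonneg_left c2.le n1
        linarith
    · push Not at c1
      have := mul_le_mul_of_nonneg_right c1.le n2
      linarith
  have tot := sum_le_sum fun x (_ : x ∈ (univ : Finset (Fin k → ZMod p))) => pt x
  rw [sum_add_distrib, sum_add_distrib, ← mul_sum, ← mul_sum, ← mul_sum, hs1, hs2] at tot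
  have hM1 : α ^ k * (A.card : ℝ) ^ k ≤ (1.01 * M) ^ k := by
    rw [← mul_pow, ← hM]
    exact pow_le_pow_left₀ hMp.le (by linarith) _
  have sm : τ * B1.card * (B2.card * (A.card : ℝ) ^ k) + τ * B2.card * (B1.card * (A.card : ℝ) ^ k) ≤ T / 4 := by
    calc _ = (B1.card * B2.card * (α ^ k * (A.card : ℝ) ^ k)) / 4 := by rw [hτ]; ring
      _ ≤ (B1.card * B2.card * (1.01 * M) ^ k) / 4 := by gcongr
      _ ≤ _ := by linarith
  linarith

lemma sift {p : ℕ} [NeZero p] (A B1 B2 : Finset (ZMod p)) (hA : A.Nonempty) (hB1 : B1.Nonempty)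
    (hB2 : B2.Nonempty)
    (α : ℝ) (hα : 0 < α) (k : ℕ) (hk : 1600 ≤ k)
    (h : (((B1 ×ˢ B1) ×ˢ (B2 ×ˢ B2)).card : ℝ) * (1.01 * (α * A.card)) ^ k
      ≤ ∑ q ∈ (B1 ×ˢ B1) ×ˢ (B2 ×ˢ B2), crr (ic A) (q.1.1 - q.1.2 + q.2.1 - q.2.2) ^ k) :
    ∃ (u : ZMod p) (A1 A2 : Finset (ZMod p)), A1 ⊆ B1 ∧ A2 ⊆ B2 ∧ α ^ k / 8 * B1.card ≤ A1.card ∧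
      α ^ k / 8 * B2.card ≤ A2.card ∧
      ∑ a1 ∈ A1, ∑ a2 ∈ A2, (if crr (ic A) (u + a1 - a2) < 1.005 * (α * A.card) then (1 : ℝ) else 0)
        ≤ 1 / 1000 * (A1.card * A2.card) := by
  classical
  suffices ∃ u, (B1.card : ℝ) * B2.card * (1.01 * (α * A.card)) ^ k
      ≤ ∑ b1 ∈ B1, ∑ b2 ∈ B2, crr (ic A) (u + b1 - b2) ^ k by
    obtain ⟨u, hu⟩ := this
    exact ⟨u, sift_core A B1 B2 hA hB1 hB2 α hα k hk u hu⟩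
  by_contra hcon
  push Not at hcon
  have hlt : ∑ c1 ∈ B1, ∑ c2 ∈ B2, ∑ b1 ∈ B1, ∑ b2 ∈ B2, crr (ic A) ((c2 - c1) + b1 - b2) ^ k
      < ∑ c1 ∈ B1, ∑ c2 ∈ B2, (B1.card : ℝ) * B2.card * (1.01 * (α * A.card)) ^ k :=
    sum_lt_sum_of_nonempty hB1 fun c1 _ => sum_lt_sum_of_nonempty hB2 fun c2 _ => hcon _
  have e1 : ∑ q ∈ (B1 ×ˢ B1) ×ˢ (B2 ×ˢ B2), crr (ic A) (q.1.1 - q.1.2 + q.2.1 - q.2.2) ^ k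
      = ∑ c1 ∈ B1, ∑ c2 ∈ B2, ∑ b1 ∈ B1, ∑ b2 ∈ B2, crr (ic A) ((c2 - c1) + b1 - b2) ^ k := by
    simp only [sum_product]
    rw [sum_comm]
    refine sum_congr rfl fun c1 _ => ?_
    rw [sum_comm]
    refine sum_congr rfl fun c2 _ => ?_
    refine sum_congr rfl fun b1 _ => ?_
    refine sum_congr rfl fun b2 _ => ?_
    congr 2; ring
  rw [e1] at h
  simp only [sum_const, nsmul_eq_mul] at hlt
  have := lt_of_le_of_lt h hlt
  simp only [card_product] at this
  push_cast at this
  exact absurd this (not_lt.mpr (le_of_eq (by ring)))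

/-! ## Almost periodicity by sampling -/

lemma mgf_bd {ι : Type*} (A : Finset ι) (Z : ι → ℝ) (hZ : ∀ a ∈ A, |Z a| ≤ 1) (hs : ∑ a ∈ A, Z a = 0)
    (t : ℝ) : ∑ a ∈ A, Real.exp (t * Z a) ≤ A.card * Real.exp (t ^ 2 / 2) := by
  calc ∑ a ∈ A, Real.exp (t * Z a) ≤ ∑ a ∈ A, (Real.cosh t + Z a * Real.sinh t) := by
        refine sum_le_sum fun a ha => ?_
        rw [mul_comm]
        exact Real.exp_mul_le_cosh_add_mul_sinh (hZ a ha) t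
    _ = A.card * Real.cosh t := by
        rw [sum_add_distrib, ← sum_mul, hs, sum_const, nsmul_eq_mul]; ring
    _ ≤ _ := by
        gcongr
        exact Real.cosh_le_exp_half_sq t

lemma hoeff_one {ι : Type*} (A : Finset ι) (Z : ι → ℝ) (hZ : ∀ a ∈ A, |Z a| ≤ 1)
    (hs : ∑ a ∈ A, Z a = 0) (n : ℕ) (ε : ℝ) (hε : 0 ≤ ε) :
    ((((Fintype.piFinset fun _ : Fin n => A).filter fun x => n * ε < ∑ i, Z (x i)).card : ℕ) : ℝ)
      ≤ Real.exp (-(n * ε ^ 2 / 2)) * A.card ^ n := by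
  have h1 : ∑ x ∈ Fintype.piFinset (fun _ : Fin n => A), Real.exp (ε * ∑ i, Z (x i))
      ≤ (A.card * Real.exp (ε ^ 2 / 2)) ^ n := by
    have : ∑ x ∈ Fintype.piFinset (fun _ : Fin n => A), Real.exp (ε * ∑ i, Z (x i))
        = (∑ a ∈ A, Real.exp (ε * Z a)) ^ n := by
      have := Finset.prod_univ_sum (fun _ : Fin n => A) (fun _ a => Real.exp (ε * Z a))
      rw [prod_const, card_univ, Fintype.card_fin] at this
      rw [this]
      refine sum_congr rfl fun x _ => ?_
      rw [mul_sum, Real.exp_sum]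
    rw [this]
    exact pow_le_pow_left₀ (sum_nonneg fun _ _ => (Real.exp_pos _).le) (mgf_bd A Z hZ hs ε) n
  have h2 : (((Fintype.piFinset fun _ : Fin n => A).filter fun x => n * ε < ∑ i, Z (x i)).card : ℝ)
      * Real.exp (ε * (n * ε)) ≤ ∑ x ∈ Fintype.piFinset (fun _ : Fin n => A), Real.exp (ε * ∑ i, Z (x i)) := by
    rw [← nsmul_eq_mul, ← sum_const]
    calc _ ≤ ∑ x ∈ (Fintype.piFinset fun _ : Fin n => A).filter fun x => n * ε < ∑ i, Z (x i),
          Real.exp (ε * ∑ i, Z (x i)) := by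
            refine sum_le_sum fun x hx => ?_
            rw [mem_filter] at hx
            apply Real.exp_le_exp.mpr
            exact mul_le_mul_of_nonneg_left hx.2.le hε
      _ ≤ _ := sum_le_sum_of_subset_of_nonneg (filter_subset _ _) fun _ _ _ => (Real.exp_pos _).le
  have h3 := h2.trans h1
  rw [← le_div_iff₀ (Real.exp_pos _)] at h3
  refine h3.trans (le_of_eq ?_)
  rw [mul_pow, ← Real.exp_nat_mul, div_eq_mul_inv, ← Real.exp_neg, mul_assoc, ← Real.exp_add, mul_comm]
  congr 2; ring

lemma hoeff_two {ι : Type*} (A : Finset ι) (Z : ι → ℝ) (hZ : ∀ a ∈ A, |Z a| ≤ 1)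
    (hs : ∑ a ∈ A, Z a = 0) (n : ℕ) (ε : ℝ) (hε : 0 ≤ ε) :
    ((((Fintype.piFinset fun _ : Fin n => A).filter fun x => n * ε < |∑ i, Z (x i)|).card : ℕ) : ℝ)
      ≤ 2 * Real.exp (-(n * ε ^ 2 / 2)) * A.card ^ n := by
  classical
  have h1 := hoeff_one A Z hZ hs n ε hε
  have h2 := hoeff_one A (fun a => - Z a) (fun a ha => by rw [abs_neg]; exact hZ a ha)
    (by rw [sum_neg_distrib, hs, neg_zero]) n ε hε
  have h3 : ((Fintype.piFinset fun _ : Fin n => A).filter fun x => n * ε < |∑ i, Z (x i)|)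
      ⊆ ((Fintype.piFinset fun _ : Fin n => A).filter fun x => n * ε < ∑ i, Z (x i))
        ∪ ((Fintype.piFinset fun _ : Fin n => A).filter fun x => n * ε < ∑ i, - Z (x i)) := by
    intro x hx
    rw [mem_filter] at hx
    rw [mem_union, mem_filter, mem_filter]
    rcases lt_abs.mp hx.2 with h | h
    · left; exact ⟨hx.1, h⟩
    · right; exact ⟨hx.1, by rw [sum_neg_distrib]; exact h⟩
  have h4 := (card_le_card h3).trans (card_union_le _ _)
  have h5 : ((((Fintype.piFinset fun _ : Fin n => A).filter fun x => n * ε < |∑ i, Z (x i)|).card : ℕ) : ℝ)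
    ≤ ((((Fintype.piFinset fun _ : Fin n => A).filter fun x => n * ε < ∑ i, Z (x i)).card : ℕ) : ℝ)
      + ((((Fintype.piFinset fun _ : Fin n => A).filter fun x => n * ε < ∑ i, - Z (x i)).card : ℕ) : ℝ) := by
    exact_mod_cast h4
  linarith

noncomputable def avg {p : ℕ} (A : Finset (ZMod p)) (F : ZMod p → ℝ) (y : ZMod p) : ℝ :=
  (A.card : ℝ)⁻¹ * ∑ a ∈ A, F (a + y)

lemma avg_nonneg {p : ℕ} (A : Finset (ZMod p)) (F : ZMod p → ℝ) (hF : ∀ y, 0 ≤ F y) (y : ZMod p) :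
    0 ≤ avg A F y := by
  unfold avg
  exact mul_nonneg (by positivity) (sum_nonneg fun a _ => hF _)

lemma avg_le_one {p : ℕ} (A : Finset (ZMod p)) (hA : A.Nonempty) (F : ZMod p → ℝ) (hF : ∀ y, F y ≤ 1)
    (y : ZMod p) : avg A F y ≤ 1 := by
  unfold avg
  have : (0 : ℝ) < A.card := by exact_mod_cast hA.card_pos
  rw [inv_mul_le_iff₀ this, mul_one]
  calc ∑ a ∈ A, F (a + y) ≤ ∑ a ∈ A, 1 := sum_le_sum fun a _ => hF _
    _ = _ := by simp

lemma croot_sisask {p : ℕ} [NeZero p] (A1 B4 E R : Finset (ZMod p)) (hA1 : A1.Nonempty)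
    (F : ZMod p → ℝ) (hF0 : ∀ y, 0 ≤ F y) (hF1 : ∀ y, F y ≤ 1)
    (hE : ∀ a ∈ A1, ∀ b ∈ B4, a + b ∈ E) (n : ℕ) (hn : 1 ≤ n) (ε : ℝ) (hε : 0 < ε) :
    ∃ T ⊆ B4, (A1.card : ℝ) ^ n * B4.card ≤ 2 * T.card * (E.card : ℝ) ^ n ∧
      ∀ b ∈ T, ∀ b' ∈ T, (((univ.filter fun y => y + b ∈ R ∧ y + b' ∈ R ∧
        2 * ε < |avg A1 F (y + b) - avg A1 F (y + b')|).card : ℕ) : ℝ)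
        ≤ 8 * Real.exp (-(n * ε ^ 2 / 2)) * R.card := by
  classical
  have hAp : (0 : ℝ) < A1.card := by exact_mod_cast hA1.card_pos
  have hnp : (0 : ℝ) < n := by exact_mod_cast hn
  set κ := Real.exp (-(n * ε ^ 2 / 2)) with hκ
  have hκp : 0 < κ := Real.exp_pos _
  set X : Finset (Fin n → ZMod p) := Fintype.piFinset fun _ : Fin n => A1 with hX
  have hXc : (X.card : ℝ) = (A1.card : ℝ) ^ n := by
    rw [hX, Fintype.card_piFinset]; simp
  set N : (Fin n → ZMod p) → Finset (ZMod p) := fun x => R.filter fun y =>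
    n * ε < |∑ i, (F (x i + y) - avg A1 F y)| with hN
  have hoe : ∀ y, ((X.filter fun x => n * ε < |∑ i, (F (x i + y) - avg A1 F y)|).card : ℝ)
      ≤ 2 * κ * A1.card ^ n := by
    intro y
    refine hoeff_two A1 (fun a => F (a + y) - avg A1 F y) ?_ ?_ n ε hε.le
    · intro a _
      have h1 := hF0 (a + y)
      have h2 := hF1 (a + y)
      have h3 := avg_nonneg A1 F hF0 y
      have h4 := avg_le_one A1 hA1 F hF1 y
      rw [abs_le]; constructor <;> linarith
    · rw [sum_sub_distrib, sum_const, nsmul_eq_mul]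
      unfold avg
      rw [← mul_assoc, mul_inv_cancel₀ hAp.ne', one_mul, sub_self]
  have hNsum : ∑ x ∈ X, ((N x).card : ℝ) ≤ R.card * (2 * κ * A1.card ^ n) := by
    have : ∑ x ∈ X, ((N x).card : ℝ)
        = ∑ y ∈ R, ((X.filter fun x => n * ε < |∑ i, (F (x i + y) - avg A1 F y)|).card : ℝ) := by
      simp only [hN, card_filter]
      push_cast
      rw [sum_comm]
    rw [this]
    refine (sum_le_sum fun y _ => hoe y).trans ?_
    rw [sum_const, nsmul_eq_mul]
  set Gd := X.filter fun x => ((N x).card : ℝ) ≤ 4 * κ * R.card with hGd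
  have hGdc : (A1.card : ℝ) ^ n ≤ 2 * Gd.card := by
    rcases Nat.eq_zero_or_pos R.card with hR | hR
    · have : Gd = X := by
        rw [hGd]; apply filter_true_of_mem
        intro x _
        have : (N x).card ≤ R.card := card_le_card (filter_subset _ _)
        have h0 : (N x).card = 0 := by omega
        rw [h0, hR]; simp
      rw [this, hXc]; linarith [pow_pos hAp n]
    · have hRp : (0 : ℝ) < R.card := by exact_mod_cast hR
      have h1 : ((X.filter fun x => ¬ ((N x).card : ℝ) ≤ 4 * κ * R.card).card : ℝ) * (4 * κ * R.card)
          ≤ ∑ x ∈ X, ((N x).card : ℝ) := by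
        rw [← nsmul_eq_mul, ← sum_const]
        calc _ ≤ ∑ x ∈ X.filter (fun x => ¬ ((N x).card : ℝ) ≤ 4 * κ * R.card), ((N x).card : ℝ) := by
              refine sum_le_sum fun x hx => ?_
              rw [mem_filter] at hx
              exact (not_le.mp hx.2).le
          _ ≤ _ := sum_le_sum_of_subset_of_nonneg (filter_subset _ _) fun _ _ _ => by positivity
      have h2 := h1.trans hNsum
      have h3 : ((X.filter fun x => ¬ ((N x).card : ℝ) ≤ 4 * κ * R.card).card : ℝ) * 2
          ≤ (A1.card : ℝ) ^ n := by
        have hp : (0 : ℝ) < 2 * κ * R.card := by positivity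
        refine le_of_mul_le_mul_right ?_ hp
        linarith
      have h4 := card_filter_add_card_filter_not (s := X) (fun x => ((N x).card : ℝ) ≤ 4 * κ * R.card)
      have h5 : (Gd.card : ℝ) + ((X.filter fun x => ¬ ((N x).card : ℝ) ≤ 4 * κ * R.card).card : ℝ)
          = X.card := by exact_mod_cast h4
      rw [hXc] at h5
      linarith
  -- pigeonhole
  set En : Finset (Fin n → ZMod p) := Fintype.piFinset fun _ : Fin n => E with hEn
  have hEnc : (En.card : ℝ) = (E.card : ℝ) ^ n := by
    rw [hEn, Fintype.card_piFinset]; simp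
  have hmaps : ∀ z ∈ Gd ×ˢ B4, (fun i => z.1 i + z.2) ∈ En := by
    intro z hz
    rw [mem_product] at hz
    have hz1 : z.1 ∈ X := (mem_filter.mp hz.1).1
    rw [hEn, Fintype.mem_piFinset]
    intro i
    exact hE _ (Fintype.mem_piFinset.mp hz1 i) _ hz.2
  set fib : (Fin n → ZMod p) → Finset ((Fin n → ZMod p) × ZMod p) := fun c =>
    (Gd ×ˢ B4).filter fun z => (fun i => z.1 i + z.2) = c with hfib
  have hsumfib : ∑ c ∈ En, (fib c).card = (Gd ×ˢ B4).card :=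
    (card_eq_sum_card_fiberwise hmaps).symm
  rcases B4.eq_empty_or_nonempty with hB4 | hB4
  · refine ⟨∅, empty_subset _, ?_, ?_⟩
    · rw [hB4]; simp
    · simp
  have hEne : En.Nonempty := by
    obtain ⟨a, ha⟩ := hA1
    obtain ⟨b, hb⟩ := hB4
    exact ⟨fun _ => a + b, Fintype.mem_piFinset.mpr fun _ => hE a ha b hb⟩
  obtain ⟨c, hc, hcmax⟩ := exists_max_image En (fun c => (fib c).card) hEne
  refine ⟨(fib c).image Prod.snd, ?_, ?_, ?_⟩
  · intro b hb
    rw [mem_image] at hb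
    obtain ⟨z, hz, rfl⟩ := hb
    exact (mem_product.mp (mem_filter.mp hz).1).2
  · have hinj : ((fib c).image Prod.snd).card = (fib c).card := by
      apply card_image_of_injOn
      intro z hz z' hz' h
      have h1 := (mem_filter.mp hz).2
      have h2 := (mem_filter.mp hz').2
      refine Prod.ext ?_ h
      funext i
      have h3 := congrFun (h1.trans h2.symm) i
      simp only [h] at h3
      exact add_right_cancel h3
    rw [hinj]
    have h1 : (Gd ×ˢ B4).card ≤ En.card * (fib c).card := by
      rw [← hsumfib, ← smul_eq_mul, ← sum_const]
      exact sum_le_sum fun c' hc' => hcmax c' hc'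
    rw [card_product] at h1
    have h2 : (Gd.card : ℝ) * B4.card ≤ En.card * (fib c).card := by exact_mod_cast h1
    rw [hEnc] at h2
    calc (A1.card : ℝ) ^ n * B4.card ≤ (2 * Gd.card) * B4.card := by gcongr
      _ = 2 * (Gd.card * B4.card) := by ring
      _ ≤ 2 * ((E.card : ℝ) ^ n * (fib c).card) := by gcongr
      _ = _ := by ring
  · intro b hb b' hb'
    rw [mem_image] at hb hb'
    obtain ⟨⟨a, b0⟩, hz, rfl⟩ := hb
    obtain ⟨⟨a', b0'⟩, hz', rfl⟩ := hb'
    simp only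
    rw [hfib, mem_filter, mem_product] at hz hz'
    have ha := (mem_filter.mp hz.1.1).2
    have ha' := (mem_filter.mp hz'.1.1).2
    have hsub : (univ.filter fun y => y + b0 ∈ R ∧ y + b0' ∈ R ∧
        2 * ε < |avg A1 F (y + b0) - avg A1 F (y + b0')|)
        ⊆ ((N a).image fun y => y - b0) ∪ ((N a').image fun y => y - b0') := by
      intro y hy
      rw [mem_filter] at hy
      obtain ⟨-, hy1, hy2, hy3⟩ := hy
      rw [mem_union, mem_image, mem_image]
      by_contra hcon
      push Not at hcon
      have g1 : y + b0 ∉ N a := fun h => hcon.1 _ h (by ring)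
      have g2 : y + b0' ∉ N a' := fun h => hcon.2 _ h (by ring)
      simp only [hN, mem_filter, not_and, not_lt] at g1 g2
      have g1' := g1 hy1
      have g2' := g2 hy2
      rw [sum_sub_distrib, sum_const, nsmul_eq_mul, card_univ, Fintype.card_fin] at g1' g2'
      have e : ∑ i, F (a i + (y + b0)) = ∑ i, F (a' i + (y + b0')) := by
        refine sum_congr rfl fun i _ => ?_
        have h1 := congrFun (hz.2.trans hz'.2.symm) i
        simp only at h1
        rw [show a i + (y + b0) = (a i + b0) + y by ring, h1]; congr 1; ring
      rw [e] at g1'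
      rw [abs_le] at g1' g2'
      have : |avg A1 F (y + b0) - avg A1 F (y + b0')| ≤ 2 * ε := by
        have h : n * |avg A1 F (y + b0) - avg A1 F (y + b0')| ≤ n * (2 * ε) := by
          rw [← abs_of_pos hnp, ← abs_mul, abs_of_pos hnp, abs_le]
          constructor <;> nlinarith
        exact le_of_mul_le_mul_left h hnp
      linarith
    have h1 := (card_le_card hsub).trans (card_union_le _ _)
    have h2 : (((univ.filter fun y => y + b0 ∈ R ∧ y + b0' ∈ R ∧
        2 * ε < |avg A1 F (y + b0) - avg A1 F (y + b0')|).card : ℕ) : ℝ)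
        ≤ (N a).card + (N a').card := by
      exact_mod_cast h1.trans (add_le_add card_image_le card_image_le)
    linarith

/-! ## Local Chang lemma -/

def dis3 {p : ℕ} [NeZero p] (B : Finset (ZMod p)) (κ : ℝ) (L : Finset (ZMod p)) : Prop :=
  ∀ c : ZMod p → ℤ, (∀ l, c l ∈ ({-1, 0, 1} : Finset ℤ)) → (∀ l, l ∉ L → c l = 0) → c ≠ 0 →
    ‖∑ b ∈ B, ee ((∑ l, (c l : ZMod p) * l) * b)‖ ≤ κ * B.card

open Classical in
noncomputable def rzt {p : ℕ} (L : Finset (ZMod p)) (l : ZMod p) : Finset ℤ :=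
  if l ∈ L then {-1, 0, 1} else {0}

open Classical in
noncomputable def rzw {p : ℕ} (L : Finset (ZMod p)) (ω : ZMod p → ℂ) (l : ZMod p) (j : ℤ) : ℂ :=
  if l ∈ L then (if j = 0 then (Real.cosh (1 / 2) : ℂ) else
    if j = 1 then (Real.sinh (1 / 2) / 2 : ℂ) * ω l else (Real.sinh (1 / 2) / 2 : ℂ) * (starRingEnd ℂ) (ω l))
  else 1

lemma sum_three {M : Type*} [AddCommMonoid M] (f : ℤ → M) :
    ∑ j ∈ ({-1, 0, 1} : Finset ℤ), f j = f (-1) + (f 0 + f 1) := by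
  rw [sum_insert (by decide), sum_insert (by decide), sum_singleton]

lemma rz_factor {p : ℕ} [NeZero p] (L : Finset (ZMod p)) (ω : ZMod p → ℂ) (l b : ZMod p) :
    ∑ j ∈ rzt L l, rzw L ω l j * ee ((j : ZMod p) * l * b)
      = if l ∈ L then ((Real.cosh (1 / 2) + (ω l * ee (l * b)).re * Real.sinh (1 / 2) : ℝ) : ℂ) else 1 := by
  classical
  unfold rzt rzw
  split_ifs with h
  · rw [sum_three]
    simp only [if_true, Int.reduceNeg, neg_eq_zero, one_ne_zero, if_false, reduceCtorEq, zero_ne_one]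
    push_cast
    rw [show (-1 : ZMod p) * l * b = -(l * b) by ring, ee_neg, zero_mul, zero_mul, ee_zero, one_mul]
    have h1 : (((ω l * ee (l * b)).re : ℝ) : ℂ) = (ω l * ee (l * b) + (starRingEnd ℂ) (ω l * ee (l * b))) / 2 := by
      rw [Complex.add_conj]; push_cast; ring
    rw [h1, map_mul]
    norm_num
    ring
  · rw [sum_singleton]; simp [ee_zero]

lemma rz_norm {p : ℕ} [NeZero p] (L : Finset (ZMod p)) (ω : ZMod p → ℂ) (hω : ∀ l, ‖ω l‖ = 1) (l : ZMod p) :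
    ∑ j ∈ rzt L l, ‖rzw L ω l j‖ = if l ∈ L then Real.exp (1 / 2) else 1 := by
  classical
  have hs : 0 ≤ Real.sinh (1 / 2) := Real.sinh_nonneg_iff.mpr (by norm_num)
  unfold rzt rzw
  split_ifs with h
  · rw [sum_three]
    simp only [if_true, Int.reduceNeg, neg_eq_zero, one_ne_zero, if_false, reduceCtorEq, zero_ne_one]
    have e1 : ‖(Real.sinh (1 / 2) / 2 : ℂ)‖ = Real.sinh (1 / 2) / 2 := by
      rw [show ((Real.sinh (1 / 2) : ℝ) / 2 : ℂ) = ((Real.sinh (1 / 2) / 2 : ℝ) : ℂ) by push_cast; rfl]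
      rw [Complex.norm_real, Real.norm_of_nonneg (by linarith)]
    rw [norm_mul, norm_mul, RCLike.norm_conj, hω, e1, Complex.norm_real,
      Real.norm_of_nonneg (Real.cosh_pos _).le, ← Real.cosh_add_sinh]
    ring
  · rw [sum_singleton]; simp

lemma rz_sum {p : ℕ} [NeZero p] (B L : Finset (ZMod p)) (ω : ZMod p → ℂ) (hω : ∀ l, ‖ω l‖ = 1)
    (κ : ℝ) (hκ : 0 ≤ κ) (hd : dis3 B κ L) :
    ∑ b ∈ B, Real.exp (1 / 2 * ∑ l ∈ L, (ω l * ee (l * b)).re)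
      ≤ (Real.exp (L.card / 8) + κ * 3 ^ L.card) * B.card := by
  classical
  have h1 : ∀ b, Real.exp (1 / 2 * ∑ l ∈ L, (ω l * ee (l * b)).re)
      ≤ ∏ l ∈ L, (Real.cosh (1 / 2) + (ω l * ee (l * b)).re * Real.sinh (1 / 2)) := by
    intro b
    rw [mul_sum, Real.exp_sum]
    refine prod_le_prod (fun _ _ => (Real.exp_pos _).le) fun l _ => ?_
    rw [mul_comm]
    refine Real.exp_mul_le_cosh_add_mul_sinh ?_ _
    refine (Complex.abs_re_le_norm _).trans ?_
    rw [norm_mul, hω, ee_norm, one_mul]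
  have h2 : ∀ b, ((∏ l ∈ L, (Real.cosh (1 / 2) + (ω l * ee (l * b)).re * Real.sinh (1 / 2)) : ℝ) : ℂ)
      = ∑ c ∈ Fintype.piFinset (rzt L), (∏ l, rzw L ω l (c l)) * ee ((∑ l, (c l : ZMod p) * l) * b) := by
    intro b
    have := Finset.prod_univ_sum (rzt L) (fun l j => rzw L ω l j * ee ((j : ZMod p) * l * b))
    simp_rw [rz_factor] at this
    rw [prod_ite_mem, univ_inter] at this
    rw [Complex.ofReal_prod, this]
    refine sum_congr rfl fun c _ => ?_
    rw [prod_mul_distrib, sum_mul, ee_sum]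
  have h3 : ((∑ b ∈ B, ∏ l ∈ L, (Real.cosh (1 / 2) + (ω l * ee (l * b)).re * Real.sinh (1 / 2)) : ℝ) : ℂ)
      = ∑ c ∈ Fintype.piFinset (rzt L), (∏ l, rzw L ω l (c l)) * ∑ b ∈ B, ee ((∑ l, (c l : ZMod p) * l) * b) := by
    rw [Complex.ofReal_sum]
    simp_rw [h2]
    rw [sum_comm]
    simp_rw [mul_sum]
  have hz : (0 : ZMod p → ℤ) ∈ Fintype.piFinset (rzt L) := by
    rw [Fintype.mem_piFinset]; intro l; unfold rzt; split_ifs <;> simp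
  calc ∑ b ∈ B, Real.exp (1 / 2 * ∑ l ∈ L, (ω l * ee (l * b)).re)
      ≤ ∑ b ∈ B, ∏ l ∈ L, (Real.cosh (1 / 2) + (ω l * ee (l * b)).re * Real.sinh (1 / 2)) :=
        sum_le_sum fun b _ => h1 b
    _ ≤ ‖((∑ b ∈ B, ∏ l ∈ L, (Real.cosh (1 / 2) + (ω l * ee (l * b)).re * Real.sinh (1 / 2)) : ℝ) : ℂ)‖ := by
        rw [Complex.norm_real]; exact Real.le_norm_self _
    _ ≤ ∑ c ∈ Fintype.piFinset (rzt L), (∏ l, ‖rzw L ω l (c l)‖) * ‖∑ b ∈ B, ee ((∑ l, (c l : ZMod p) * l) * b)‖ := by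
        rw [h3]
        refine (norm_sum_le _ _).trans (le_of_eq ?_)
        refine sum_congr rfl fun c _ => ?_
        rw [norm_mul, norm_prod]
    _ ≤ ∑ c ∈ Fintype.piFinset (rzt L), ((if c = 0 then Real.exp (L.card / 8) * B.card else 0)
          + (∏ l, ‖rzw L ω l (c l)‖) * (κ * B.card)) := by
        refine sum_le_sum fun c hc => ?_
        have hw : 0 ≤ ∏ l, ‖rzw L ω l (c l)‖ := prod_nonneg fun _ _ => norm_nonneg _
        have hB : (0 : ℝ) ≤ B.card := by positivity
        split_ifs with h0
        · have hA : ∏ l, ‖rzw L ω l (c l)‖ ≤ Real.exp (L.card / 8) := by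
            have : ∀ l, ‖rzw L ω l (c l)‖ = if l ∈ L then Real.cosh (1 / 2) else 1 := by
              intro l
              rw [h0]; unfold rzw
              by_cases hl : l ∈ L
              · rw [if_pos hl, if_pos hl, Pi.zero_apply, if_pos rfl, Complex.norm_real,
                  Real.norm_of_nonneg (Real.cosh_pos _).le]
              · rw [if_neg hl, if_neg hl]; simp
            simp_rw [this]
            rw [prod_ite_mem, univ_inter, prod_const]
            calc Real.cosh (1 / 2) ^ L.card ≤ Real.exp ((1 / 2) ^ 2 / 2) ^ L.card :=
                  pow_le_pow_left₀ (Real.cosh_pos _).le (Real.cosh_le_exp_half_sq _) _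
              _ = _ := by rw [← Real.exp_nat_mul]; congr 1; ring
          have hS : ‖∑ b ∈ B, ee ((∑ l, (c l : ZMod p) * l) * b)‖ ≤ B.card := by
            refine (norm_sum_le _ _).trans ?_
            simp [ee_norm]
          have := mul_le_mul hA hS (norm_nonneg _) (Real.exp_pos _).le
          have h4 : 0 ≤ (∏ l, ‖rzw L ω l (c l)‖) * (κ * B.card) := by positivity
          linarith
        · rw [zero_add]
          refine mul_le_mul_of_nonneg_left ?_ hw
          rw [Fintype.mem_piFinset] at hc
          refine hd c (fun l => ?_) (fun l hl => ?_) h0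
          · have := hc l
            unfold rzt at this
            split_ifs at this with hl
            · exact this
            · rw [mem_singleton] at this; rw [this]; decide
          · have := hc l
            unfold rzt at this
            rw [if_neg hl, mem_singleton] at this
            exact this
    _ = Real.exp (L.card / 8) * B.card + Real.exp (1 / 2) ^ L.card * (κ * B.card) := by
        rw [sum_add_distrib, sum_ite_eq' , if_pos hz, ← sum_mul]
        have := Finset.prod_univ_sum (rzt L) (fun l j => ‖rzw L ω l j‖)
        simp_rw [rz_norm L ω hω] at this
        rw [prod_ite_mem, univ_inter, prod_const] at this
        rw [← this]
    _ ≤ _ := by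
        have : Real.exp (1 / 2) ≤ 3 :=
          (Real.exp_le_exp.mpr (by norm_num : (1 / 2 : ℝ) ≤ 1)).trans (by linarith [Real.exp_one_lt_d9])
        have h5 : Real.exp (1 / 2) ^ L.card ≤ 3 ^ L.card := pow_le_pow_left₀ (Real.exp_pos _).le this _
        have h6 : 0 ≤ κ * B.card := by positivity
        nlinarith

lemma chang_card {p : ℕ} [NeZero p] (B T L : Finset (ZMod p)) (hTB : T ⊆ B) (hT : T.Nonempty)
    (τ : ℝ) (hτ : 0 < τ) (hTc : τ * B.card ≤ T.card)
    (hL : ∀ l ∈ L, (T.card : ℝ) / 2 ≤ ‖∑ b ∈ T, ee (l * b)‖)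
    (κ : ℝ) (hκ : 0 ≤ κ) (hκ1 : κ * 3 ^ L.card ≤ 1) (hd : dis3 B κ L) :
    Real.exp (L.card / 8) ≤ 2 / τ := by
  classical
  have hTp : (0 : ℝ) < T.card := by exact_mod_cast hT.card_pos
  have hBp : (0 : ℝ) < B.card := by exact_mod_cast (hT.mono hTB).card_pos
  have hω : ∀ l : ZMod p, ∃ w : ℂ, ‖w‖ = 1 ∧ w * ∑ b ∈ T, ee (l * b) = (‖∑ b ∈ T, ee (l * b)‖ : ℂ) := by
    intro l
    set z := ∑ b ∈ T, ee (l * b)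
    by_cases hz : z = 0
    · exact ⟨1, by simp, by simp [hz]⟩
    · have hn : ‖z‖ ≠ 0 := by simpa using hz
      refine ⟨(starRingEnd ℂ) z / ‖z‖, ?_, ?_⟩
      · rw [norm_div, RCLike.norm_conj, Complex.norm_real, norm_norm, div_self hn]
      · have hn' : (‖z‖ : ℂ) ≠ 0 := by exact_mod_cast hn
        rw [div_mul_eq_mul_div, div_eq_iff hn', mul_comm, Complex.mul_conj']; ring
  choose ω hω1 hω2 using hω
  have h1 := rz_sum B L ω hω1 κ hκ hd
  set X : ZMod p → ℝ := fun b => ∑ l ∈ L, (ω l * ee (l * b)).re with hX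
  have h2 : (L.card : ℝ) / 2 * T.card ≤ ∑ b ∈ T, X b := by
    rw [hX, sum_comm]
    have : ∀ l ∈ L, (T.card : ℝ) / 2 ≤ ∑ b ∈ T, (ω l * ee (l * b)).re := by
      intro l hl
      rw [← Complex.re_sum, ← mul_sum, hω2, Complex.ofReal_re]
      exact hL l hl
    have := sum_le_sum this
    rw [sum_const, nsmul_eq_mul] at this
    linarith
  have h3 : Real.exp (L.card / 4) * T.card ≤ ∑ b ∈ T, Real.exp (1 / 2 * X b) := by
    calc Real.exp (L.card / 4) * T.card ≤ ∑ b ∈ T, Real.exp (L.card / 4) * (1 / 2 * X b - L.card / 4 + 1) := by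
          rw [← mul_sum, sum_add_distrib, sum_sub_distrib, ← mul_sum, sum_const, sum_const, nsmul_eq_mul,
            nsmul_eq_mul]
          have : (0 : ℝ) < Real.exp (L.card / 4) := Real.exp_pos _
          gcongr
          linarith
      _ ≤ _ := by
          refine sum_le_sum fun b _ => ?_
          have := Real.add_one_le_exp (1 / 2 * X b - L.card / 4)
          calc _ ≤ Real.exp (L.card / 4) * Real.exp (1 / 2 * X b - L.card / 4) := by gcongr
            _ = _ := by rw [← Real.exp_add]; congr 1; ring
  have h4 : ∑ b ∈ T, Real.exp (1 / 2 * X b) ≤ ∑ b ∈ B, Real.exp (1 / 2 * X b) :=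
    sum_le_sum_of_subset_of_nonneg hTB fun _ _ _ => (Real.exp_pos _).le
  have h5 : (1 : ℝ) ≤ Real.exp (L.card / 8) := Real.one_le_exp (by positivity)
  have h6 : Real.exp (L.card / 4) * (τ * B.card) ≤ 2 * Real.exp (L.card / 8) * B.card := by
    calc Real.exp (L.card / 4) * (τ * B.card) ≤ Real.exp (L.card / 4) * T.card := by gcongr
      _ ≤ (Real.exp (L.card / 8) + κ * 3 ^ L.card) * B.card := (h3.trans h4).trans h1
      _ ≤ _ := by gcongr; linarith
  have h7 : Real.exp (L.card / 4) = Real.exp (L.card / 8) * Real.exp (L.card / 8) := by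
    rw [← Real.exp_add]; congr 1; ring
  rw [h7] at h6
  rw [le_div_iff₀ hτ]
  have hp : 0 < Real.exp (L.card / 8) * B.card := by positivity
  refine le_of_mul_le_mul_left ?_ hp
  nlinarith

lemma sum_norm_sub_one {p : ℕ} [NeZero p] {ι : Type*} (s : Finset ι) (x : ι → ZMod p) :
    ‖ee (∑ i ∈ s, x i) - 1‖ ≤ ∑ i ∈ s, ‖ee (x i) - 1‖ := by
  classical
  induction s using Finset.induction_on with
  | empty => simp [ee_zero]
  | insert a s ha ih =>
    rw [sum_insert ha, sum_insert ha]
    exact (ee_sub_one_add _ _).trans (by linarith)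

lemma chang {p : ℕ} [NeZero p] (B T : Finset (ZMod p)) (hTB : T ⊆ B) (hT : T.Nonempty)
    (τ : ℝ) (hτ : 0 < τ) (hTc : τ * B.card ≤ T.card) (m : ℕ) (hm : 2 / τ < Real.exp ((m + 1 : ℕ) / 8)) :
    ∃ L : Finset (ZMod p), L.card ≤ m ∧ ∀ ξ, (T.card : ℝ) / 2 ≤ ‖∑ b ∈ T, ee (ξ * b)‖ →
      ∃ θ, (1 / 3 : ℝ) ^ (m + 1) * B.card ≤ ‖∑ b ∈ B, ee (θ * b)‖ ∧
        ∀ t, ‖ee (ξ * t) - 1‖ ≤ ∑ l ∈ L, ‖ee (l * t) - 1‖ + ‖ee (θ * t) - 1‖ := by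
  classical
  set κ : ℝ := (1 / 3) ^ (m + 1) with hκ
  have hκ0 : 0 ≤ κ := by positivity
  set 𝓕 : Finset (Finset (ZMod p)) := univ.filter fun L =>
    L.card ≤ m + 1 ∧ (∀ l ∈ L, (T.card : ℝ) / 2 ≤ ‖∑ b ∈ T, ee (l * b)‖) ∧ dis3 B κ L with h𝓕
  have hne : 𝓕.Nonempty := by
    refine ⟨∅, ?_⟩
    rw [h𝓕, mem_filter]
    refine ⟨mem_univ _, by simp, by simp, ?_⟩
    intro c _ h0 hc
    exact absurd (funext fun l => h0 l (by simp)) hc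
  obtain ⟨L, hL, hmax⟩ := exists_max_image 𝓕 card hne
  obtain ⟨-, hLc, hLD, hLd⟩ := mem_filter.mp hL
  have hLm : L.card ≤ m := by
    by_contra hcon
    have he : L.card = m + 1 := by omega
    have := chang_card B T L hTB hT τ hτ hTc hLD κ hκ0 (by rw [he, hκ, ← mul_pow]; norm_num) hLd
    rw [he] at this
    linarith
  refine ⟨L, hLm, fun ξ hξ => ?_⟩
  by_cases hξL : ξ ∈ L
  · refine ⟨0, ?_, fun t => ?_⟩
    · simp only [zero_mul, ee_zero, sum_const, nsmul_eq_mul, mul_one, Complex.norm_natCast]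
      have h1 : κ ≤ 1 := pow_le_one₀ (by norm_num) (by norm_num)
      have h2 : (0 : ℝ) ≤ B.card := by positivity
      nlinarith
    · have := single_le_sum (f := fun l => ‖ee (l * t) - 1‖) (fun l _ => norm_nonneg _) hξL
      linarith [norm_nonneg (ee ((0 : ZMod p) * t) - 1)]
  · have hnd : ¬ dis3 B κ (insert ξ L) := by
      intro hdd
      have hmem : insert ξ L ∈ 𝓕 := by
        rw [h𝓕, mem_filter]
        refine ⟨mem_univ _, ?_, ?_, hdd⟩
        · rw [card_insert_of_notMem hξL]; omega
        · intro l hl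
          rcases mem_insert.mp hl with rfl | h
          · exact hξ
          · exact hLD l h
      have := hmax _ hmem
      rw [card_insert_of_notMem hξL] at this
      omega
    unfold dis3 at hnd
    push Not at hnd
    obtain ⟨c, hc1, hc2, hc0, hc3⟩ := hnd
    have hcξ : c ξ ≠ 0 := by
      intro h0
      have := hLd c hc1 (fun l hl => by
        by_cases hl' : l = ξ
        · rw [hl', h0]
        · exact hc2 l (by rw [mem_insert]; tauto)) hc0
      linarith
    set θ := ∑ l, (c l : ZMod p) * l with hθ
    refine ⟨θ, hc3.le, fun t => ?_⟩
    have hθ2 : θ = (c ξ : ZMod p) * ξ + ∑ l ∈ L, (c l : ZMod p) * l := by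
      rw [hθ, ← sum_insert (f := fun l => (c l : ZMod p) * l) hξL]
      symm
      apply sum_subset (subset_univ _)
      intro l _ hl
      rw [hc2 l hl]; simp
    have hsub : ∀ l y : ZMod p, ‖ee ((c l : ZMod p) * y) - 1‖ ≤ ‖ee y - 1‖ := by
      intro l y
      have := hc1 l
      simp only [mem_insert, mem_singleton] at this
      rcases this with h | h | h <;> rw [h]
      · push_cast; rw [neg_one_mul, ee_sub_one_neg]
      · simp [ee_zero]
      · simp
    have hξe : ‖ee (ξ * t) - 1‖ = ‖ee ((c ξ : ZMod p) * (ξ * t)) - 1‖ := by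
      have := hc1 ξ
      simp only [mem_insert, mem_singleton] at this
      rcases this with h | h | h
      · rw [h]; push_cast; rw [neg_one_mul, ee_sub_one_neg]
      · exact absurd h hcξ
      · rw [h]; simp
    rw [hξe, show (c ξ : ZMod p) * (ξ * t) = ∑ l ∈ L, -((c l : ZMod p) * (l * t)) + θ * t by
      rw [hθ2, add_mul, sum_mul, sum_neg_distrib]
      simp_rw [mul_assoc]; ring]
    refine (ee_sub_one_add _ _).trans ?_
    gcongr
    refine (sum_norm_sub_one _ _).trans (sum_le_sum fun l _ => ?_)
    rw [ee_sub_one_neg]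
    exact hsub l _

lemma char_small {p : ℕ} [NeZero p] (B : Finset (ZMod p)) (hB : B.Nonempty) (θ t : ZMod p) (κ η : ℝ)
    (hκ : 0 < κ) (hθ : κ * B.card ≤ ‖∑ b ∈ B, ee (θ * b)‖)
    (hη : ((B.filter fun x => x + t ∉ B).card : ℝ) ≤ η * B.card) :
    ‖ee (θ * t) - 1‖ ≤ 2 * η / κ := by
  classical
  have hBp : (0 : ℝ) < B.card := by exact_mod_cast hB.card_pos
  set B' := B.image (fun x => x + t) with hB'
  have hinj : Set.InjOn (fun x => x + t) (B : Set (ZMod p)) := by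
    intro x _ y _ h; simpa using h
  have hc : B'.card = B.card := card_image_of_injOn hinj
  have e1 : (ee (θ * t) - 1) * ∑ b ∈ B, ee (θ * b) = ∑ b ∈ B', ee (θ * b) - ∑ b ∈ B, ee (θ * b) := by
    rw [hB', sum_image hinj, sub_mul, one_mul, mul_sum]
    congr 1
    refine sum_congr rfl fun b _ => ?_
    rw [mul_add, ee_add]; ring
  rw [← sum_sdiff_sub_sum_sdiff] at e1
  have c1 : (B' \ B).card ≤ (B.filter fun x => x + t ∉ B).card := by
    have : B' \ B ⊆ (B.filter fun x => x + t ∉ B).image (fun x => x + t) := by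
      intro y hy
      rw [mem_sdiff, hB', mem_image] at hy
      obtain ⟨⟨x, hx, rfl⟩, h⟩ := hy
      exact mem_image_of_mem _ (mem_filter.mpr ⟨hx, h⟩)
    exact (card_le_card this).trans card_image_le
  have c2 : (B \ B').card = (B' \ B).card := card_sdiff_comm hc.symm
  have n1 : ∀ s : Finset (ZMod p), ‖∑ b ∈ s, ee (θ * b)‖ ≤ s.card := by
    intro s
    refine (norm_sum_le _ _).trans ?_
    simp [ee_norm]
  have e2 : ‖ee (θ * t) - 1‖ * ‖∑ b ∈ B, ee (θ * b)‖ ≤ 2 * (η * B.card) := by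
    rw [← norm_mul, e1]
    refine (norm_sub_le _ _).trans ?_
    have a1 := n1 (B' \ B)
    have a2 := n1 (B \ B')
    rw [c2] at a2
    have a3 : ((B' \ B).card : ℝ) ≤ (B.filter fun x => x + t ∉ B).card := by exact_mod_cast c1
    linarith
  have e3 : ‖ee (θ * t) - 1‖ * (κ * B.card) ≤ 2 * (η * B.card) :=
    (mul_le_mul_of_nonneg_left hθ (norm_nonneg _)).trans e2
  rw [le_div_iff₀ hκ]
  refine le_of_mul_le_mul_right ?_ hBp
  linarith

/-! ## From almost periodicity to a density increment -/

noncomputable def ppo {p : ℕ} (T : Finset (ZMod p)) (H : ZMod p → ℝ) (t : ZMod p) : ℝ :=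
  (T.card : ℝ)⁻¹ * ((T.card : ℝ)⁻¹ * ∑ b ∈ T, ∑ b' ∈ T, H (t + b' - b))

lemma ppo_sub {p : ℕ} (T : Finset (ZMod p)) (hT : T.Nonempty) (H : ZMod p → ℝ) (t : ZMod p) (v e : ℝ)
    (h : ∀ b ∈ T, ∀ b' ∈ T, |H (t + b' - b) - v| ≤ e) : |ppo T H t - v| ≤ e := by
  have hTp : (0 : ℝ) < T.card := by exact_mod_cast hT.card_pos
  have h1 : ppo T H t - v = (T.card : ℝ)⁻¹ * ((T.card : ℝ)⁻¹ * ∑ b ∈ T, ∑ b' ∈ T, (H (t + b' - b) - v)) := by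
    unfold ppo
    simp only [sum_sub_distrib, sum_const, nsmul_eq_mul]
    field_simp
  rw [h1, abs_mul, abs_mul, abs_of_pos (inv_pos.mpr hTp)]
  rw [inv_mul_le_iff₀ hTp, inv_mul_le_iff₀ hTp]
  refine (abs_sum_le_sum_abs _ _).trans ?_
  calc ∑ b ∈ T, |∑ b' ∈ T, (H (t + b' - b) - v)| ≤ ∑ b ∈ T, ∑ b' ∈ T, e := by
        refine sum_le_sum fun b hb => (abs_sum_le_sum_abs _ _).trans (sum_le_sum fun b' hb' => h b hb b' hb')
    _ = _ := by simp only [sum_const, nsmul_eq_mul]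

lemma ppo_diff {p : ℕ} (T : Finset (ZMod p)) (hT : T.Nonempty) (H H' : ZMod p → ℝ) (t : ZMod p) (e : ℝ)
    (h : ∀ b ∈ T, ∀ b' ∈ T, |H (t + b' - b) - H' (t + b' - b)| ≤ e) : |ppo T H t - ppo T H' t| ≤ e := by
  have h1 : ppo T H t - ppo T H' t = ppo T (fun x => H x - H' x) t - 0 := by
    unfold ppo; simp only [sum_sub_distrib]; ring
  rw [h1]
  exact ppo_sub T hT _ t 0 e (fun b hb b' hb' => by rw [sub_zero]; exact h b hb b' hb')

lemma ppo_iter_dev {p : ℕ} (T : Finset (ZMod p)) (hT : T.Nonempty) (H : ZMod p → ℝ)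
    (N : ℕ → Finset (ZMod p)) (l : ℕ) (e : ℝ)
    (hN : ∀ i, ∀ t ∈ N i, ∀ b ∈ T, ∀ b' ∈ T, t + b' - b ∈ N (i + 1))
    (hH : ∀ i, i < l → ∀ t ∈ N i, ∀ b ∈ T, ∀ b' ∈ T, |H (t + b' - b) - H t| ≤ e) (j : ℕ) :
    ∀ i, i + j ≤ l → ∀ t ∈ N i, |(ppo T)^[j] H t - H t| ≤ j * e := by
  induction j with
  | zero => intro i _ t _; simp
  | succ j ih =>
    intro i hi t ht
    rw [Function.iterate_succ_apply']
    have h1 : |ppo T ((ppo T)^[j] H) t - ppo T H t| ≤ j * e :=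
      ppo_diff T hT _ _ t _ fun b hb b' hb' => ih (i + 1) (by omega) _ (hN i t ht b hb b' hb')
    have h2 : |ppo T H t - H t| ≤ e := ppo_sub T hT H t _ e fun b hb b' hb' => hH i (by omega) t ht b hb b' hb'
    have h3 := abs_sub_le (ppo T ((ppo T)^[j] H) t) (ppo T H t) (H t)
    push_cast
    linarith

lemma ppo_sum_le {p : ℕ} (T : Finset (ZMod p)) (hT : T.Nonempty) (H : ZMod p → ℝ) (B : Finset (ZMod p))
    (c : ℝ) (h : ∀ z, ∑ t ∈ B, H (z + t) ≤ c) (z : ZMod p) : ∑ t ∈ B, ppo T H (z + t) ≤ c := by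
  have hTp : (0 : ℝ) < T.card := by exact_mod_cast hT.card_pos
  unfold ppo
  rw [← mul_sum, ← mul_sum, inv_mul_le_iff₀ hTp, inv_mul_le_iff₀ hTp, sum_comm]
  calc ∑ b ∈ T, ∑ t ∈ B, ∑ b' ∈ T, H (z + t + b' - b) ≤ ∑ b ∈ T, ∑ b' ∈ T, c := by
        refine sum_le_sum fun b _ => ?_
        rw [sum_comm]
        refine sum_le_sum fun b' _ => ?_
        refine le_trans (le_of_eq ?_) (h (z + b' - b))
        refine sum_congr rfl fun t _ => ?_
        congr 1; ring
    _ = _ := by simp only [sum_const, nsmul_eq_mul]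

lemma ppo_iter_sum_le {p : ℕ} (T : Finset (ZMod p)) (hT : T.Nonempty) (H : ZMod p → ℝ) (B : Finset (ZMod p))
    (c : ℝ) (h : ∀ z, ∑ t ∈ B, H (z + t) ≤ c) (j : ℕ) : ∀ z, ∑ t ∈ B, (ppo T)^[j] H (z + t) ≤ c := by
  induction j with
  | zero => simpa using h
  | succ j ih =>
    intro z
    rw [Function.iterate_succ_apply']
    exact ppo_sum_le T hT _ B c ih z

lemma ppo_ft {p : ℕ} [NeZero p] (T : Finset (ZMod p)) (H : ZMod p → ℝ) (a : ZMod p → ℂ)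
    (h : ∀ t, (H t : ℂ) = ∑ ξ, a ξ * ee (ξ * t)) (t : ZMod p) :
    (ppo T H t : ℂ) = ∑ ξ, (a ξ * (((T.card : ℝ)⁻¹ * ‖∑ b ∈ T, ee (ξ * b)‖) ^ 2 : ℝ)) * ee (ξ * t) := by
  unfold ppo
  push_cast
  simp_rw [h]
  have e1 : ∑ b ∈ T, ∑ b' ∈ T, ∑ ξ, a ξ * ee (ξ * (t + b' - b))
      = ∑ ξ, a ξ * ee (ξ * t) * ((‖∑ b ∈ T, ee (ξ * b)‖ ^ 2 : ℝ) : ℂ) := by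
    have : ∀ ξ, a ξ * ee (ξ * t) * ((‖∑ b ∈ T, ee (ξ * b)‖ ^ 2 : ℝ) : ℂ)
        = ∑ b ∈ T, ∑ b' ∈ T, a ξ * ee (ξ * (t + b' - b)) := by
      intro ξ
      rw [← two_sum, sum_product, sum_comm, mul_sum]
      refine sum_congr rfl fun b _ => ?_
      rw [mul_sum]
      refine sum_congr rfl fun b' _ => ?_
      rw [show ξ * (t + b' - b) = ξ * t + ξ * (b' - b) by ring, ee_add]; ring
    simp_rw [this]
    rw [sum_comm (s := univ)]
    refine sum_congr rfl fun b _ => ?_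
    rw [sum_comm]
  rw [e1, mul_sum, mul_sum]
  refine sum_congr rfl fun ξ _ => ?_
  push_cast; ring

lemma ppo_iter_ft {p : ℕ} [NeZero p] (T : Finset (ZMod p)) (H : ZMod p → ℝ) (a : ZMod p → ℂ)
    (h : ∀ t, (H t : ℂ) = ∑ ξ, a ξ * ee (ξ * t)) (j : ℕ) : ∀ t,
    ((ppo T)^[j] H t : ℂ)
      = ∑ ξ, (a ξ * ((((T.card : ℝ)⁻¹ * ‖∑ b ∈ T, ee (ξ * b)‖) ^ 2) ^ j : ℝ)) * ee (ξ * t) := by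
  induction j with
  | zero => intro t; simpa using h t
  | succ j ih =>
    intro t
    rw [Function.iterate_succ_apply', ppo_ft T _ _ ih]
    refine sum_congr rfl fun ξ _ => ?_
    push_cast; ring

/-- the function `H` -/
noncomputable def HH {p : ℕ} (A1 A2 : Finset (ZMod p)) (F : ZMod p → ℝ) (t : ZMod p) : ℝ :=
  (A2.card : ℝ)⁻¹ * ∑ a ∈ A2, avg A1 F (t - a)

lemma HH_ft {p : ℕ} [NeZero p] (A1 A2 : Finset (ZMod p)) (F : ZMod p → ℝ) (t : ZMod p) :
    (HH A1 A2 F t : ℂ) = ∑ ξ, (ft (fun x => (F x : ℂ)) ξ * (((A1.card : ℂ)⁻¹ * ∑ a ∈ A1, ee (ξ * a)) *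
      ((A2.card : ℂ)⁻¹ * ∑ a ∈ A2, ee (-(ξ * a))))) * ee (ξ * t) := by
  unfold HH avg
  push_cast
  have h1 : ∀ x, (F x : ℂ) = ∑ ξ, ft (fun x => (F x : ℂ)) ξ * ee (ξ * x) :=
    fun x => ft_inv (fun x => (F x : ℂ)) x
  have h2 : ∀ ξ, (ft (fun x => (F x : ℂ)) ξ * (((A1.card : ℂ)⁻¹ * ∑ a ∈ A1, ee (ξ * a)) *
      ((A2.card : ℂ)⁻¹ * ∑ a ∈ A2, ee (-(ξ * a))))) * ee (ξ * t)
      = (A2.card : ℂ)⁻¹ * ∑ a2 ∈ A2, (A1.card : ℂ)⁻¹ * ∑ a1 ∈ A1,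
        ft (fun x => (F x : ℂ)) ξ * ee (ξ * (a1 + (t - a2))) := by
    intro ξ
    rw [← mul_sum, sum_comm]
    have : ∑ a1 ∈ A1, ∑ a2 ∈ A2, ft (fun x => (F x : ℂ)) ξ * ee (ξ * (a1 + (t - a2)))
        = ft (fun x => (F x : ℂ)) ξ * ee (ξ * t) * ((∑ a ∈ A1, ee (ξ * a)) * ∑ a ∈ A2, ee (-(ξ * a))) := by
      rw [sum_mul_sum, mul_sum]
      refine sum_congr rfl fun a1 _ => ?_
      rw [mul_sum]
      refine sum_congr rfl fun a2 _ => ?_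
      rw [show ξ * (a1 + (t - a2)) = ξ * t + (ξ * a1 + -(ξ * a2)) by ring, ee_add, ee_add]; ring
    rw [this]; ring
  rw [sum_congr rfl fun ξ _ => h2 ξ, ← mul_sum (s := univ), sum_comm (s := univ)]
  refine congrArg _ (sum_congr rfl fun a2 _ => ?_)
  rw [← mul_sum (s := univ), sum_comm (s := univ)]
  refine congrArg _ (sum_congr rfl fun a1 _ => ?_)
  exact h1 _

lemma HH_l1 {p : ℕ} [NeZero p] (A1 A2 : Finset (ZMod p)) (F : ZMod p → ℝ) (hA1 : A1.Nonempty)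
    (hA2 : A2.Nonempty) (w : ℝ) (hw : ∑ x, F x ^ 2 ≤ w) :
    ∑ ξ, ‖(ft (fun x => (F x : ℂ)) ξ * (((A1.card : ℂ)⁻¹ * ∑ a ∈ A1, ee (ξ * a)) *
      ((A2.card : ℂ)⁻¹ * ∑ a ∈ A2, ee (-(ξ * a)))))‖ ≤ √(w / A1.card) := by
  classical
  have hA1p : (0 : ℝ) < A1.card := by exact_mod_cast hA1.card_pos
  have hA2p : (0 : ℝ) < A2.card := by exact_mod_cast hA2.card_pos
  have hp : (0 : ℝ) < p := by exact_mod_cast NeZero.pos p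
  have b2 : ∀ ξ : ZMod p, ‖(A2.card : ℂ)⁻¹ * ∑ a ∈ A2, ee (-(ξ * a))‖ ≤ 1 := by
    intro ξ
    rw [norm_mul, norm_inv, Complex.norm_natCast, inv_mul_le_iff₀ hA2p, mul_one]
    refine (norm_sum_le _ _).trans ?_
    simp [ee_norm]
  have e1 : ∀ ξ : ZMod p, ‖(A1.card : ℂ)⁻¹ * ∑ a ∈ A1, ee (ξ * a)‖
      = (p : ℝ) / A1.card * ‖ft (fun x => ((ic A1 x : ℝ) : ℂ)) ξ‖ := by
    intro ξ
    unfold ft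
    have : ∑ y, ((ic A1 y : ℝ) : ℂ) * ee (-(ξ * y)) = (starRingEnd ℂ) (∑ a ∈ A1, ee (ξ * a)) := by
      rw [map_sum, ← sum_filter_add_sum_filter_not univ (fun y => y ∈ A1)]
      have z1 : ∑ y ∈ univ.filter (fun y => y ∉ A1), ((ic A1 y : ℝ) : ℂ) * ee (-(ξ * y)) = 0 := by
        refine sum_eq_zero fun y hy => ?_
        have := (mem_filter.mp hy).2
        simp [ic, this]
      rw [z1, add_zero, filter_univ_mem]
      refine sum_congr rfl fun y hy => ?_
      rw [ee_neg]; simp [ic, hy]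
    rw [this, norm_mul, norm_mul, RCLike.norm_conj, norm_inv, norm_inv, Complex.norm_natCast,
      Complex.norm_natCast]
    field_simp
  have c1 : ∑ ξ, ‖(ft (fun x => (F x : ℂ)) ξ * (((A1.card : ℂ)⁻¹ * ∑ a ∈ A1, ee (ξ * a)) *
      ((A2.card : ℂ)⁻¹ * ∑ a ∈ A2, ee (-(ξ * a)))))‖
      ≤ (p : ℝ) / A1.card * ∑ ξ, ‖ft (fun x => (F x : ℂ)) ξ‖ * ‖ft (fun x => ((ic A1 x : ℝ) : ℂ)) ξ‖ := by
    rw [mul_sum]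
    refine sum_le_sum fun ξ _ => ?_
    rw [norm_mul, norm_mul, e1]
    have n1 := norm_nonneg (ft (fun x => (F x : ℂ)) ξ)
    have n2 : 0 ≤ (p : ℝ) / A1.card * ‖ft (fun x => ((ic A1 x : ℝ) : ℂ)) ξ‖ := by positivity
    have n3 := b2 ξ
    calc _ ≤ ‖ft (fun x => (F x : ℂ)) ξ‖ * ((p : ℝ) / A1.card * ‖ft (fun x => ((ic A1 x : ℝ) : ℂ)) ξ‖ * 1) := by
          gcongr
      _ = _ := by ring
  refine c1.trans (Real.le_sqrt_of_sq_le ?_)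
  rw [mul_pow]
  have c2 := sum_mul_sq_le_sq_mul_sq univ (fun ξ => ‖ft (fun x => (F x : ℂ)) ξ‖)
    (fun ξ => ‖ft (fun x => ((ic A1 x : ℝ) : ℂ)) ξ‖)
  rw [ft_parseval, ft_parseval] at c2
  have s1 : ∑ x, ‖((F x : ℝ) : ℂ)‖ ^ 2 ≤ w := by
    refine le_trans (le_of_eq ?_) hw
    refine sum_congr rfl fun x _ => ?_
    rw [Complex.norm_real, Real.norm_eq_abs, sq_abs]
  have s2 : ∑ x, ‖((ic A1 x : ℝ) : ℂ)‖ ^ 2 = A1.card := by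
    rw [← ic_sum A1]
    refine sum_congr rfl fun x _ => ?_
    rw [Complex.norm_real, Real.norm_eq_abs, sq_abs]
    unfold ic; split_ifs <;> norm_num
  rw [s2] at c2
  have hw0 : 0 ≤ w := le_trans (sum_nonneg fun _ _ => sq_nonneg _) hw
  calc _ ≤ ((p : ℝ) / A1.card) ^ 2 * (((p : ℝ)⁻¹ * ∑ x, ‖((F x : ℝ) : ℂ)‖ ^ 2) * ((p : ℝ)⁻¹ * A1.card)) := by
        gcongr
    _ ≤ ((p : ℝ) / A1.card) ^ 2 * (((p : ℝ)⁻¹ * w) * ((p : ℝ)⁻¹ * A1.card)) := by gcongr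
    _ = w / A1.card := by field_simp

lemma HH_dev {p : ℕ} [NeZero p] (A1 A2 R : Finset (ZMod p)) (F : ZMod p → ℝ) (hF0 : ∀ y, 0 ≤ F y)
    (hF1 : ∀ y, F y ≤ 1) (hA1 : A1.Nonempty) (hA2 : A2.Nonempty) (ε X : ℝ) (hε : 0 ≤ ε) (t b b' : ZMod p)
    (hR1 : ∀ a ∈ A2, t - a ∈ R) (hR2 : ∀ a ∈ A2, t + b' - b - a ∈ R)
    (hX : (((univ.filter fun y => y + b ∈ R ∧ y + b' ∈ R ∧
        2 * ε < |avg A1 F (y + b) - avg A1 F (y + b')|).card : ℕ) : ℝ) ≤ X) :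
    |HH A1 A2 F (t + b' - b) - HH A1 A2 F t| ≤ 2 * ε + X / A2.card := by
  classical
  have hA2p : (0 : ℝ) < A2.card := by exact_mod_cast hA2.card_pos
  have h1 : HH A1 A2 F (t + b' - b) - HH A1 A2 F t
      = (A2.card : ℝ)⁻¹ * ∑ a ∈ A2, (avg A1 F (t + b' - b - a) - avg A1 F (t - a)) := by
    unfold HH; rw [sum_sub_distrib]; ring
  rw [h1, abs_mul, abs_of_pos (inv_pos.mpr hA2p), inv_mul_le_iff₀ hA2p]
  refine (abs_sum_le_sum_abs _ _).trans ?_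
  have h2 : ∀ a ∈ A2, |avg A1 F (t + b' - b - a) - avg A1 F (t - a)|
      ≤ 2 * ε + (if 2 * ε < |avg A1 F (t - a) - avg A1 F (t + b' - b - a)| then (1 : ℝ) else 0) := by
    intro a ha
    have g1 := avg_nonneg A1 F hF0 (t - a)
    have g2 := avg_nonneg A1 F hF0 (t + b' - b - a)
    have g3 := avg_le_one A1 hA1 F hF1 (t - a)
    have g4 := avg_le_one A1 hA1 F hF1 (t + b' - b - a)
    rw [abs_sub_comm]
    split_ifs with hc
    · have : |avg A1 F (t - a) - avg A1 F (t + b' - b - a)| ≤ 1 := by rw [abs_le]; constructor <;> linarith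
      linarith
    · push Not at hc; linarith
  refine (sum_le_sum h2).trans ?_
  rw [sum_add_distrib, sum_const, nsmul_eq_mul, ← sum_filter, sum_const, nsmul_eq_mul, mul_one, mul_add,
    mul_div_cancel₀ _ hA2p.ne']
  have h3 : ((A2.filter fun a => 2 * ε < |avg A1 F (t - a) - avg A1 F (t + b' - b - a)|).card : ℝ) ≤ X := by
    refine le_trans ?_ hX
    norm_cast
    refine card_le_card_of_injOn (fun a => t - a - b) ?_ (fun a _ a' _ h => by simpa using h)
    intro a ha
    have ha := mem_filter.mp (mem_coe.mp ha)
    simp only [coe_filter, mem_univ, true_and, Set.mem_ofPred_eq]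
    rw [show t - a - b + b = t - a by ring, show t - a - b + b' = t + b' - b - a by ring]
    exact ⟨hR1 a ha.1, hR2 a ha.1, ha.2⟩
  linarith

lemma increment {p : ℕ} [NeZero p] (A A1 A2 W R T B3 : Finset (ZMod p)) (hA1 : A1.Nonempty) (hA2 : A2.Nonempty)
    (hT : T.Nonempty) (hA : A.Nonempty) (α : ℝ) (hα : 0 < α) (u : ZMod p)
    (hbad : ∑ a1 ∈ A1, ∑ a2 ∈ A2, (if crr (ic A) (u + a1 - a2) < 1.005 * (α * A.card) then (1 : ℝ) else 0)
        ≤ 1 / 1000 * (A1.card * A2.card))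
    (hW : ∀ a1 ∈ A1, ∀ a2 ∈ A2, a1 - a2 ∈ W) (F : ZMod p → ℝ)
    (hF : ∀ w, F w = if w ∈ W ∧ 1.005 * (α * A.card) ≤ crr (ic A) (u + w) then 1 else 0)
    (ε X : ℝ) (hε : 0 ≤ ε)
    (hcs : ∀ b ∈ T, ∀ b' ∈ T, (((univ.filter fun y => y + b ∈ R ∧ y + b' ∈ R ∧
        2 * ε < |avg A1 F (y + b) - avg A1 F (y + b')|).card : ℕ) : ℝ) ≤ X)
    (N : ℕ → Finset (ZMod p)) (l : ℕ) (hN0 : (0 : ZMod p) ∈ N 0)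
    (hN : ∀ i, ∀ t ∈ N i, ∀ b ∈ T, ∀ b' ∈ T, t + b' - b ∈ N (i + 1))
    (hNR : ∀ i, i ≤ l → ∀ t ∈ N i, ∀ a ∈ A2, t - a ∈ R)
    (hl : l * (2 * ε + X / A2.card) ≤ 1 / 1000) (ε1 : ℝ) (hε1 : 0 ≤ ε1)
    (hB3 : ∀ ξ : ZMod p, (T.card : ℝ) / 2 ≤ ‖∑ b ∈ T, ee (ξ * b)‖ → ∀ t ∈ B3, ‖ee (ξ * t) - 1‖ ≤ ε1)
    (hfin : √(W.card / A1.card) * (ε1 + 2 * (1 / 4) ^ l) ≤ 1 / 1000) :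
    ∃ x : ZMod p, (1 + 1 / 600) * α * B3.card ≤ ((B3.filter fun t => x + t ∈ A).card : ℝ) := by
  classical
  have hA1p : (0 : ℝ) < A1.card := by exact_mod_cast hA1.card_pos
  have hA2p : (0 : ℝ) < A2.card := by exact_mod_cast hA2.card_pos
  have hTp : (0 : ℝ) < T.card := by exact_mod_cast hT.card_pos
  have hAp : (0 : ℝ) < A.card := by exact_mod_cast hA.card_pos
  have hF0 : ∀ y, 0 ≤ F y := fun y => by rw [hF]; split_ifs <;> norm_num
  have hF1 : ∀ y, F y ≤ 1 := fun y => by rw [hF]; split_ifs <;> norm_num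
  have hFW : ∑ x, F x ^ 2 ≤ W.card := by
    calc ∑ x, F x ^ 2 ≤ ∑ x, if x ∈ W then (1 : ℝ) else 0 := by
          refine sum_le_sum fun x _ => ?_
          rw [hF]
          by_cases h : x ∈ W
          · simp only [h, true_and, if_true]; split_ifs <;> norm_num
          · simp [h]
      _ = W.card := by simp
  -- H 0 is large
  set H := HH A1 A2 F with hHdef
  have H0 : 1 - 1 / 1000 ≤ H 0 := by
    have e0 : H 0 = (A2.card : ℝ)⁻¹ * ((A1.card : ℝ)⁻¹ * ∑ a1 ∈ A1, ∑ a2 ∈ A2, F (a1 - a2)) := by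
      rw [hHdef]; unfold HH avg
      rw [← mul_sum, sum_comm]
      simp only [zero_sub, ← sub_eq_add_neg]
    have e1 : ∑ a1 ∈ A1, ∑ a2 ∈ A2, F (a1 - a2) = (A1.card : ℝ) * A2.card - ∑ a1 ∈ A1, ∑ a2 ∈ A2,
        (if crr (ic A) (u + a1 - a2) < 1.005 * (α * A.card) then (1 : ℝ) else 0) := by
      have : ((A1.card : ℝ) * A2.card) = ∑ a1 ∈ A1, ∑ a2 ∈ A2, (1 : ℝ) := by simp
      rw [this, ← sum_sub_distrib]
      refine sum_congr rfl fun a1 h1 => ?_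
      rw [← sum_sub_distrib]
      refine sum_congr rfl fun a2 h2 => ?_
      rw [hF, show u + (a1 - a2) = u + a1 - a2 by ring]
      have := hW a1 h1 a2 h2
      by_cases hc : crr (ic A) (u + a1 - a2) < 1.005 * (α * A.card)
      · simp [hc, not_le.mpr hc]
      · simp [this, hc, not_lt.mp hc]
    rw [e0, e1, le_inv_mul_iff₀ hA2p, le_inv_mul_iff₀ hA1p]
    linarith
  set G := (ppo T)^[l] H with hG
  have G0 : |G 0 - H 0| ≤ 1 / 1000 := by
    refine le_trans (ppo_iter_dev T hT H N l (2 * ε + X / A2.card) hN ?_ l 0 (by omega) 0 hN0) hl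
    intro i hi t ht b hb b' hb'
    exact HH_dev A1 A2 R F hF0 hF1 hA1 hA2 ε X hε t b b' (fun a ha => hNR i hi.le t ht a ha)
      (fun a ha => hNR (i + 1) hi _ (hN i t ht b hb b' hb') a ha) (hcs b hb b' hb')
  set c : ZMod p → ℂ := fun ξ => (ft (fun x => (F x : ℂ)) ξ * (((A1.card : ℂ)⁻¹ * ∑ a ∈ A1, ee (ξ * a)) *
      ((A2.card : ℂ)⁻¹ * ∑ a ∈ A2, ee (-(ξ * a))))) with hc
  set m : ZMod p → ℝ := fun ξ => (((T.card : ℝ)⁻¹ * ‖∑ b ∈ T, ee (ξ * b)‖) ^ 2) ^ l with hm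
  have Gft : ∀ t, (G t : ℂ) = ∑ ξ, (c ξ * (m ξ : ℝ)) * ee (ξ * t) := fun t =>
    ppo_iter_ft T H c (fun t => HH_ft A1 A2 F t) l t
  have Gdev : ∀ t ∈ B3, |G t - G 0| ≤ 1 / 1000 := by
    intro t ht
    have e1 : ((G t - G 0 : ℝ) : ℂ) = ∑ ξ, c ξ * ((m ξ : ℝ) * (ee (ξ * t) - 1)) := by
      push_cast
      rw [Gft, Gft, ← sum_sub_distrib]
      refine sum_congr rfl fun ξ _ => ?_
      rw [mul_zero, ee_zero]; ring
    have e2 : |G t - G 0| = ‖((G t - G 0 : ℝ) : ℂ)‖ := by rw [Complex.norm_real, Real.norm_eq_abs]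
    rw [e2, e1]
    refine le_trans ?_ hfin
    calc ‖∑ ξ, c ξ * ((m ξ : ℝ) * (ee (ξ * t) - 1))‖ ≤ ∑ ξ, ‖c ξ‖ * (ε1 + 2 * (1 / 4) ^ l) := by
          refine (norm_sum_le _ _).trans (sum_le_sum fun ξ _ => ?_)
          rw [norm_mul]
          refine mul_le_mul_of_nonneg_left ?_ (norm_nonneg _)
          rw [norm_mul, Complex.norm_real, Real.norm_eq_abs]
          have mu0 : 0 ≤ (T.card : ℝ)⁻¹ * ‖∑ b ∈ T, ee (ξ * b)‖ := by positivity
          have mu1 : (T.card : ℝ)⁻¹ * ‖∑ b ∈ T, ee (ξ * b)‖ ≤ 1 := by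
            rw [inv_mul_le_iff₀ hTp, mul_one]
            refine (norm_sum_le _ _).trans ?_
            simp [ee_norm]
          have hm0 : 0 ≤ m ξ := by rw [hm]; positivity
          have h2 : ‖ee (ξ * t) - 1‖ ≤ 2 := by
            refine (norm_sub_le _ _).trans ?_
            rw [ee_norm, norm_one]; norm_num
          rw [abs_of_nonneg hm0]
          have q0 : (0 : ℝ) ≤ 2 * (1 / 4) ^ l := by positivity
          by_cases hx : (T.card : ℝ) / 2 ≤ ‖∑ b ∈ T, ee (ξ * b)‖
          · have := hB3 ξ hx t ht
            have m1 : m ξ ≤ 1 := by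
              rw [hm]; exact pow_le_one₀ (by positivity) (pow_le_one₀ mu0 mu1)
            have := mul_le_mul m1 this (norm_nonneg _) zero_le_one
            linarith
          · push Not at hx
            have m1 : m ξ ≤ (1 / 4) ^ l := by
              rw [hm]
              refine pow_le_pow_left₀ (by positivity) ?_ l
              have : (T.card : ℝ)⁻¹ * ‖∑ b ∈ T, ee (ξ * b)‖ ≤ 1 / 2 := by
                rw [inv_mul_le_iff₀ hTp]; linarith
              calc _ ≤ (1 / 2 : ℝ) ^ 2 := pow_le_pow_left₀ mu0 this 2
                _ = _ := by norm_num
            have := mul_le_mul m1 h2 (norm_nonneg _) (by positivity)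
            linarith
      _ ≤ _ := by
          rw [← sum_mul]
          refine mul_le_mul_of_nonneg_right (HH_l1 A1 A2 F hA1 hA2 W.card hFW) (by positivity)
  have Glow : ∀ t ∈ B3, 0.997 ≤ G t := by
    intro t ht
    have h1 := (abs_le.mp (Gdev t ht)).1
    have h2 := (abs_le.mp G0).1
    norm_num at *
    linarith
  -- find z
  obtain ⟨z, hz⟩ : ∃ z, 0.997 * (B3.card : ℝ) ≤ ∑ t ∈ B3, F (z + t) := by
    by_contra hcon
    push Not at hcon
    obtain ⟨z0, hz0⟩ : ∃ z0, ∀ z, ∑ t ∈ B3, F (z + t) ≤ ∑ t ∈ B3, F (z0 + t) := by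
      obtain ⟨z0, _, hz0⟩ := exists_max_image univ (fun z => ∑ t ∈ B3, F (z + t)) ⟨0, mem_univ _⟩
      exact ⟨z0, fun z => hz0 z (mem_univ _)⟩
    have hH : ∀ z, ∑ t ∈ B3, H (z + t) ≤ ∑ t ∈ B3, F (z0 + t) := by
      intro z
      rw [hHdef]; unfold HH avg
      rw [← mul_sum, inv_mul_le_iff₀ hA2p, sum_comm]
      rw [← nsmul_eq_mul]
      refine sum_le_card_nsmul _ _ _ fun a _ => ?_
      rw [← mul_sum, inv_mul_le_iff₀ hA1p, sum_comm, ← nsmul_eq_mul]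
      refine sum_le_card_nsmul _ _ _ fun a' _ => ?_
      refine le_trans (le_of_eq ?_) (hz0 (a' + z - a))
      refine sum_congr rfl fun t _ => ?_
      congr 1; ring
    have h1 := ppo_iter_sum_le T hT H B3 _ hH l 0
    have h2 : 0.997 * (B3.card : ℝ) ≤ ∑ t ∈ B3, (ppo T)^[l] H (0 + t) := by
      calc 0.997 * (B3.card : ℝ) = ∑ t ∈ B3, (0.997 : ℝ) := by rw [sum_const, nsmul_eq_mul]; ring
        _ ≤ _ := by
          refine sum_le_sum fun t ht => ?_
          rw [zero_add]; exact Glow t ht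
    linarith [hcon z0]
  have hcr : 0.997 * 1.005 * (α * A.card) * (B3.card : ℝ) ≤ ∑ t ∈ B3, crr (ic A) (u + (z + t)) := by
    calc 0.997 * 1.005 * (α * A.card) * (B3.card : ℝ) ≤ 1.005 * (α * A.card) * ∑ t ∈ B3, F (z + t) := by
          have : (0 : ℝ) ≤ 1.005 * (α * A.card) := by positivity
          nlinarith
      _ ≤ _ := by
          rw [mul_sum]
          refine sum_le_sum fun t _ => ?_
          rw [hF]
          split_ifs with hc
          · linarith [hc.2]
          · rw [mul_zero]; unfold crr
            exact sum_nonneg fun y _ => mul_nonneg (ic_nonneg _ _) (ic_nonneg _ _)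
  by_contra hcon
  push Not at hcon
  have hcr2 : ∑ t ∈ B3, crr (ic A) (u + (z + t)) ≤ A.card * ((1 + 1 / 600) * α * B3.card) := by
    unfold crr
    rw [sum_comm]
    have : ∀ y, ∑ t ∈ B3, ic A y * ic A (y + (u + (z + t))) ≤ ic A y * ((1 + 1 / 600) * α * B3.card) := by
      intro y
      rw [← mul_sum]
      refine mul_le_mul_of_nonneg_left ?_ (ic_nonneg _ _)
      refine le_trans (le_of_eq ?_) (hcon (y + u + z)).le
      unfold ic
      rw [← sum_filter, sum_const, nsmul_eq_mul, mul_one]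
      congr 2
      refine filter_congr fun t _ => ?_
      rw [show y + (u + (z + t)) = y + u + z + t by ring]
    refine (sum_le_sum fun y _ => this y).trans (le_of_eq ?_)
    rw [← sum_mul, ic_sum]
  have hB3c : (0 : ℝ) ≤ B3.card := by positivity
  have hB3c' : (0 : ℝ) < B3.card := by
    rcases hB3c.lt_or_eq with h | h
    · exact h
    · have := hcon 0
      rw [← h, mul_zero] at this
      exact absurd this (not_lt.mpr (by positivity))
  have : 0 < α * A.card * B3.card := by positivity
  have h9 := hcr.trans hcr2
  norm_num at h9
  nlinarith

/-! ## Bohr set scaffolding -/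

def Reg {p : ℕ} [NeZero p] (Γ : Finset (ZMod p)) (κ η r : ℝ) : Prop :=
  ((bohr Γ (r + κ * r)).card : ℝ) ≤ (1 + η) * (bohr Γ r).card

lemma reg_exists {p : ℕ} [NeZero p] (Γ : Finset (ZMod p)) (d h : ℕ) (hd : Γ.card ≤ d) (hd1 : 1 ≤ d)
    (hh : 1 ≤ h) {R : ℝ} (hR : 0 < R) :
    ∃ r, R / 2 ≤ r ∧ r ≤ R ∧ Reg Γ (1 / (16 * d * h)) (1 / h) r := by
  obtain ⟨r, h1, h2, h3⟩ := bohr_regular Γ d h hd hd1 hh hR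
  refine ⟨r, h1, h2, le_trans ?_ h3⟩
  refine Nat.cast_le.mpr (card_le_card (bohr_mono ?_))
  have : (1 / (16 * d * h) : ℝ) * r = r / (16 * d * h) := by ring
  rw [this]
  gcongr

lemma Reg.card_le {p : ℕ} [NeZero p] {Γ : Finset (ZMod p)} {κ η r s : ℝ} (h : Reg Γ κ η r) (hs : s ≤ κ * r) :
    ((bohr Γ (r + s)).card : ℝ) ≤ (1 + η) * (bohr Γ r).card := by
  refine le_trans ?_ h
  norm_cast
  exact card_le_card (bohr_mono (by linarith))

lemma Reg.shift {p : ℕ} [NeZero p] {Γ : Finset (ZMod p)} {κ η r s : ℝ} (h : Reg Γ κ η r) (hs : s ≤ κ * r)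
    (hs0 : 0 ≤ s) {t : ZMod p} (ht : t ∈ bohr Γ s) :
    (((bohr Γ r).filter (fun x => x + t ∉ bohr Γ r)).card : ℝ) ≤ η * (bohr Γ r).card :=
  bohr_shift (h.card_le hs) hs0 ht

/-- half frequencies -/
noncomputable def hf {p : ℕ} (Γ : Finset (ZMod p)) : Finset (ZMod p) := Γ.image fun γ => γ * (2 : ZMod p)⁻¹

lemma hf_card {p : ℕ} (Γ : Finset (ZMod p)) : (hf Γ).card ≤ Γ.card := card_image_le

lemma two_ne {p : ℕ} [Fact p.Prime] (h2 : p ≠ 2) : (2 : ZMod p) ≠ 0 := by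
  have h : ((2 : ℕ) : ZMod p) ≠ 0 := by
    rw [Ne, ZMod.natCast_eq_zero_iff]
    intro h
    exact h2 ((Nat.prime_dvd_prime_iff_eq Fact.out Nat.prime_two).mp h)
  exact_mod_cast h

lemma mem_hf {p : ℕ} [Fact p.Prime] (h2 : p ≠ 2) (Γ : Finset (ZMod p)) (r : ℝ) (x : ZMod p) :
    2 * x ∈ bohr (hf Γ) r ↔ x ∈ bohr Γ r := by
  have h := two_ne h2
  have e : ∀ γ : ZMod p, γ * 2⁻¹ * (2 * x) = γ * x := by intro γ; field_simp
  simp [mem_bohr, hf, e]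

lemma hf_image {p : ℕ} [Fact p.Prime] (h2 : p ≠ 2) (Γ : Finset (ZMod p)) (r : ℝ) :
    (bohr Γ r).image (fun x => 2 * x) = bohr (hf Γ) r := by
  have h := two_ne h2
  ext y
  simp only [mem_image]
  constructor
  · rintro ⟨x, hx, rfl⟩; exact (mem_hf h2 Γ r x).mpr hx
  · intro hy
    refine ⟨2⁻¹ * y, ?_, by field_simp⟩
    rw [← mem_hf h2]
    convert hy using 1
    field_simp

lemma two_inj {p : ℕ} [Fact p.Prime] (h2 : p ≠ 2) : Function.Injective (fun x : ZMod p => 2 * x) :=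
  mul_right_injective₀ (two_ne h2)

lemma hf_bohr_card {p : ℕ} [Fact p.Prime] (h2 : p ≠ 2) (Γ : Finset (ZMod p)) (r : ℝ) :
    (bohr (hf Γ) r).card = (bohr Γ r).card := by
  rw [← hf_image h2, card_image_of_injective _ (two_inj h2)]

lemma hf_sub {p : ℕ} [Fact p.Prime] (h2 : p ≠ 2) (Γ : Finset (ZMod p)) (r : ℝ) :
    bohr (hf Γ) r ⊆ bohr Γ (2 * r) := by
  have h := two_ne h2
  intro x hx
  rw [mem_bohr] at *
  intro γ hγ
  have h1 := hx (γ * 2⁻¹) (mem_image_of_mem _ hγ)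
  have : γ * x = γ * 2⁻¹ * x + γ * 2⁻¹ * x := by field_simp; ring
  rw [this]
  refine (ee_sub_one_add _ _).trans ?_
  linarith

lemma hf_reg {p : ℕ} [Fact p.Prime] (h2 : p ≠ 2) {Γ : Finset (ZMod p)} {κ η r : ℝ} (h : Reg Γ κ η r) :
    Reg (hf Γ) κ η r := by
  unfold Reg at *
  rwa [hf_bohr_card h2, hf_bohr_card h2]

/-- the number of elements of `B` that land in `A` after translation by `x` -/
noncomputable def nn {p : ℕ} (A B : Finset (ZMod p)) (x : ZMod p) : ℝ := ((B.filter fun t => x + t ∈ A).card : ℝ)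

lemma nn_avg {p : ℕ} [NeZero p] (A B0 B : Finset (ZMod p)) (x0 : ZMod p) (α η : ℝ)
    (h0 : α * B0.card ≤ nn A B0 x0)
    (hB : ∀ b ∈ B, ((B0.filter fun t => t - b ∉ B0).card : ℝ) ≤ η * B0.card) :
    B.card * ((α - η) * B0.card) ≤ ∑ t ∈ B0, nn A B (x0 + t) := by
  classical
  have e : ∑ t ∈ B0, nn A B (x0 + t) = ∑ b ∈ B, ((B0.filter fun t => x0 + t + b ∈ A).card : ℝ) := by
    unfold nn
    simp_rw [card_filter]
    push_cast
    rw [sum_comm]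
  rw [e, ← nsmul_eq_mul]
  refine card_nsmul_le_sum _ _ _ fun b hb => ?_
  have h1 : (B0.filter fun t => x0 + t ∈ A).card ≤ (B0.filter fun t => t - b ∉ B0).card
      + (B0.filter fun t => x0 + t + b ∈ A).card := by
    calc _ ≤ ((B0.filter fun t => t - b ∉ B0) ∪ (B0.filter fun t => x0 + t + b ∈ A).image (fun t => t + b)).card := by
          refine card_le_card fun t ht => ?_
          have ht := mem_filter.mp ht
          by_cases hc : t - b ∈ B0
          · refine mem_union_right _ (mem_image.mpr ⟨t - b, mem_filter.mpr ⟨hc, ?_⟩, by ring⟩)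
            convert ht.2 using 1; ring
          · exact mem_union_left _ (mem_filter.mpr ⟨ht.1, hc⟩)
      _ ≤ _ := (card_union_le _ _).trans (Nat.add_le_add_left card_image_le _)
  have h1' : nn A B0 x0 ≤ ((B0.filter fun t => t - b ∉ B0).card : ℝ)
      + ((B0.filter fun t => x0 + t + b ∈ A).card : ℝ) := by unfold nn; exact_mod_cast h1
  have := hB b hb
  linarith

lemma twoscale {p : ℕ} [NeZero p] (A B0 B Y : Finset (ZMod p)) (x0 : ZMod p) (α η : ℝ) (hB0 : B0.Nonempty)
    (hBn : B.Nonempty) (hYn : Y.Nonempty)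
    (h0 : α * B0.card ≤ nn A B0 x0)
    (hB : ∀ b ∈ B, ((B0.filter fun t => t - b ∉ B0).card : ℝ) ≤ η * B0.card)
    (hY : ∀ b ∈ Y, ((B0.filter fun t => t - b ∉ B0).card : ℝ) ≤ η * B0.card) :
    ∃ x, 2 * (α - η) ≤ nn A B x / B.card + nn A Y x / Y.card := by
  have h1 := nn_avg A B0 B x0 α η h0 hB
  have h2 := nn_avg A B0 Y x0 α η h0 hY
  have p1 : (0 : ℝ) < B.card := by exact_mod_cast hBn.card_pos
  have p2 : (0 : ℝ) < Y.card := by exact_mod_cast hYn.card_pos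
  have h3 : ∑ t ∈ B0, (2 * (α - η)) ≤ ∑ t ∈ B0, (nn A B (x0 + t) / B.card + nn A Y (x0 + t) / Y.card) := by
    rw [sum_add_distrib, ← sum_div, ← sum_div, sum_const, nsmul_eq_mul]
    have e1 := (le_div_iff₀' p1).mpr h1
    have e2 := (le_div_iff₀' p2).mpr h2
    linarith
  obtain ⟨t, _, ht⟩ := exists_le_of_sum_le hB0 h3
  exact ⟨x0 + t, ht⟩

/-- number of three term progressions -/
noncomputable def aps {p : ℕ} [NeZero p] (A : Finset (ZMod p)) : ℝ :=
  ∑ n : ZMod p, ∑ d : ZMod p, ic A n * ic A (n + d) * ic A (n + 2 * d)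

lemma aps_lower {p : ℕ} [NeZero p] (A B Y : Finset (ZMod p)) (x : ZMod p) :
    ∑ y ∈ Y.filter (fun t => x + t ∈ A), cvv (ic (B.filter fun t => x + t ∈ A)) (2 * y) ≤ aps A := by
  classical
  have e : aps A = ∑ y, ∑ n, ic A (x + y) * ic A (x + n) * ic A (x + (2 * y - n)) := by
    unfold aps
    rw [← Equiv.sum_comp (Equiv.addLeft x), sum_comm]
    rw [sum_comm]
    rw [sum_comm (s := univ) (t := univ) (f := fun y n => ic A (x + y) * ic A (x + n) * ic A (x + (2 * y - n)))]
    refine sum_congr rfl fun n _ => ?_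
    rw [← Equiv.sum_comp (Equiv.addRight (-n))]
    refine sum_congr rfl fun y _ => ?_
    simp only [Equiv.coe_addLeft, Equiv.coe_addRight]
    rw [show x + n + (y + -n) = x + y by ring, show x + n + 2 * (y + -n) = x + (2 * y - n) by ring]
    ring
  rw [e]
  have h1 : ∀ y ∈ Y.filter (fun t => x + t ∈ A), cvv (ic (B.filter fun t => x + t ∈ A)) (2 * y)
      ≤ ∑ n, ic A (x + y) * ic A (x + n) * ic A (x + (2 * y - n)) := by
    intro y hy
    have hy := (mem_filter.mp hy).2
    unfold cvv
    refine sum_le_sum fun n _ => ?_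
    have h2 : ∀ z, ic (B.filter fun t => x + t ∈ A) z ≤ ic A (x + z) := by
      intro z
      unfold ic
      by_cases hz : x + z ∈ A
      · simp only [hz, if_true]; split_ifs <;> norm_num
      · simp [hz]
    have h3 : ic A (x + y) = 1 := by simp [ic, hy]
    rw [h3, one_mul]
    exact mul_le_mul (h2 _) (h2 _) (ic_nonneg _ _) (ic_nonneg _ _)
  refine (sum_le_sum h1).trans ?_
  refine sum_le_sum_of_subset_of_nonneg (subset_univ _) fun y _ _ => ?_
  exact sum_nonneg fun n _ => mul_nonneg (mul_nonneg (ic_nonneg _ _) (ic_nonneg _ _)) (ic_nonneg _ _)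

set_option maxHeartbeats 1000000 in
lemma core {p : ℕ} [NeZero p] (Δ A B C : Finset (ZMod p)) (r' η κ α : ℝ) (d h : ℕ)
    (P a n m h4 : ℕ) (ε ε1 : ℝ)
    (hd1 : 1 ≤ d) (hh : 1 ≤ h) (hκ : κ = 1 / (16 * d * h)) (hηh : η = 1 / h) (hr' : 0 < r') (hr'2 : r' ≤ 1)
    (hDd : Δ.card + m ≤ d) (hreg : Reg Δ κ η r')
    (hAB : A ⊆ B) (hBn : B.Nonempty) (hsym : ∀ y ∈ B, -y ∈ B)
    (hα : (A.card : ℝ) = α * B.card) (hη : η ≤ α / 1000)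
    (hsh : ∀ v ∈ bohr Δ r', ((B.filter fun y => y + v ∉ B).card : ℝ) ≤ η * B.card)
    (hCD : C ⊆ bohr Δ r') (hC : C.Nonempty)
    (hP : 25 ≤ P) (hPe : Even P) (hDC : ((bohr Δ r').card : ℝ) ≤ 2 ^ P * C.card)
    (hfew : ∑ c ∈ C, cvv (ic A) c ≤ 1 / 2 * (α * A.card) * C.card)
    (ha : 1 ≤ a) (hn : 1 ≤ n) (hε : 0 < ε) (hε1 : 0 ≤ ε1) (hh4 : 1 ≤ h4)
    (hσ : (1 / 2 : ℝ) ^ a ≤ α ^ (64 * P) / 8)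
    (hnum1 : a * (2 * ε + 16 * 2 ^ a * Real.exp (-(n * ε ^ 2 / 2))) ≤ 1 / 1000)
    (hm : 2 / ((1 / 2 : ℝ) ^ ((a + 1) * n + 1)) < Real.exp ((m + 1 : ℕ) / 8))
    (hc1 : 2 * (1 / (h4 : ℝ)) / (1 / 3) ^ (m + 1) ≤ ε1 / 2)
    (hc2 : m * (1 / (16 * d * h4)) ≤ ε1 / 2)
    (hfin : √(2 * 2 ^ a) * (ε1 + 2 * (1 / 4) ^ a) ≤ 1 / 1000) :
    ∃ (Γ : Finset (ZMod p)) (r3 : ℝ) (x : ZMod p), Γ.card ≤ Δ.card + m ∧ Reg Γ κ η r3 ∧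
      (κ / 16) ^ 2 * (κ / (16 * a)) * (1 / (16 * d * h4) / 2) * r' ≤ r3 ∧ r3 ≤ r' ∧
      (1 + 1 / 600) * α * (bohr Γ r3).card ≤ nn A (bohr Γ r3) x := by
  classical
  have hdp : (1 : ℝ) ≤ d := by exact_mod_cast hd1
  have hhp : (1 : ℝ) ≤ h := by exact_mod_cast hh
  have hh4p : (1 : ℝ) ≤ h4 := by exact_mod_cast hh4
  have hap : (1 : ℝ) ≤ a := by exact_mod_cast ha
  have hκ0 : 0 < κ := by rw [hκ]; positivity
  have hdh : (1 : ℝ) ≤ d * h := one_le_mul_of_one_le_of_one_le hdp hhp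
  have hdh4 : (1 : ℝ) ≤ d * h4 := one_le_mul_of_one_le_of_one_le hdp hh4p
  have hκ1 : κ ≤ 1 / 16 := by
    rw [hκ]
    refine one_div_le_one_div_of_le (by norm_num) ?_
    linarith
  have hη0 : 0 < η := by rw [hηh]; positivity
  have hη1 : η ≤ 1 := by rw [hηh, div_le_one (by linarith)]; exact hhp
  have hα0 : 0 < α := by linarith
  have hBp : (0 : ℝ) < B.card := by exact_mod_cast hBn.card_pos
  have hAp : (0 : ℝ) < A.card := by rw [hα]; positivity
  have hA : A.Nonempty := by rw [← card_pos]; exact_mod_cast hAp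
  -- radii
  have hκr : 0 < κ * r' / 8 := by positivity
  obtain ⟨ra, ra1, ra2, rareg⟩ := reg_exists Δ d h (by omega) hd1 hh hκr
  rw [← hκ, ← hηh] at rareg
  have ra0 : 0 < ra := by linarith
  have hκra : 0 < κ * ra / 8 := by positivity
  obtain ⟨rb, rb1, rb2, rbreg⟩ := reg_exists Δ d h (by omega) hd1 hh hκra
  rw [← hκ, ← hηh] at rbreg
  have rb0 : 0 < rb := by linarith
  have hκrb : 0 < κ * rb / (8 * a) := by positivity
  obtain ⟨r4, r41, r42, r4reg⟩ := reg_exists Δ d h4 (by omega) hd1 hh4 hκrb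
  set κ4 : ℝ := 1 / (16 * d * h4) with hκ4
  have hκ40 : 0 < κ4 := by rw [hκ4]; positivity
  have r40 : 0 < r4 := by linarith
  have r42' : a * r4 ≤ κ * rb / 8 := by
    rw [le_div_iff₀ (by positivity)] at r42
    linarith
  have r43 : r4 ≤ a * r4 := le_mul_of_one_le_left r40.le hap
  have k1 : κ * r' ≤ 1 / 16 * r' := mul_le_mul_of_nonneg_right hκ1 hr'.le
  have k2 : κ * ra ≤ 1 / 16 * ra := mul_le_mul_of_nonneg_right hκ1 ra0.le
  have r44 : κ * rb ≤ 1 / 16 * rb := mul_le_mul_of_nonneg_right hκ1 rb0.le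
  have ra3 : ra ≤ r' / 128 := by linarith
  have rb3 : rb ≤ ra / 128 := by linarith
  have rb4 : κ * rb ≤ κ * ra := mul_le_mul_of_nonneg_left (by linarith) hκ0.le
  set B1 := bohr Δ ra with hB1
  set B2 := bohr Δ rb with hB2
  set B4 := bohr Δ r4 with hB4
  have B1p : (0 : ℝ) < B1.card := bohr_card_pos ra0.le
  have B2p : (0 : ℝ) < B2.card := bohr_card_pos rb0.le
  have B4p : (0 : ℝ) < B4.card := bohr_card_pos r40.le
  have B1n : B1.Nonempty := ⟨0, zero_mem_bohr ra0.le⟩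
  have B2n : B2.Nonempty := ⟨0, zero_mem_bohr rb0.le⟩
  have B4n : B4.Nonempty := ⟨0, zero_mem_bohr r40.le⟩
  have hs : 2 * ra + 2 * rb ≤ κ * r' := by linarith
  have hs' : 2 * ra + 2 * rb ≤ r' := by linarith
  have hπ : ∀ q ∈ (B1 ×ˢ B1) ×ˢ (B2 ×ˢ B2), q.1.1 - q.1.2 + q.2.1 - q.2.2 ∈ bohr Δ (2 * ra + 2 * rb) := by
    intro q hq
    simp only [mem_product] at hq
    have := bohr_sub (bohr_add (bohr_sub hq.1.1 hq.1.2) hq.2.1) hq.2.2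
    exact bohr_mono (by linarith) this
  have hsneg : ∀ v ∈ bohr Δ r', ((B.filter fun y => y - v ∉ B).card : ℝ) ≤ η * B.card := by
    intro v hv
    have := hsh (-v) (bohr_neg hv)
    simpa [sub_eq_add_neg] using this
  have lift := moment_lift ((B1 ×ˢ B1) ×ˢ (B2 ×ˢ B2)) (fun q => q.1.1 - q.1.2 + q.2.1 - q.2.2)
    (fourfold_pos B1 B2) A B C (bohr Δ r') (bohr Δ (r' + (2 * ra + 2 * rb))) hAB hCD hC hBn α η hα hη0.le hη hsym
    hsneg (fun q hq => hsneg _ (bohr_mono hs' (hπ q hq))) (fun q hq => hsh _ (bohr_mono hs' (hπ q hq)))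
    P (by omega) hPe hDC (fun c hc q hq => bohr_sub hc (hπ q hq))
    ((hreg.card_le hs).trans (by gcongr; linarith)) hfew
  obtain ⟨u, A1, A2, hA1, hA2, c1, c2, hbad⟩ := sift A B1 B2 hA B1n B2n α hα0 (64 * P) (by omega) lift
  have c1' : (1 / 2 : ℝ) ^ a * B1.card ≤ A1.card := le_trans (by gcongr) c1
  have c2' : (1 / 2 : ℝ) ^ a * B2.card ≤ A2.card := le_trans (by gcongr) c2
  have A1p : (0 : ℝ) < A1.card := lt_of_lt_of_le (by positivity) c1'
  have A2p : (0 : ℝ) < A2.card := lt_of_lt_of_le (by positivity) c2'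
  have A1n : A1.Nonempty := by rw [← card_pos]; exact_mod_cast A1p
  have A2n : A2.Nonempty := by rw [← card_pos]; exact_mod_cast A2p
  set W := bohr Δ (ra + rb) with hW
  set R := bohr Δ (rb + 2 * (a * r4)) with hR
  set E := bohr Δ (ra + r4) with hE
  have Wc : (W.card : ℝ) ≤ 2 * B1.card := (rareg.card_le (by linarith)).trans (by gcongr; linarith)
  have Rc : (R.card : ℝ) ≤ 2 * B2.card := (rbreg.card_le (by linarith)).trans (by gcongr; linarith)
  have Ec : (E.card : ℝ) ≤ 2 * B1.card := (rareg.card_le (by linarith)).trans (by gcongr; linarith)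
  set F : ZMod p → ℝ := fun w => if w ∈ W ∧ 1.005 * (α * A.card) ≤ crr (ic A) (u + w) then 1 else 0 with hF
  obtain ⟨T, hTB, Tc, hcs⟩ := croot_sisask A1 B4 E R A1n F (fun y => by rw [hF]; dsimp only; split_ifs <;> norm_num)
    (fun y => by rw [hF]; dsimp only; split_ifs <;> norm_num) (fun x hx b hb => bohr_add (hA1 hx) hb) n hn ε hε
  -- size of T
  have Tτ : (1 / 2 : ℝ) ^ ((a + 1) * n + 1) * B4.card ≤ T.card := by
    have Ep : (0 : ℝ) < E.card := bohr_card_pos (by linarith)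
    have h1 : ((1 / 2 : ℝ) ^ (a + 1)) * E.card ≤ A1.card := by
      calc ((1 / 2 : ℝ) ^ (a + 1)) * E.card ≤ ((1 / 2 : ℝ) ^ (a + 1)) * (2 * B1.card) := by gcongr
        _ = (1 / 2 : ℝ) ^ a * B1.card := by rw [pow_succ]; ring
        _ ≤ _ := c1'
    have h2 : (((1 / 2 : ℝ) ^ (a + 1)) * E.card) ^ n * B4.card ≤ 2 * T.card * (E.card : ℝ) ^ n :=
      le_trans (by gcongr) Tc
    rw [mul_pow, ← pow_mul] at h2
    have h3 : (E.card : ℝ) ^ n * ((1 / 2 : ℝ) ^ ((a + 1) * n) * B4.card) ≤ (E.card : ℝ) ^ n * (2 * T.card) := by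
      linarith
    have h4 := le_of_mul_le_mul_left h3 (by positivity)
    rw [pow_succ]; linarith
  have Tp : (0 : ℝ) < T.card := lt_of_lt_of_le (by positivity) Tτ
  have Tn : T.Nonempty := by rw [← card_pos]; exact_mod_cast Tp
  obtain ⟨L, Lc, hL⟩ := chang B4 T hTB Tn _ (by positivity) Tτ m hm
  have hΓ : (Δ ∪ L).card ≤ Δ.card + m := (card_union_le _ _).trans (by omega)
  obtain ⟨r3, r31, r32, r3reg⟩ := reg_exists (Δ ∪ L) d h (by omega) hd1 hh (mul_pos hκ40 r40)
  rw [← hκ, ← hηh] at r3reg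
  have r30 : 0 < r3 := lt_of_lt_of_le (by positivity) r31
  have hκ41 : κ4 ≤ 1 / 16 := by
    rw [hκ4]
    refine one_div_le_one_div_of_le (by norm_num) ?_
    linarith
  have k4 : κ4 * r4 ≤ 1 / 16 * r4 := mul_le_mul_of_nonneg_right hκ41 r40.le
  have k5 : κ4 * r4 ≤ κ4 * 1 := mul_le_mul_of_nonneg_left (by linarith) hκ40.le
  obtain ⟨x, hx⟩ := increment A A1 A2 W R T (bohr (Δ ∪ L) r3) A1n A2n Tn hA α hα0 u hbad
    (fun x hx y hy => bohr_sub (hA1 hx) (hA2 hy)) F (fun w => rfl) ε _ hε.le hcs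
    (fun i => bohr Δ (2 * (i * r4))) a (zero_mem_bohr (by simp))
    (by
      intro i t ht b hb b' hb'
      have := bohr_sub (bohr_add ht (hTB hb')) (hTB hb)
      refine bohr_mono ?_ this
      push_cast; linarith)
    (by
      intro i hi t ht y hy
      have := bohr_sub ht (hA2 hy)
      refine bohr_mono ?_ this
      have : (i : ℝ) ≤ a := by exact_mod_cast hi
      have := mul_le_mul_of_nonneg_right this r40.le
      linarith)
    (by
      refine le_trans ?_ hnum1
      refine mul_le_mul_of_nonneg_left ?_ (by positivity)
      refine add_le_add le_rfl ?_
      rw [div_le_iff₀ A2p]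
      calc 8 * Real.exp (-(n * ε ^ 2 / 2)) * R.card ≤ 8 * Real.exp (-(n * ε ^ 2 / 2)) * (2 * B2.card) := by gcongr
        _ = 16 * 2 ^ a * Real.exp (-(n * ε ^ 2 / 2)) * ((1 / 2 : ℝ) ^ a * B2.card) := by
            have : (2 : ℝ) ^ a * (1 / 2 : ℝ) ^ a = 1 := by rw [← mul_pow]; norm_num
            linear_combination (-16 * Real.exp (-(n * ε ^ 2 / 2)) * B2.card) * this
        _ ≤ _ := by gcongr)
    ε1 hε1
    (by
      intro ξ hξ t ht
      obtain ⟨θ, hθ1, hθ2⟩ := hL ξ hξ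
      refine (hθ2 t).trans ?_
      have t1 : ∑ l ∈ L, ‖ee (l * t) - 1‖ ≤ ε1 / 2 := by
        calc ∑ l ∈ L, ‖ee (l * t) - 1‖ ≤ ∑ l ∈ L, r3 :=
              sum_le_sum fun l hl => (mem_bohr.mp ht) l (mem_union_right _ hl)
          _ = L.card * r3 := by rw [sum_const, nsmul_eq_mul]
          _ ≤ m * κ4 := by
              have : (L.card : ℝ) ≤ m := by exact_mod_cast Lc
              have : r3 ≤ κ4 := by linarith
              gcongr
          _ ≤ _ := hc2
      have tB : t ∈ bohr Δ r3 := bohr_anti subset_union_left ht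
      have t2 := char_small B4 B4n θ t _ _ (by positivity) hθ1 (r4reg.shift r32 r30.le tB)
      linarith)
    (by
      refine le_trans ?_ hfin
      refine mul_le_mul_of_nonneg_right (Real.sqrt_le_sqrt ?_) (by positivity)
      rw [div_le_iff₀ A1p]
      have : (2 : ℝ) ^ a * (1 / 2 : ℝ) ^ a = 1 := by rw [← mul_pow]; norm_num
      calc (W.card : ℝ) ≤ 2 * B1.card := Wc
        _ = 2 * 2 ^ a * ((1 / 2 : ℝ) ^ a * B1.card) := by linear_combination (-2 * B1.card) * this
        _ ≤ _ := by gcongr)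
  refine ⟨Δ ∪ L, r3, x, hΓ, r3reg, ?_, by linarith, hx⟩
  calc (κ / 16) ^ 2 * (κ / (16 * a)) * (κ4 / 2) * r' = κ4 / 2 * ((κ / (16 * a)) * (κ / 16 * (κ * r' / 8 / 2))) := by ring
    _ ≤ κ4 / 2 * ((κ / (16 * a)) * (κ / 16 * ra)) := by gcongr
    _ = κ4 / 2 * ((κ / (16 * a)) * (κ * ra / 8 / 2)) := by ring
    _ ≤ κ4 / 2 * ((κ / (16 * a)) * rb) := by gcongr
    _ = κ4 / 2 * (κ * rb / (8 * a) / 2) := by field_simp; norm_num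
    _ ≤ κ4 / 2 * r4 := by gcongr
    _ ≤ r3 := by linarith

set_option maxHeartbeats 1000000 in
lemma step {p : ℕ} [Fact p.Prime] (hp2 : p ≠ 2) (Γ A : Finset (ZMod p)) (x0 : ZMod p) (r0 η κ α : ℝ) (d h q : ℕ)
    (P a n m h4 : ℕ) (ε ε1 : ℝ)
    (hd1 : 1 ≤ d) (hh : 1 ≤ h) (hκ : κ = 1 / (16 * d * h)) (hηh : η = 1 / h) (hr0 : 0 < r0) (hr02 : r0 ≤ 2)
    (hDd : Γ.card + m ≤ d) (hreg : Reg Γ κ η r0)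
    (hαq : (1 / 2 : ℝ) ^ q ≤ α) (hA : α * (bohr Γ r0).card ≤ nn A (bohr Γ r0) x0)
    (hη : η ≤ (1 / 2 : ℝ) ^ q / 8000)
    (hP : 25 ≤ P) (hPe : Even P) (hPq : q + 1 ≤ P)
    (ha : 1 ≤ a) (hn : 1 ≤ n) (hε : 0 < ε) (hε1 : 0 ≤ ε1) (hh4 : 1 ≤ h4)
    (hσ : (1 / 2 : ℝ) ^ a ≤ ((1 / 2 : ℝ) ^ (q + 1)) ^ (64 * P) / 8)
    (hnum1 : a * (2 * ε + 16 * 2 ^ a * Real.exp (-(n * ε ^ 2 / 2))) ≤ 1 / 1000)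
    (hm : 2 / ((1 / 2 : ℝ) ^ ((a + 1) * n + 1)) < Real.exp ((m + 1 : ℕ) / 8))
    (hc1 : 2 * (1 / (h4 : ℝ)) / (1 / 3) ^ (m + 1) ≤ ε1 / 2)
    (hc2 : m * (1 / (16 * d * h4)) ≤ ε1 / 2)
    (hfin : √(2 * 2 ^ a) * (ε1 + 2 * (1 / 4) ^ a) ≤ 1 / 1000) (w : ℝ)
    (hw : w = (κ / 16) ^ 4 * (κ / (16 * a)) * (1 / (16 * d * h4) / 2)) :
    (((1 / 2 : ℝ) ^ (q + 1)) ^ 3 / 2 * ((bohr Γ (w * r0)).card : ℝ) ^ 2 ≤ aps A) ∨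
    ∃ (Γ' : Finset (ZMod p)) (r : ℝ) (x : ZMod p), Γ'.card ≤ Γ.card + m ∧ Reg Γ' κ η r ∧
      w * r0 ≤ r ∧ r ≤ 2 ∧ (1 + 1 / 2000) * α * (bohr Γ' r).card ≤ nn A (bohr Γ' r) x := by
  classical
  have hdp : (1 : ℝ) ≤ d := by exact_mod_cast hd1
  have hhp : (1 : ℝ) ≤ h := by exact_mod_cast hh
  have hh4p : (1 : ℝ) ≤ h4 := by exact_mod_cast hh4
  have hap : (1 : ℝ) ≤ a := by exact_mod_cast ha
  have hκ0 : 0 < κ := by rw [hκ]; positivity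
  have hdh : (1 : ℝ) ≤ d * h := one_le_mul_of_one_le_of_one_le hdp hhp
  have hdh4 : (1 : ℝ) ≤ d * h4 := one_le_mul_of_one_le_of_one_le hdp hh4p
  have hκ1 : κ ≤ 1 / 16 := by
    rw [hκ]
    refine one_div_le_one_div_of_le (by norm_num) ?_
    linarith
  have hη0 : 0 < η := by rw [hηh]; positivity
  have hq0 : 0 < (1 / 2 : ℝ) ^ q := by positivity
  have hα0 : 0 < α := by linarith
  set κ4 : ℝ := 1 / (16 * d * h4) with hκ4
  have hκ40 : 0 < κ4 := by rw [hκ4]; positivity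
  have hκ41 : κ4 ≤ 1 / 16 := by
    rw [hκ4]
    refine one_div_le_one_div_of_le (by norm_num) ?_
    linarith
  -- width bounds
  have ww : (κ / (16 * a)) * (κ4 / 2) ≤ 1 := by
    have t1 : κ / (16 * a) ≤ 1 := by rw [div_le_one (by positivity)]; linarith
    have t2 : κ4 / 2 ≤ 1 := by linarith
    exact mul_le_one₀ t1 (by positivity) t2
  have ww2 : (κ / 16) ^ 2 ≤ 1 := pow_le_one₀ (by positivity) (by linarith)
  have ww0 : 0 < (κ / (16 * a)) * (κ4 / 2) := by positivity
  have hw1 : w = (κ / 16) ^ 2 * ((κ / 16) ^ 2 * (κ / (16 * a)) * (κ4 / 2)) := by rw [hw]; ring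
  have hw2 : w ≤ (κ / 16) ^ 2 := by
    rw [hw1, mul_assoc ((κ / 16) ^ 2) (κ / (16 * a))]
    exact mul_le_of_le_one_right (by positivity) (mul_le_one₀ ww2 ww0.le ww)
  -- radii
  have k0 : κ * r0 ≤ 1 / 16 * r0 := mul_le_mul_of_nonneg_right hκ1 hr0.le
  obtain ⟨r1, r11, r12, r1reg⟩ := reg_exists Γ d h (by omega) hd1 hh (R := κ * r0 / 8) (by positivity)
  rw [← hκ, ← hηh] at r1reg
  have r10 : 0 < r1 := lt_of_lt_of_le (by positivity) r11
  have k1 : κ * r1 ≤ 1 / 16 * r1 := mul_le_mul_of_nonneg_right hκ1 r10.le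
  obtain ⟨r', r'1, r'2, r'reg⟩ := reg_exists Γ d h (by omega) hd1 hh (R := κ * r1 / 8) (by positivity)
  rw [← hκ, ← hηh] at r'reg
  have r'0 : 0 < r' := lt_of_lt_of_le (by positivity) r'1
  have hr'w : (κ / 16) ^ 2 * r0 ≤ r' := by
    calc (κ / 16) ^ 2 * r0 = κ / 16 * (κ * r0 / 8 / 2) := by ring
      _ ≤ κ / 16 * r1 := by gcongr
      _ = κ * r1 / 8 / 2 := by ring
      _ ≤ _ := r'1
  have hr'1 : r' ≤ r1 := by linarith
  have hwr' : w * r0 ≤ r' := (mul_le_mul_of_nonneg_right hw2 hr0.le).trans hr'w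
  set B0 := bohr Γ r0 with hB0
  set B := bohr Γ r1 with hB
  set Y := bohr Γ r' with hY
  have Bp : (0 : ℝ) < B.card := bohr_card_pos r10.le
  have Yp : (0 : ℝ) < Y.card := bohr_card_pos r'0.le
  have sh0 : ∀ b ∈ B, ((B0.filter fun t => t - b ∉ B0).card : ℝ) ≤ η * B0.card := by
    intro b hb
    simpa [sub_eq_add_neg] using hreg.shift (s := r1) (by linarith) r10.le (bohr_neg hb)
  have hYB : Y ⊆ B := bohr_mono hr'1
  obtain ⟨x, hx⟩ := twoscale A B0 B Y x0 α η ⟨0, zero_mem_bohr hr0.le⟩ ⟨0, zero_mem_bohr r10.le⟩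
    ⟨0, zero_mem_bohr r'0.le⟩ hA sh0 (fun b hb => sh0 b (hYB hb))
  by_cases c1 : (1 + 1 / 2000) * α * B.card ≤ nn A B x
  · exact Or.inr ⟨Γ, r1, x, by omega, r1reg, by linarith, by linarith, c1⟩
  by_cases c2 : (1 + 1 / 2000) * α * Y.card ≤ nn A Y x
  · exact Or.inr ⟨Γ, r', x, by omega, r'reg, hwr', by linarith, c2⟩
  push Not at c1 c2
  rw [← div_lt_iff₀ Bp] at c1
  rw [← div_lt_iff₀ Yp] at c2
  have d1 : 0.999 * α ≤ nn A B x / B.card := by norm_num at *; linarith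
  have d2 : 0.999 * α ≤ nn A Y x / Y.card := by norm_num at *; linarith
  set A' := B.filter fun t => x + t ∈ A with hA'
  set α' := nn A B x / B.card with hα'
  have hα'c : (A'.card : ℝ) = α' * B.card := by
    rw [hα', div_mul_cancel₀ _ Bp.ne']; rfl
  set C0 := Y.filter fun t => x + t ∈ A with hC0
  have hC0c : 0.999 * α * Y.card ≤ C0.card := by
    rw [le_div_iff₀ Yp] at d2; exact d2
  set C := C0.image (fun y => 2 * y) with hC
  have hCc : C.card = C0.card := card_image_of_injective _ (two_inj hp2)
  have C0p : (0 : ℝ) < C0.card := lt_of_lt_of_le (by positivity) hC0c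
  have hαq1 : (1 / 2 : ℝ) ^ (q + 1) ≤ 0.999 * α := by
    rw [pow_succ]; norm_num at *; linarith
  have hαq1' : (1 / 2 : ℝ) ^ (q + 1) ≤ α' := hαq1.trans d1
  by_cases hmany : 1 / 2 * (α' * A'.card) * C.card < ∑ c ∈ C, cvv (ic A') c
  · left
    have e1 : ∑ c ∈ C, cvv (ic A') c = ∑ y ∈ C0, cvv (ic A') (2 * y) :=
      sum_image fun y _ y' _ h => two_inj hp2 h
    have h1 := aps_lower A B Y x
    have hYw : ((bohr Γ (w * r0)).card : ℝ) ≤ Y.card := Nat.cast_le.mpr (card_le_card (bohr_mono hwr'))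
    have hYB' : (Y.card : ℝ) ≤ B.card := Nat.cast_le.mpr (card_le_card hYB)
    refine le_trans ?_ h1
    rw [← e1]
    refine le_trans ?_ hmany.le
    rw [hα'c, hCc]
    set s := (1 / 2 : ℝ) ^ (q + 1) with hs
    have hs0 : 0 < s := by positivity
    have hα'0 : 0 ≤ α' := hs0.le.trans hαq1'
    have hα'1 : 0 ≤ α' * B.card := by positivity
    have hα'2 : 0 ≤ α' * (α' * B.card) := by positivity
    calc s ^ 3 / 2 * ((bohr Γ (w * r0)).card : ℝ) ^ 2 ≤ s ^ 3 / 2 * (Y.card : ℝ) ^ 2 := by gcongr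
      _ = 1 / 2 * (s * (s * Y.card)) * (s * Y.card) := by ring
      _ ≤ 1 / 2 * (α' * (α' * B.card)) * (0.999 * α * Y.card) := by gcongr
      _ ≤ 1 / 2 * (α' * (α' * B.card)) * C0.card := by
          have : 0 ≤ 1 / 2 * (α' * (α' * B.card)) := by have := hs0.le.trans hαq1'; positivity
          exact mul_le_mul_of_nonneg_left hC0c this
  · right
    push Not at hmany
    have hDY : ((bohr (hf Γ) r').card : ℝ) = Y.card := by rw [hf_bohr_card hp2]
    obtain ⟨Γ', r3, z, g1, g2, g3, g4, g5⟩ := core (hf Γ) A' B C r' η κ α' d h P a n m h4 ε ε1 hd1 hh hκ hηh r'0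
      (by linarith) (by have := hf_card Γ; omega) (hf_reg hp2 r'reg) (filter_subset _ _)
      ⟨0, zero_mem_bohr r10.le⟩ (fun y hy => bohr_neg hy) hα'c
      (by
        have : 0.999 * α / 1000 ≤ α' / 1000 := by gcongr
        norm_num at *
        linarith)
      (fun v hv => r1reg.shift (s := 2 * r') (by linarith) (by linarith) (hf_sub hp2 Γ r' hv))
      (by rw [← hf_image hp2]; exact image_subset_image (filter_subset _ _))
      (by rw [← card_pos, hCc]; exact_mod_cast C0p) hP hPe
      (by
        rw [hDY, hCc]
        have t1 : (1 / 2 : ℝ) ^ (q + 1) * Y.card ≤ C0.card :=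
          (mul_le_mul_of_nonneg_right hαq1 Yp.le).trans hC0c
        have t2 : (2 : ℝ) ^ (q + 1) ≤ 2 ^ P := pow_le_pow_right₀ (by norm_num) hPq
        have t3 : (2 : ℝ) ^ (q + 1) * (1 / 2 : ℝ) ^ (q + 1) = 1 := by rw [← mul_pow]; norm_num
        calc (Y.card : ℝ) = 2 ^ (q + 1) * ((1 / 2 : ℝ) ^ (q + 1) * Y.card) := by rw [← mul_assoc, t3, one_mul]
          _ ≤ 2 ^ P * C0.card := by gcongr)
      hmany ha hn hε hε1 hh4 (hσ.trans (by gcongr)) hnum1 hm hc1 hc2 hfin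
    refine ⟨Γ', r3, x + z, by have := hf_card Γ; omega, g2, ?_, by linarith, ?_⟩
    · refine le_trans ?_ g3
      rw [hw1, ← hκ4]
      calc _ = (κ / 16) ^ 2 * (κ / (16 * a)) * (κ4 / 2) * ((κ / 16) ^ 2 * r0) := by ring
        _ ≤ _ := by gcongr
    · have t1 : nn A' (bohr Γ' r3) z ≤ nn A (bohr Γ' r3) (x + z) := by
        unfold nn
        refine Nat.cast_le.mpr (card_le_card fun t ht => ?_)
        have ht := mem_filter.mp ht
        refine mem_filter.mpr ⟨ht.1, ?_⟩
        have := (mem_filter.mp ht.2).2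
        rwa [add_assoc]
      refine le_trans ?_ (g5.trans t1)
      refine mul_le_mul_of_nonneg_right ?_ (by positivity)
      have : (1 + 1 / 600) * (0.999 * α) ≤ (1 + 1 / 600) * α' := by gcongr
      norm_num at *
      linarith

lemma nn_le {p : ℕ} (A B : Finset (ZMod p)) (x : ZMod p) : nn A B x ≤ B.card :=
  Nat.cast_le.mpr (card_filter_le _ _)

set_option maxHeartbeats 1000000 in
lemma iteration {p : ℕ} [Fact p.Prime] (hp2 : p ≠ 2) (A : Finset (ZMod p)) (η κ : ℝ) (d h q : ℕ)
    (P a n m h4 J ω : ℕ) (ε ε1 : ℝ) (hq : 1 ≤ q)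
    (hd1 : 1 ≤ d) (hh : 1 ≤ h) (hκ : κ = 1 / (16 * d * h)) (hηh : η = 1 / h)
    (hJ : J = 4000 * q) (hDd : J * m ≤ d)
    (hA : (1 / 2 : ℝ) ^ q * p ≤ A.card)
    (hη : η ≤ (1 / 2 : ℝ) ^ q / 8000)
    (hP : 25 ≤ P) (hPe : Even P) (hPq : q + 1 ≤ P)
    (ha : 1 ≤ a) (hn : 1 ≤ n) (hε : 0 < ε) (hε1 : 0 ≤ ε1) (hh4 : 1 ≤ h4)
    (hσ : (1 / 2 : ℝ) ^ a ≤ ((1 / 2 : ℝ) ^ (q + 1)) ^ (64 * P) / 8)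
    (hnum1 : a * (2 * ε + 16 * 2 ^ a * Real.exp (-(n * ε ^ 2 / 2))) ≤ 1 / 1000)
    (hm : 2 / ((1 / 2 : ℝ) ^ ((a + 1) * n + 1)) < Real.exp ((m + 1 : ℕ) / 8))
    (hc1 : 2 * (1 / (h4 : ℝ)) / (1 / 3) ^ (m + 1) ≤ ε1 / 2)
    (hc2 : m * (1 / (16 * d * h4)) ≤ ε1 / 2)
    (hfin : √(2 * 2 ^ a) * (ε1 + 2 * (1 / 4) ^ a) ≤ 1 / 1000) (w : ℝ)
    (hw : w = (κ / 16) ^ 4 * (κ / (16 * a)) * (1 / (16 * d * h4) / 2))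
    (hω : (1 / 2 : ℝ) ^ ω ≤ w) :
    ((1 / 2 : ℝ) ^ (q + 1)) ^ 3 / 2 * ((p : ℝ) / 49 ^ (d * (ω * J))) ^ 2 ≤ aps A := by
  classical
  have hw0 : 0 ≤ w := le_trans (by positivity) hω
  by_contra hcon
  have key : ∀ j, j ≤ J → ∃ (Γ : Finset (ZMod p)) (r : ℝ) (x : ZMod p), Γ.card ≤ j * m ∧ Reg Γ κ η r ∧
      ((1 / 2 : ℝ) ^ ω) ^ j * 2 ≤ r ∧ r ≤ 2 ∧
      (1 + 1 / 2000 : ℝ) ^ j * (1 / 2) ^ q * (bohr Γ r).card ≤ nn A (bohr Γ r) x := by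
    intro j
    induction j with
    | zero =>
      intro _
      have hu : ∀ r, bohr (∅ : Finset (ZMod p)) r = univ := by intro r; ext x; simp [mem_bohr]
      refine ⟨∅, 2, 0, by simp, ?_, by simp, le_rfl, ?_⟩
      · unfold Reg
        rw [hu, hu]
        have hη0 : 0 ≤ η := by rw [hηh]; positivity
        have : (0 : ℝ) ≤ (univ : Finset (ZMod p)).card := by positivity
        nlinarith
      · rw [hu]
        unfold nn
        simpa [ZMod.card] using hA
    | succ j ih =>
      intro hj
      obtain ⟨Γ, r, x, h1, h2, h3, h4', h5⟩ := ih (by omega)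
      have hjm : (j + 1) * m ≤ J * m := Nat.mul_le_mul_right m hj
      have hjm' : (j + 1) * m = j * m + m := by ring
      have hr0 : 0 < r := lt_of_lt_of_le (by positivity) h3
      have hα : (1 / 2 : ℝ) ^ q ≤ (1 + 1 / 2000 : ℝ) ^ j * (1 / 2) ^ q :=
        le_mul_of_one_le_left (by positivity) (one_le_pow₀ (by norm_num))
      rcases step hp2 Γ A x r η κ _ d h q P a n m h4 ε ε1 hd1 hh hκ hηh hr0 h4' (by omega) h2 hα h5 hη hP hPe hPq
        ha hn hε hε1 hh4 hσ hnum1 hm hc1 hc2 hfin w hw with hap | ⟨Γ', r', x', g1, g2, g3, g4, g5⟩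
      · exfalso
        refine hcon (le_trans ?_ hap)
        refine mul_le_mul_of_nonneg_left ?_ (by positivity)
        refine pow_le_pow_left₀ (by positivity) ?_ 2
        rw [div_le_iff₀ (by positivity)]
        have hr1 : (2 : ℝ) / 2 ^ (ω * J) ≤ w * r := by
          calc (2 : ℝ) / 2 ^ (ω * J) = (1 / 2) ^ (ω * J) * 2 := by rw [one_div, inv_pow]; ring
            _ ≤ (1 / 2) ^ (ω * (j + 1)) * 2 := by
                refine mul_le_mul_of_nonneg_right ?_ (by norm_num)
                exact pow_le_pow_of_le_one (by norm_num) (by norm_num) (Nat.mul_le_mul_left _ hj)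
            _ = (1 / 2) ^ ω * (((1 / 2 : ℝ) ^ ω) ^ j * 2) := by rw [pow_mul, pow_succ]; ring
            _ ≤ w * r := by gcongr
        have hb := bohr_lower Γ (ω * J)
        have hc : (49 : ℕ) ^ (Γ.card * (ω * J)) ≤ 49 ^ (d * (ω * J)) :=
          Nat.pow_le_pow_right (by norm_num) (Nat.mul_le_mul_right _ (by omega))
        have hb2 : p ≤ 49 ^ (d * (ω * J)) * (bohr Γ (w * r)).card :=
          hb.trans (Nat.mul_le_mul hc (card_le_card (bohr_mono hr1)))
        rw [mul_comm]
        exact_mod_cast hb2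
      · refine ⟨Γ', r', x', by omega, g2, ?_, g4, ?_⟩
        · refine le_trans ?_ g3
          calc ((1 / 2 : ℝ) ^ ω) ^ (j + 1) * 2 = (1 / 2) ^ ω * (((1 / 2 : ℝ) ^ ω) ^ j * 2) := by rw [pow_succ]; ring
            _ ≤ w * r := by gcongr
        · refine le_trans (le_of_eq ?_) g5
          rw [pow_succ]; ring
  obtain ⟨Γ, r, x, _, _, h3, _, h5⟩ := key J le_rfl
  have h6 := h5.trans (nn_le _ _ _)
  have hr0 : 0 < r := lt_of_lt_of_le (by positivity) h3
  have hbp : (0 : ℝ) < (bohr Γ r).card := bohr_card_pos hr0.le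
  have h7 : (1 + 1 / 2000 : ℝ) ^ J * (1 / 2) ^ q ≤ 1 := by
    by_contra hc
    push Not at hc
    have := mul_lt_mul_of_pos_right hc hbp
    linarith
  have h8 : (2 : ℝ) ≤ (1 + 1 / 2000 : ℝ) ^ 2000 := by
    refine le_trans (le_of_eq ?_) (one_add_mul_le_pow (a := (1 / 2000 : ℝ)) (by norm_num) 2000)
    push_cast; ring
  have h9 : ((4 : ℝ)) ^ q ≤ (1 + 1 / 2000 : ℝ) ^ J := by
    rw [hJ, show 4000 * q = 2000 * (2 * q) by ring, pow_mul, show (4 : ℝ) = 2 ^ 2 by norm_num, ← pow_mul]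
    exact pow_le_pow_left₀ (by norm_num) h8 _
  have h10 : (2 : ℝ) ^ q ≤ 1 := by
    calc (2 : ℝ) ^ q = 4 ^ q * (1 / 2) ^ q := by rw [← mul_pow]; norm_num
      _ ≤ (1 + 1 / 2000 : ℝ) ^ J * (1 / 2) ^ q := by gcongr
      _ ≤ 1 := h7
  have h11 : (2 : ℝ) ^ 1 ≤ 2 ^ q := pow_le_pow_right₀ (by norm_num) hq
  linarith

lemma pow_half_le (a b : ℕ) (h : b ≤ a) : (1 / 2 : ℝ) ^ a ≤ (1 / 2) ^ b :=
  pow_le_pow_of_le_one (by norm_num) (by norm_num) h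

lemma num1 (a n : ℕ) (ha : 30000 ≤ a) (hn : n = 20 * 16000 ^ 2 * a ^ 3) :
    (a : ℝ) * (2 * (1 / (16000 * a)) + 16 * 2 ^ a * Real.exp (-(n * (1 / (16000 * a : ℝ)) ^ 2 / 2))) ≤ 1 / 1000 := by
  have hap : (30000 : ℝ) ≤ a := by exact_mod_cast ha
  have e1 : -((n : ℝ) * (1 / (16000 * a : ℝ)) ^ 2 / 2) = (10 * a : ℕ) * (-1 : ℝ) := by
    rw [hn]; push_cast; field_simp; norm_num
  have e2 : Real.exp (-1) ≤ 1 / 2 := by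
    rw [Real.exp_neg, one_div]
    refine inv_anti₀ (by norm_num) ?_
    have := Real.add_one_le_exp 1
    linarith
  have e3 : Real.exp (-((n : ℝ) * (1 / (16000 * a : ℝ)) ^ 2 / 2)) ≤ (1 / 2) ^ (10 * a) := by
    rw [e1, Real.exp_nat_mul]
    exact pow_le_pow_left₀ (Real.exp_pos _).le e2 _
  have e4 : (a : ℝ) ≤ 2 ^ a := by exact_mod_cast Nat.lt_two_pow_self.le
  have e5 : (2 : ℝ) ^ a * (1 / 2) ^ a = 1 := by rw [← mul_pow]; norm_num
  have e6 : (1 / 2 : ℝ) ^ a ≤ (1 / 2) ^ 20 := pow_half_le _ _ (by omega)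
  have e7 : (1 / 2 : ℝ) ^ (8 * a) ≤ (1 / 2) ^ a := pow_half_le _ _ (by omega)
  have e8 : (a : ℝ) * (2 * (1 / (16000 * a))) = 1 / 8000 := by field_simp; norm_num
  calc _ = 1 / 8000 + 16 * (a * 2 ^ a * Real.exp (-((n : ℝ) * (1 / (16000 * a : ℝ)) ^ 2 / 2))) := by
        rw [mul_add, e8]; ring
    _ ≤ 1 / 8000 + 16 * (2 ^ a * 2 ^ a * (1 / 2) ^ (10 * a)) := by gcongr
    _ = 1 / 8000 + 16 * (1 / 2) ^ (8 * a) := by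
        rw [show 10 * a = a + a + 8 * a by ring, pow_add, pow_add]
        congr 2
        calc _ = (2 ^ a * (1 / 2 : ℝ) ^ a) * (2 ^ a * (1 / 2) ^ a) * (1 / 2) ^ (8 * a) := by ring
          _ = _ := by rw [e5]; ring
    _ ≤ 1 / 8000 + 16 * (1 / 2) ^ 20 := by linarith
    _ ≤ _ := by norm_num

lemma num2 (a n m : ℕ) (ha : 30000 ≤ a) (hn : 1 ≤ n) (hm : m = 32 * a * n) :
    2 / ((1 / 2 : ℝ) ^ ((a + 1) * n + 1)) < Real.exp ((m + 1 : ℕ) / 8) := by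
  have e1 : 2 / ((1 / 2 : ℝ) ^ ((a + 1) * n + 1)) = 2 ^ ((a + 1) * n + 2) := by
    rw [one_div, inv_pow, div_inv_eq_mul, pow_succ 2 ((a + 1) * n + 1)]; ring
  have e2 : (a + 1) * n + 2 ≤ 4 * a * n := by nlinarith
  have e3 : (2 : ℝ) ≤ Real.exp 1 := by
    have := Real.add_one_le_exp 1
    linarith
  rw [e1]
  calc (2 : ℝ) ^ ((a + 1) * n + 2) ≤ 2 ^ (4 * a * n) := pow_le_pow_right₀ (by norm_num) e2
    _ ≤ (Real.exp 1) ^ (4 * a * n) := pow_le_pow_left₀ (by norm_num) e3 _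
    _ = Real.exp ((4 * a * n : ℕ) * 1) := by rw [Real.exp_nat_mul]
    _ < _ := by
        refine Real.exp_lt_exp.mpr ?_
        rw [hm]; push_cast; linarith

lemma num3 (a : ℕ) (ha : 30000 ≤ a) : √(2 * 2 ^ a) * ((1 / 2 : ℝ) ^ a / 4000 + 2 * (1 / 4) ^ a) ≤ 1 / 1000 := by
  have h1 : √(2 * 2 ^ a) ≤ (2 : ℝ) ^ a := by
    refine Real.sqrt_le_iff.mpr ⟨by positivity, ?_⟩
    rw [sq]
    have : (2 : ℝ) ^ 1 ≤ 2 ^ a := pow_le_pow_right₀ (by norm_num) (by omega)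
    gcongr
    linarith
  have e5 : (2 : ℝ) ^ a * (1 / 2) ^ a = 1 := by rw [← mul_pow]; norm_num
  have e6 : (1 / 2 : ℝ) ^ a ≤ (1 / 2) ^ 20 := pow_half_le _ _ (by omega)
  have e7 : (1 / 4 : ℝ) ^ a = (1 / 2) ^ a * (1 / 2) ^ a := by rw [← mul_pow]; norm_num
  calc _ ≤ 2 ^ a * ((1 / 2 : ℝ) ^ a / 4000 + 2 * (1 / 4) ^ a) := by gcongr
    _ = 1 / 4000 + 2 * (1 / 2) ^ a := by
        rw [e7]
        linear_combination (1 / 4000 + 2 * (1 / 2 : ℝ) ^ a) * e5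
    _ ≤ 1 / 4000 + 2 * (1 / 2) ^ 20 := by linarith
    _ ≤ _ := by norm_num

lemma num4 (q a m d h h4 ω : ℕ) (hq : 1 ≤ q) (hqa : q ≤ a) (ham : a ≤ m) (hmd : m ≤ d) (hd : 126 ≤ d)
    (hh : h = 2 ^ (q + 13)) (hh4 : h4 = 3 ^ (m + 1) * 16000 * 2 ^ a) (hω : ω = 20 * d) :
    (1 / 2 : ℝ) ^ ω ≤ (1 / (16 * d * h : ℝ) / 16) ^ 4 * (1 / (16 * d * h : ℝ) / (16 * a)) * (1 / (16 * d * h4) / 2) := by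
  have hap : (1 : ℝ) ≤ a := by exact_mod_cast hq.trans hqa
  have hdp : (1 : ℝ) ≤ d := by exact_mod_cast (by omega : 1 ≤ d)
  have hhp : (0 : ℝ) < h := by rw [hh]; positivity
  have hh4p : (0 : ℝ) < h4 := by rw [hh4]; positivity
  have e : (1 / (16 * d * h : ℝ) / 16) ^ 4 * (1 / (16 * d * h : ℝ) / (16 * a)) * (1 / (16 * d * h4) / 2)
      = 1 / (2 ^ 45 * (d ^ 6 * h ^ 5 * a * h4)) := by
    field_simp; norm_num
  rw [e, div_pow, one_pow]
  refine one_div_le_one_div_of_le (by positivity) ?_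
  have g1 : (d : ℝ) ≤ 2 ^ d := by exact_mod_cast Nat.lt_two_pow_self.le
  have g2 : (a : ℝ) ≤ 2 ^ a := by exact_mod_cast Nat.lt_two_pow_self.le
  have g3 : (h4 : ℝ) ≤ 2 ^ (2 * (m + 1) + 14 + a) := by
    rw [hh4]; push_cast
    have g0 : (2 : ℝ) ^ (2 * (m + 1) + 14 + a) = (2 ^ 2) ^ (m + 1) * 2 ^ 14 * 2 ^ a := by
      rw [pow_add, pow_add, pow_mul]
    rw [g0]
    gcongr <;> norm_num
  have g4 : (h : ℝ) = 2 ^ (q + 13) := by rw [hh]; push_cast; ring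
  calc (2 : ℝ) ^ 45 * (d ^ 6 * h ^ 5 * a * h4)
      ≤ 2 ^ 45 * ((2 ^ d) ^ 6 * (2 ^ (q + 13)) ^ 5 * 2 ^ a * 2 ^ (2 * (m + 1) + 14 + a)) := by
        rw [g4]; gcongr
    _ = 2 ^ (45 + (d * 6 + (q + 13) * 5 + a + (2 * (m + 1) + 14 + a))) := by
        rw [← pow_mul, ← pow_mul]; ring
    _ ≤ 2 ^ ω := pow_le_pow_right₀ (by norm_num) (by omega)

set_option maxHeartbeats 2000000 in
theorem roth : ∃ C : ℕ, ∀ (p : ℕ) [Fact p.Prime], p ≠ 2 → ∀ q : ℕ, 1 ≤ q → ∀ A : Finset (ZMod p),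
    (1 / 2 : ℝ) ^ q * p ≤ A.card → (1 / 2 : ℝ) ^ (C * q ^ 19) * (p : ℝ) ^ 2 ≤ aps A := by
  obtain ⟨c0, hc0⟩ : ∃ c : ℕ, c = 4000 * 32 * 30000 * (20 * 16000 ^ 2 * 30000 ^ 3) := ⟨_, rfl⟩
  refine ⟨12 * 20 * 4000 * c0 ^ 2 + 7, ?_⟩
  intro p _ hp2 q hq A hA
  obtain ⟨a, ha⟩ : ∃ a : ℕ, a = 30000 * q ^ 2 := ⟨_, rfl⟩
  obtain ⟨n, hn⟩ : ∃ n : ℕ, n = 20 * 16000 ^ 2 * a ^ 3 := ⟨_, rfl⟩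
  obtain ⟨m, hm⟩ : ∃ m : ℕ, m = 32 * a * n := ⟨_, rfl⟩
  obtain ⟨J, hJ⟩ : ∃ J : ℕ, J = 4000 * q := ⟨_, rfl⟩
  obtain ⟨d, hd⟩ : ∃ d : ℕ, d = J * m := ⟨_, rfl⟩
  obtain ⟨h, hh⟩ : ∃ h : ℕ, h = 2 ^ (q + 13) := ⟨_, rfl⟩
  obtain ⟨h4, hh4⟩ : ∃ h4 : ℕ, h4 = 3 ^ (m + 1) * 16000 * 2 ^ a := ⟨_, rfl⟩
  obtain ⟨ω, hω⟩ : ∃ ω : ℕ, ω = 20 * d := ⟨_, rfl⟩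
  have hq2 : q ≤ q ^ 2 := Nat.le_self_pow (by norm_num) q
  have ha1 : 30000 ≤ a := by omega
  have hqa : q ≤ a := by omega
  have hn1 : 1 ≤ n := by
    rw [hn]
    exact Nat.mul_pos (by norm_num) (Nat.pow_pos (by omega))
  have ham : a ≤ m := by
    rw [hm]
    calc a ≤ 32 * a := by omega
      _ ≤ 32 * a * n := Nat.le_mul_of_pos_right _ hn1
  have hJ1 : 4000 ≤ J := by omega
  have hmd : m ≤ d := by
    rw [hd]
    exact Nat.le_mul_of_pos_left _ (by omega)
  have hd1 : 126 ≤ d := by omega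
  have hdq : d = c0 * q ^ 9 := by rw [hd, hJ, hm, hn, ha, hc0]; ring
  have hh1 : 1 ≤ h := by rw [hh]; exact Nat.one_le_two_pow
  have h41 : 1 ≤ h4 := by rw [hh4]; exact Nat.one_le_iff_ne_zero.mpr (by positivity)
  have h42 : (h4 : ℝ) = 3 ^ (m + 1) * 16000 * 2 ^ a := by rw [hh4]; push_cast; ring
  have e5 : (2 : ℝ) ^ a * (1 / 2) ^ a = 1 := by rw [← mul_pow]; norm_num
  have e5' : (1 / 2 : ℝ) ^ a = 1 / 2 ^ a := by rw [div_pow, one_pow]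
  have hap : (1 : ℝ) ≤ a := by exact_mod_cast (by omega : 1 ≤ a)
  have hdp : (1 : ℝ) ≤ d := by exact_mod_cast (by omega : 1 ≤ d)
  have main := iteration hp2 A (1 / h) (1 / (16 * d * h)) d h q (100 * q) a n m h4 J ω (1 / (16000 * a))
    ((1 / 2) ^ a / 4000) hq (by omega) hh1 rfl rfl hJ hd.ge hA
    (by
      rw [hh, div_pow, one_pow]; push_cast
      rw [div_div]
      refine one_div_le_one_div_of_le (by positivity) ?_
      rw [pow_add]
      gcongr
      norm_num)
    (by omega) ⟨50 * q, by ring⟩ (by omega) (by omega) hn1 (by positivity) (by positivity) h41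
    (by
      rw [← pow_mul]
      have e8 : (1 / 2 : ℝ) ^ ((q + 1) * (64 * (100 * q))) / 8 = (1 / 2 : ℝ) ^ ((q + 1) * (64 * (100 * q)) + 3) := by
        rw [pow_add]; norm_num; ring
      rw [e8]
      refine pow_half_le _ _ ?_
      rw [ha]; nlinarith)
    (num1 a n ha1 hn) (num2 a n m ha1 hn1 hm)
    (by
      rw [h42, e5', div_pow, one_pow]
      refine le_of_eq ?_
      field_simp
      norm_num)
    (by
      have hmd' : (m : ℝ) ≤ d := by exact_mod_cast hmd
      have h43 : 16000 * 2 ^ a ≤ (h4 : ℝ) := by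
        rw [h42, mul_assoc]
        exact le_mul_of_one_le_left (by positivity) (one_le_pow₀ (by norm_num))
      calc (m : ℝ) * (1 / (16 * d * h4)) ≤ d * (1 / (16 * d * (16000 * 2 ^ a))) := by gcongr
        _ = 1 / (16 * (16000 * 2 ^ a)) := by field_simp
        _ ≤ _ := by
            rw [e5', div_div, div_div]
            refine one_div_le_one_div_of_le (by positivity) ?_
            have : (0 : ℝ) < 2 ^ a := by positivity
            linarith)
    (num3 a ha1) _ rfl (num4 q a m d h h4 ω hq hqa ham hmd hd1 hh hh4 hω)
  refine le_trans ?_ main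
  have f1 : (49 : ℝ) ^ (d * (ω * J)) ≤ 2 ^ (6 * (d * (ω * J))) := by
    rw [pow_mul 2 6]; exact pow_le_pow_left₀ (by norm_num) (by norm_num) _
  have f2 : (p : ℝ) * (1 / 2) ^ (6 * (d * (ω * J))) ≤ p / 49 ^ (d * (ω * J)) := by
    rw [div_pow, one_pow, mul_one_div]
    gcongr
  have f3 : (3 * (q + 1) + 1) + 12 * (d * (ω * J)) ≤ (12 * 20 * 4000 * c0 ^ 2 + 7) * q ^ 19 := by
    have : 12 * (d * (ω * J)) = 12 * 20 * 4000 * c0 ^ 2 * q ^ 19 := by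
      rw [hω, hdq, hJ]; ring
    have h1 : q ≤ q ^ 19 := Nat.le_self_pow (by norm_num) q
    rw [this, add_mul]
    omega
  calc (1 / 2 : ℝ) ^ ((12 * 20 * 4000 * c0 ^ 2 + 7) * q ^ 19) * (p : ℝ) ^ 2
      ≤ (1 / 2 : ℝ) ^ ((3 * (q + 1) + 1) + 12 * (d * (ω * J))) * (p : ℝ) ^ 2 := by
        gcongr ?_ * _
        exact pow_half_le _ _ f3
    _ = ((1 / 2 : ℝ) ^ (q + 1)) ^ 3 / 2 * (p * (1 / 2) ^ (6 * (d * (ω * J)))) ^ 2 := by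
        rw [pow_add, show 12 * (d * (ω * J)) = 6 * (d * (ω * J)) * 2 by ring, pow_mul, pow_succ _ (3 * (q + 1)),
          mul_comm 3 (q + 1), pow_mul]
        ring
    _ ≤ _ := by gcongr

lemma lam_ft {p : ℕ} [Fact p.Prime] (h2 : p ≠ 2) (f : ZMod p → ℝ) :
    (Lam p f : ℂ) = ∑ ξ, ft (fun x => (f x : ℂ)) ξ ^ 2 * ft (fun x => (f x : ℂ)) (-(2 * ξ)) := by
  have hp : (p : ℂ) ≠ 0 := by exact_mod_cast (Fact.out : p.Prime).ne_zero
  set F : ZMod p → ℂ := fun x => (f x : ℂ) with hF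
  have h20 := two_ne h2
  have hb : Function.Bijective (fun x : ZMod p => -(2 * x)) := by
    refine Finite.injective_iff_bijective.mp ?_
    intro x y h
    exact two_inj h2 (neg_injective h)
  have hc : ∀ n : ZMod p, Function.Bijective (fun d : ZMod p => n + 2 * d) := by
    intro n
    refine Finite.injective_iff_bijective.mp ?_
    intro x y h
    exact two_inj h2 (add_left_cancel h)
  have hpf : ∀ ξ, ∑ x, F x * ee (-(ξ * x)) = p * ft F ξ := by
    intro ξ
    rw [ft, mul_inv_cancel_left₀ hp]
  have e1 : ∀ n d : ZMod p, F n * F (n + d) * F (n + 2 * d) =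
      ∑ ξ, ft F (-(2 * ξ)) * ((F n * ee (-(ξ * n))) * (F (n + 2 * d) * ee (-(ξ * (n + 2 * d))))) := by
    intro n d
    rw [ft_inv F (n + d)]
    rw [← hb.sum_comp (fun ξ => ft F ξ * ee (ξ * (n + d))), mul_sum, sum_mul]
    refine sum_congr rfl fun ξ _ => ?_
    rw [show -(2 * ξ) * (n + d) = -(ξ * n) + -(ξ * (n + 2 * d)) by ring, ee_add]
    ring
  have e2 : ∑ n, ∑ d, F n * F (n + d) * F (n + 2 * d) = ∑ ξ, ft F (-(2 * ξ)) * ((p * ft F ξ) * (p * ft F ξ)) := by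
    calc _ = ∑ n, ∑ ξ, ft F (-(2 * ξ)) * ((F n * ee (-(ξ * n))) * (p * ft F ξ)) := by
          refine sum_congr rfl fun n _ => ?_
          simp_rw [e1]
          rw [sum_comm]
          refine sum_congr rfl fun ξ _ => ?_
          rw [← mul_sum, ← mul_sum, (hc n).sum_comp (fun x => F x * ee (-(ξ * x))), hpf]
      _ = _ := by
          rw [sum_comm]
          refine sum_congr rfl fun ξ _ => ?_
          rw [← mul_sum, ← sum_mul, hpf]
  have e3 : (Lam p f : ℂ) = ((p : ℂ) ^ 2)⁻¹ * ∑ n, ∑ d, F n * F (n + d) * F (n + 2 * d) := by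
    rw [Lam]; push_cast; rfl
  rw [e3, e2, mul_sum]
  refine sum_congr rfl fun ξ _ => ?_
  field_simp

noncomputable def sm {p : ℕ} (B : Finset (ZMod p)) (f : ZMod p → ℝ) (n : ZMod p) : ℝ :=
  (B.card : ℝ)⁻¹ * ∑ b ∈ B, f (n - b)

noncomputable def bet {p : ℕ} [NeZero p] (B : Finset (ZMod p)) (ξ : ZMod p) : ℂ :=
  (B.card : ℂ)⁻¹ * ∑ b ∈ B, ee (-(ξ * b))

lemma sm_ft {p : ℕ} [NeZero p] (B : Finset (ZMod p)) (f : ZMod p → ℝ) (ξ : ZMod p) :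
    ft (fun x => (sm B f x : ℂ)) ξ = bet B ξ * ft (fun x => (f x : ℂ)) ξ := by
  simp only [ft, sm, bet]
  push_cast
  have : ∀ y : ZMod p, ((B.card : ℂ)⁻¹ * ∑ b ∈ B, (f (y - b) : ℂ)) * ee (-(ξ * y)) =
      (B.card : ℂ)⁻¹ * ∑ b ∈ B, ee (-(ξ * b)) * ((f (y - b) : ℂ) * ee (-(ξ * (y - b)))) := by
    intro y
    rw [mul_assoc, sum_mul]
    congr 1
    refine sum_congr rfl fun b _ => ?_
    rw [show -(ξ * y) = -(ξ * b) + -(ξ * (y - b)) by ring, ee_add]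
    ring
  simp_rw [this]
  rw [← mul_sum, sum_comm]
  have h2 : ∀ b : ZMod p, ∑ y, ee (-(ξ * b)) * ((f (y - b) : ℂ) * ee (-(ξ * (y - b)))) =
      ee (-(ξ * b)) * ∑ y, (f y : ℂ) * ee (-(ξ * y)) := by
    intro b
    rw [← mul_sum]
    congr 1
    exact Equiv.sum_comp (Equiv.subRight b) (fun y => (f y : ℂ) * ee (-(ξ * y)))
  simp_rw [h2]
  rw [← sum_mul]
  ring

lemma bet_norm {p : ℕ} [NeZero p] (B : Finset (ZMod p)) (hB : B.Nonempty) (ξ : ZMod p) : ‖bet B ξ‖ ≤ 1 := by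
  have hc : (0 : ℝ) < B.card := by exact_mod_cast hB.card_pos
  rw [bet, norm_mul, norm_inv, Complex.norm_natCast, inv_mul_le_iff₀ hc, mul_one]
  refine (norm_sum_le _ _).trans ?_
  simp [ee_norm]

lemma bet_sub {p : ℕ} [NeZero p] (B : Finset (ZMod p)) (hB : B.Nonempty) (ξ : ZMod p) (t : ℝ)
    (h : ∀ b ∈ B, ‖ee (-(ξ * b)) - 1‖ ≤ t) : ‖bet B ξ - 1‖ ≤ t := by
  have hc : (0 : ℝ) < B.card := by exact_mod_cast hB.card_pos
  have hc' : (B.card : ℂ) ≠ 0 := by exact_mod_cast hc.ne'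
  have : bet B ξ - 1 = (B.card : ℂ)⁻¹ * ∑ b ∈ B, (ee (-(ξ * b)) - 1) := by
    rw [bet, sum_sub_distrib, mul_sub]
    simp [hc']
  rw [this, norm_mul, norm_inv, Complex.norm_natCast, inv_mul_le_iff₀ hc]
  refine (norm_sum_le _ _).trans ?_
  refine (sum_le_sum h).trans ?_
  simp

lemma ft_le_one {p : ℕ} [NeZero p] (f : ZMod p → ℝ) (hf : ∀ n, f n ∈ Set.Icc (0 : ℝ) 1) (ξ : ZMod p) :
    ‖ft (fun x => (f x : ℂ)) ξ‖ ≤ 1 := by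
  have hc : (0 : ℝ) < p := by exact_mod_cast NeZero.pos p
  rw [ft, norm_mul, norm_inv, Complex.norm_natCast, inv_mul_le_iff₀ hc, mul_one]
  refine (norm_sum_le _ _).trans ?_
  have : ∀ y ∈ (univ : Finset (ZMod p)), ‖(f y : ℂ) * ee (-(ξ * y))‖ ≤ 1 := by
    intro y _
    rw [norm_mul, ee_norm, mul_one, Complex.norm_real, Real.norm_eq_abs, abs_of_nonneg (hf y).1]
    exact (hf y).2
  refine (sum_le_sum this).trans ?_
  simp [ZMod.card]

lemma ft_sq_le {p : ℕ} [NeZero p] (f : ZMod p → ℝ) (hf : ∀ n, f n ∈ Set.Icc (0 : ℝ) 1) :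
    ∑ ξ, ‖ft (fun x => (f x : ℂ)) ξ‖ ^ 2 ≤ 1 := by
  have hc : (0 : ℝ) < p := by exact_mod_cast NeZero.pos p
  rw [ft_parseval, inv_mul_le_iff₀ hc, mul_one]
  have : ∀ y ∈ (univ : Finset (ZMod p)), ‖(f y : ℂ)‖ ^ 2 ≤ 1 := by
    intro y _
    rw [Complex.norm_real, Real.norm_eq_abs, abs_of_nonneg (hf y).1]
    exact pow_le_one₀ (hf y).1 (hf y).2
  refine (sum_le_sum this).trans ?_
  simp [ZMod.card]

lemma norm_prod_sub (u v : ℂ) (ρ : ℝ) (hu : ‖u‖ ≤ 1) (hv : ‖v‖ ≤ 1) (hu1 : ‖u - 1‖ ≤ ρ) (hv1 : ‖v - 1‖ ≤ 2 * ρ) :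
    ‖u ^ 2 * v - 1‖ ≤ 4 * ρ := by
  have hρ : 0 ≤ ρ := (norm_nonneg _).trans hu1
  have e : u ^ 2 * v - 1 = u * v * (u - 1) + v * (u - 1) + (v - 1) := by ring
  rw [e]
  have h1 : ‖u * v * (u - 1)‖ ≤ ρ := by
    rw [norm_mul, norm_mul]
    have : ‖u‖ * ‖v‖ ≤ 1 := mul_le_one₀ hu (norm_nonneg _) hv
    calc ‖u‖ * ‖v‖ * ‖u - 1‖ ≤ 1 * ρ := by gcongr
      _ = ρ := one_mul _
  have h2 : ‖v * (u - 1)‖ ≤ ρ := by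
    rw [norm_mul]
    calc ‖v‖ * ‖u - 1‖ ≤ 1 * ρ := by gcongr
      _ = ρ := one_mul _
  have h3 := norm_add₃_le (a := u * v * (u - 1)) (b := v * (u - 1)) (c := v - 1)
  linarith

lemma norm_prod_two (u v : ℂ) (hu : ‖u‖ ≤ 1) (hv : ‖v‖ ≤ 1) : ‖u ^ 2 * v - 1‖ ≤ 2 := by
  refine (norm_sub_le _ _).trans ?_
  rw [norm_mul, norm_pow, norm_one]
  have : ‖u‖ ^ 2 * ‖v‖ ≤ 1 := mul_le_one₀ (pow_le_one₀ (norm_nonneg _) hu) (norm_nonneg _) hv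
  linarith

lemma smoothing {p : ℕ} [Fact p.Prime] (h2 : p ≠ 2) (f : ZMod p → ℝ) (hf : ∀ n, f n ∈ Set.Icc (0 : ℝ) 1)
    (ε ρ : ℝ) (hε : 0 < ε) (hρ : 0 ≤ ρ) : ∃ Γ : Finset (ZMod p), Γ.card * ε ^ 2 ≤ 1 ∧
    Lam p (sm (bohr Γ ρ) f) ≤ Lam p f + 4 * ρ + 2 * ε := by
  classical
  set c : ZMod p → ℂ := ft (fun x => (f x : ℂ)) with hc
  have hb : Function.Bijective (fun x : ZMod p => -(2 * x)) := by
    refine Finite.injective_iff_bijective.mp ?_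
    intro x y h
    exact two_inj h2 (neg_injective h)
  have hsq := ft_sq_le f hf
  refine ⟨univ.filter fun ξ => ε ≤ ‖c (-(2 * ξ))‖, ?_, ?_⟩
  · calc _ = ∑ ξ ∈ univ.filter (fun ξ => ε ≤ ‖c (-(2 * ξ))‖), ε ^ 2 := by rw [sum_const, nsmul_eq_mul]
      _ ≤ ∑ ξ ∈ univ.filter (fun ξ => ε ≤ ‖c (-(2 * ξ))‖), ‖c (-(2 * ξ))‖ ^ 2 := by
          refine sum_le_sum fun ξ hξ => ?_
          exact pow_le_pow_left₀ hε.le (mem_filter.mp hξ).2 2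
      _ ≤ ∑ ξ, ‖c (-(2 * ξ))‖ ^ 2 := sum_le_sum_of_subset_of_nonneg (filter_subset _ _) fun _ _ _ => by positivity
      _ = ∑ ξ, ‖c ξ‖ ^ 2 := hb.sum_comp (fun ξ => ‖c ξ‖ ^ 2)
      _ ≤ 1 := hsq
  set Γ := univ.filter fun ξ => ε ≤ ‖c (-(2 * ξ))‖ with hΓ
  set B := bohr Γ ρ with hB
  have hBn : B.Nonempty := ⟨0, zero_mem_bohr hρ⟩
  have key : ∀ ξ, ‖c ξ ^ 2 * c (-(2 * ξ)) * (bet B ξ ^ 2 * bet B (-(2 * ξ)) - 1)‖ ≤ ‖c ξ‖ ^ 2 * (4 * ρ + 2 * ε) := by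
    intro ξ
    rw [norm_mul, norm_mul, norm_pow, mul_assoc]
    refine mul_le_mul_of_nonneg_left ?_ (by positivity)
    by_cases h : ε ≤ ‖c (-(2 * ξ))‖
    · have hm : ξ ∈ Γ := by simp [hΓ, h]
      have g1 : ∀ b ∈ B, ‖ee (-(ξ * b)) - 1‖ ≤ ρ := by
        intro b hb
        rw [ee_sub_one_neg]
        exact mem_bohr.mp hb ξ hm
      have g2 : ∀ b ∈ B, ‖ee (-(-(2 * ξ) * b)) - 1‖ ≤ 2 * ρ := by
        intro b hb
        have := mem_bohr.mp hb ξ hm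
        rw [show -(-(2 * ξ) * b) = ξ * b + ξ * b by ring]
        have h3 := ee_sub_one_add (ξ * b) (ξ * b)
        linarith
      have g3 := norm_prod_sub (bet B ξ) (bet B (-(2 * ξ))) ρ (bet_norm B hBn _) (bet_norm B hBn _)
        (bet_sub B hBn _ _ g1) (bet_sub B hBn _ _ g2)
      have g4 : ‖c (-(2 * ξ))‖ ≤ 1 := ft_le_one f hf _
      calc _ ≤ 1 * (4 * ρ) := by gcongr
        _ ≤ _ := by linarith
    · have g3 := norm_prod_two (bet B ξ) (bet B (-(2 * ξ))) (bet_norm B hBn _) (bet_norm B hBn _)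
      calc _ ≤ ε * 2 := by gcongr; exact (not_le.mp h).le
        _ ≤ _ := by linarith
  have e1 : ((Lam p (sm B f) - Lam p f : ℝ) : ℂ) =
      ∑ ξ, c ξ ^ 2 * c (-(2 * ξ)) * (bet B ξ ^ 2 * bet B (-(2 * ξ)) - 1) := by
    push_cast
    rw [lam_ft h2, lam_ft h2, ← sum_sub_distrib]
    refine sum_congr rfl fun ξ _ => ?_
    rw [sm_ft, sm_ft]
    ring
  have e2 : |Lam p (sm B f) - Lam p f| ≤ 4 * ρ + 2 * ε := by
    rw [← Real.norm_eq_abs, ← Complex.norm_real, e1]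
    refine (norm_sum_le _ _).trans ((sum_le_sum fun ξ _ => key ξ).trans ?_)
    rw [← sum_mul]
    calc _ ≤ 1 * (4 * ρ + 2 * ε) := by gcongr
      _ = _ := one_mul _
  have := (abs_le.mp e2).2
  linarith

/-! ## The test function -/

noncomputable def wt {p : ℕ} [NeZero p] (x : ZMod p) : ℝ := ((ee x).re + (ee (2 * x)).re) / 2

lemma wt_abs {p : ℕ} [NeZero p] (x : ZMod p) : |wt x| ≤ 1 := by
  have h1 := (Complex.abs_re_le_norm (ee x)).trans_eq (ee_norm x)
  have h2 := (Complex.abs_re_le_norm (ee (2 * x))).trans_eq (ee_norm (2 * x))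
  rw [abs_le] at h1 h2 ⊢
  unfold wt
  constructor <;> linarith [h1.1, h1.2, h2.1, h2.2]

lemma wt_complex {p : ℕ} [NeZero p] (x : ZMod p) :
    (wt x : ℂ) = (ee x + ee (-x) + ee (2 * x) + ee (-(2 * x))) / 4 := by
  unfold wt
  rw [ee_neg, ee_neg]
  have h1 := Complex.add_conj (ee x)
  have h2 := Complex.add_conj (ee (2 * x))
  push_cast
  rw [add_assoc (ee x + _), h1, h2]
  push_cast
  ring

noncomputable def dl {p : ℕ} (j ξ : ZMod p) : ℝ := open Classical in if ξ = j then 1 else 0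

lemma dl_nonneg {p : ℕ} (j ξ : ZMod p) : 0 ≤ dl j ξ := by unfold dl; split_ifs <;> norm_num

lemma dl_self {p : ℕ} (j : ZMod p) : dl j j = 1 := by simp [dl]

noncomputable def cr {p : ℕ} (ξ : ZMod p) : ℝ := (dl 1 ξ + dl (-1) ξ + dl 2 ξ + dl (-2) ξ) / 4

lemma wt_ft {p : ℕ} [NeZero p] (ξ : ZMod p) : ft (fun x => (wt x : ℂ)) ξ = (cr ξ : ℂ) := by
  have hp : (p : ℂ) ≠ 0 := by exact_mod_cast NeZero.ne p
  have h0 : ∀ j : ZMod p, ∑ x : ZMod p, ee (j * x) * ee (-(ξ * x)) = p * (dl j ξ : ℂ) := by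
    intro j
    have : ∀ x : ZMod p, ee (j * x) * ee (-(ξ * x)) = ee ((j - ξ) * x) := by
      intro x; rw [← ee_add]; congr 1; ring
    simp_rw [this]
    rw [sum_ee, dl]
    by_cases h : ξ = j
    · simp [h]
    · have : j - ξ ≠ 0 := fun h' => h (sub_eq_zero.mp h').symm
      simp [h, this]
  have e : ∀ x : ZMod p, (wt x : ℂ) * ee (-(ξ * x)) = (ee (1 * x) * ee (-(ξ * x)) + ee ((-1) * x) * ee (-(ξ * x))
      + ee (2 * x) * ee (-(ξ * x)) + ee ((-2) * x) * ee (-(ξ * x))) / 4 := by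
    intro x
    rw [wt_complex, one_mul, neg_one_mul, neg_mul]
    ring
  rw [ft]
  simp_rw [e]
  rw [← sum_div, sum_add_distrib, sum_add_distrib, sum_add_distrib, h0, h0, h0, h0, cr]
  push_cast
  field_simp

lemma wt_sum {p : ℕ} [Fact p.Prime] (h2 : p ≠ 2) : ∑ x : ZMod p, wt x = 0 := by
  have hp : (p : ℂ) ≠ 0 := by exact_mod_cast NeZero.ne p
  have h := wt_ft (0 : ZMod p)
  have h20 := two_ne h2
  have hc : cr (0 : ZMod p) = 0 := by
    simp only [cr, dl]
    rw [if_neg (by simp), if_neg (by simp), if_neg h20.symm, if_neg (by simpa using h20)]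
    norm_num
  rw [hc, ft] at h
  simp only [zero_mul, neg_zero, ee_zero, mul_one] at h
  have h3 : (∑ x : ZMod p, (wt x : ℂ)) = 0 := by simpa [hp] using h
  exact_mod_cast h3

lemma wt_lam {p : ℕ} [Fact p.Prime] (h2 : p ≠ 2) : 1 / 64 ≤ Lam p (wt (p := p)) := by
  have h := lam_ft h2 (wt (p := p))
  simp_rw [wt_ft] at h
  have h3 : Lam p (wt (p := p)) = ∑ ξ : ZMod p, cr ξ ^ 2 * cr (-(2 * ξ)) := by exact_mod_cast h
  have hn : ∀ ξ : ZMod p, 0 ≤ cr ξ := by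
    intro ξ
    unfold cr
    have := dl_nonneg 1 ξ; have := dl_nonneg (-1) ξ; have := dl_nonneg 2 ξ; have := dl_nonneg (-2) ξ
    linarith
  rw [h3]
  have h4 := single_le_sum (f := fun ξ : ZMod p => cr ξ ^ 2 * cr (-(2 * ξ)))
    (fun ξ _ => mul_nonneg (sq_nonneg _) (hn _)) (mem_univ (1 : ZMod p))
  refine le_trans ?_ h4
  have g1 : 1 / 4 ≤ cr (1 : ZMod p) := by
    unfold cr
    rw [dl_self]
    have := dl_nonneg (-1) (1 : ZMod p); have := dl_nonneg 2 (1 : ZMod p); have := dl_nonneg (-2) (1 : ZMod p)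
    linarith
  have g2 : 1 / 4 ≤ cr (-2 : ZMod p) := by
    unfold cr
    rw [dl_self]
    have := dl_nonneg (-1) (-2 : ZMod p); have := dl_nonneg 2 (-2 : ZMod p); have := dl_nonneg 1 (-2 : ZMod p)
    linarith
  simp only [mul_one]
  calc (1 / 64 : ℝ) = (1 / 4) ^ 2 * (1 / 4) := by norm_num
    _ ≤ _ := by gcongr

/-! ## Expansion -/

lemma affine_sum {p : ℕ} [Fact p.Prime] (G : ZMod p → ZMod p → ℝ) (n d : ZMod p) (hd : d ≠ 0) :
    ∑ a, ∑ b, G (a * n + b) (a * d) = ∑ x, ∑ e, G x e := by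
  have h1 : ∀ a : ZMod p, ∑ b, G (a * n + b) (a * d) = ∑ x, G x (a * d) := by
    intro a
    exact Equiv.sum_comp (Equiv.addLeft (a * n)) (fun x => G x (a * d))
  simp_rw [h1]
  rw [sum_comm]
  refine sum_congr rfl fun x _ => ?_
  exact Equiv.sum_comp (Equiv.mulRight₀ d hd) (fun e => G x e)

lemma expand3 {p : ℕ} [Fact p.Prime] (h2 : p ≠ 2) (w : ZMod p → ℝ) (hw : ∑ x, w x = 0)
    (g1 g2 g3 k1 k2 k3 : ℝ) :
    ∑ x, ∑ e, (g1 - k1 * w x) * (g2 - k2 * w (x + e)) * (g3 - k3 * w (x + 2 * e)) =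
      (p : ℝ) ^ 2 * (g1 * g2 * g3 - k1 * k2 * k3 * Lam p w) := by
  have hp : (p : ℝ) ≠ 0 := by exact_mod_cast NeZero.ne p
  have hc : ∀ n : ZMod p, Function.Bijective (fun d : ZMod p => n + 2 * d) := by
    intro n
    refine Finite.injective_iff_bijective.mp ?_
    intro x y h
    exact two_inj h2 (add_left_cancel h)
  have z1 : ∀ x, ∑ e, w (x + e) = 0 := fun x => (Equiv.sum_comp (Equiv.addLeft x) w).trans hw
  have z2 : ∀ x, ∑ e, w (x + 2 * e) = 0 := fun x => ((hc x).sum_comp w).trans hw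
  have z3 : ∑ x, ∑ e, w (x + e) * w (x + 2 * e) = 0 := by
    rw [sum_comm]
    have : ∀ e, ∑ x, w (x + e) * w (x + 2 * e) = ∑ x, w x * w (x + e) := by
      intro e
      rw [← Equiv.sum_comp (Equiv.addRight e) (fun x => w x * w (x + e))]
      refine sum_congr rfl fun x _ => ?_
      simp only [Equiv.coe_addRight]
      ring_nf
    simp_rw [this]
    rw [sum_comm]
    simp_rw [← mul_sum, z1]
    simp
  have e : ∀ x e, (g1 - k1 * w x) * (g2 - k2 * w (x + e)) * (g3 - k3 * w (x + 2 * e)) =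
      g1 * g2 * g3 - k1 * g2 * g3 * w x - g1 * k2 * g3 * w (x + e) - g1 * g2 * k3 * w (x + 2 * e)
      + k1 * k2 * g3 * (w x * w (x + e)) + k1 * g2 * k3 * (w x * w (x + 2 * e)) + g1 * k2 * k3 * (w (x + e) * w (x + 2 * e))
      - k1 * k2 * k3 * (w x * w (x + e) * w (x + 2 * e)) := by intros; ring
  simp_rw [e, sum_sub_distrib, sum_add_distrib, sum_sub_distrib, ← mul_sum, z1, z2, z3]
  rw [Lam]
  simp only [sum_const, card_univ, ZMod.card, nsmul_eq_mul, mul_zero]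
  rw [← mul_sum, hw]
  field_simp
  ring

lemma expand2 {p : ℕ} [Fact p.Prime] (w : ZMod p → ℝ) (hw : ∑ x, w x = 0) (n m : ZMod p) (h : n ≠ m) :
    ∑ a, ∑ b, w (a * n + b) * w (a * m + b) = 0 := by
  have := affine_sum (fun x e => w x * w (x + e)) n (m - n) (sub_ne_zero.mpr h.symm)
  have e : ∀ a b : ZMod p, a * n + b + a * (m - n) = a * m + b := by intros; ring
  simp_rw [e] at this
  rw [this]
  have z1 : ∀ x, ∑ e, w (x + e) = 0 := fun x => (Equiv.sum_comp (Equiv.addLeft x) w).trans hw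
  simp_rw [← mul_sum, z1]
  simp

lemma prod3_mem {x y z : ℝ} (hx : x ∈ Set.Icc (0 : ℝ) 1) (hy : y ∈ Set.Icc (0 : ℝ) 1) (hz : z ∈ Set.Icc (0 : ℝ) 1) :
    x * y * z ∈ Set.Icc (0 : ℝ) 1 := by
  refine ⟨mul_nonneg (mul_nonneg hx.1 hy.1) hz.1, ?_⟩
  exact mul_le_one₀ (mul_le_one₀ hx.2 hy.1 hy.2) hz.1 hz.2

lemma lam_mem {p : ℕ} [NeZero p] (h : ZMod p → ℝ) (hh : ∀ n, h n ∈ Set.Icc (0 : ℝ) 1) :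
    Lam p h ∈ Set.Icc (0 : ℝ) 1 := by
  have hp : (0 : ℝ) < p := by exact_mod_cast NeZero.pos p
  unfold Lam
  constructor
  · exact mul_nonneg (by positivity) (sum_nonneg fun n _ => sum_nonneg fun d _ => (prod3_mem (hh _) (hh _) (hh _)).1)
  · rw [inv_mul_le_iff₀ (by positivity), mul_one]
    calc _ ≤ ∑ n : ZMod p, ∑ d : ZMod p, (1 : ℝ) :=
          sum_le_sum fun n _ => sum_le_sum fun d _ => (prod3_mem (hh _) (hh _) (hh _)).2
      _ = _ := by simp [ZMod.card, sq]

lemma prod3_shift {x y z x' y' z' s : ℝ} (hx : x ∈ Set.Icc (0 : ℝ) 1) (hy : y ∈ Set.Icc (0 : ℝ) 1)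
    (hz' : z' ∈ Set.Icc (0 : ℝ) 1) (hy' : y' ∈ Set.Icc (0 : ℝ) 1) (hs : 0 ≤ s)
    (h1 : x' ≤ x + s) (h2 : y' ≤ y + s) (h3 : z' ≤ z + s) : x' * y' * z' ≤ x * y * z + 3 * s := by
  have a1 : x' * y' * z' ≤ (x + s) * y' * z' := by
    refine mul_le_mul_of_nonneg_right (mul_le_mul_of_nonneg_right h1 hy'.1) hz'.1
  have a2 : s * (y' * z') ≤ s * 1 :=
    mul_le_mul_of_nonneg_left (mul_le_one₀ hy'.2 hz'.1 hz'.2) hs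
  have a3 : x * z' * y' ≤ x * z' * (y + s) := mul_le_mul_of_nonneg_left h2 (mul_nonneg hx.1 hz'.1)
  have a4 : s * (x * z') ≤ s * 1 :=
    mul_le_mul_of_nonneg_left (mul_le_one₀ hx.2 hz'.1 hz'.2) hs
  have a5 : x * y * z' ≤ x * y * (z + s) := mul_le_mul_of_nonneg_left h3 (mul_nonneg hx.1 hy.1)
  have a6 : s * (x * y) ≤ s * 1 :=
    mul_le_mul_of_nonneg_left (mul_le_one₀ hx.2 hy.1 hy.2) hs
  linarith

lemma lam_shift {p : ℕ} [NeZero p] (h h' : ZMod p → ℝ) (hh : ∀ n, h n ∈ Set.Icc (0 : ℝ) 1)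
    (hh' : ∀ n, h' n ∈ Set.Icc (0 : ℝ) 1) (s : ℝ) (hs : 0 ≤ s) (hle : ∀ n, h' n ≤ h n + s) :
    Lam p h' ≤ Lam p h + 3 * s := by
  have hp : (0 : ℝ) < p := by exact_mod_cast NeZero.pos p
  unfold Lam
  rw [inv_mul_le_iff₀ (by positivity), mul_add, mul_inv_cancel_left₀ (by positivity)]
  calc _ ≤ ∑ n : ZMod p, ∑ d : ZMod p, (h n * h (n + d) * h (n + 2 * d) + 3 * s) :=
        sum_le_sum fun n _ => sum_le_sum fun d _ =>
          prod3_shift (hh _) (hh _) (hh' _) (hh' _) hs (hle _) (hle _) (hle _)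
    _ = _ := by simp [sum_add_distrib, ZMod.card, sq]; ring

lemma adjust {p : ℕ} [NeZero p] (θ σ ℓ : ℝ) (f g h : ZMod p → ℝ)
    (hf : ∀ n, f n ∈ Set.Icc (0 : ℝ) 1)
    (hmin : ∀ h : ZMod p → ℝ, (∀ n, h n ∈ Set.Icc (0 : ℝ) 1) → Ex p h ≥ θ → Lam p f ≤ Lam p h)
    (hg : θ ≤ Ex p g) (hh : ∀ n, h n ∈ Set.Icc (0 : ℝ) 1) (hE : Ex p h = Ex p g - σ)
    (hℓ : 0 < ℓ) (hgℓ : ℓ ≤ 1 - Ex p g) : Lam p f ≤ Lam p h + 3 * (|σ| / ℓ) := by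
  have hp : (0 : ℝ) < p := by exact_mod_cast NeZero.pos p
  have hs : 0 ≤ |σ| / ℓ := by positivity
  by_cases h1 : θ ≤ Ex p h
  · have := hmin h hh h1
    linarith
  by_cases h2 : 1 ≤ |σ| / ℓ
  · have := (lam_mem f hf).2
    have := (lam_mem h hh).1
    linarith
  push Not at h1 h2
  set s := |σ| / ℓ with hsd
  have hs2 : s * ℓ = |σ| := by rw [hsd]; field_simp
  have hh' : ∀ n, h n + s * (1 - h n) ∈ Set.Icc (0 : ℝ) 1 := by
    intro n
    have := (hh n).1
    have h3 := (hh n).2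
    have h4 : s * (1 - h n) ≤ 1 * (1 - h n) := mul_le_mul_of_nonneg_right h2.le (by linarith)
    have h5 : 0 ≤ s * (1 - h n) := mul_nonneg hs (by linarith)
    constructor <;> linarith
  have hE' : Ex p (fun n => h n + s * (1 - h n)) = Ex p h + s * (1 - Ex p h) := by
    unfold Ex
    rw [sum_add_distrib, ← mul_sum, sum_sub_distrib]
    simp [ZMod.card]
    field_simp
  have hge : θ ≤ Ex p (fun n => h n + s * (1 - h n)) := by
    rw [hE']
    have h5 : s * ℓ ≤ s * (1 - Ex p h) := mul_le_mul_of_nonneg_left (by linarith) hs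
    have := le_abs_self σ
    linarith
  refine (hmin _ hh' hge).trans ?_
  refine lam_shift h _ hh hh' s hs ?_
  intro n
  have : s * (1 - h n) ≤ s * 1 := mul_le_mul_of_nonneg_left (by linarith [(hh n).1]) hs
  linarith

lemma avg_lam {p : ℕ} [Fact p.Prime] (hp2 : p ≠ 2) (g η w : ZMod p → ℝ) (hw : ∑ x, w x = 0)
    (hg : ∀ n, 0 ≤ g n) (hη : ∀ n, η n ∈ Set.Icc (0 : ℝ) 1) (hL0 : Lam p w ≤ 1)
    (hh : ∀ a b n, g n - η n * w (a * n + b) ∈ Set.Icc (0 : ℝ) 1) :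
    ∑ a, ∑ b, Lam p (fun n => g n - η n * w (a * n + b)) ≤
      (p : ℝ) ^ 2 * (Lam p g - Lam p w * Lam p η + 2 / p) := by
  classical
  have hp : (0 : ℝ) < p := by exact_mod_cast NeZero.pos p
  set P : ZMod p → ZMod p → ℝ := fun n d => g n * g (n + d) * g (n + 2 * d) -
    η n * η (n + d) * η (n + 2 * d) * Lam p w with hP
  set H : ZMod p → ZMod p → ZMod p → ZMod p → ℝ := fun a b n d => (g n - η n * w (a * n + b)) *
    (g (n + d) - η (n + d) * w (a * (n + d) + b)) * (g (n + 2 * d) - η (n + 2 * d) * w (a * (n + 2 * d) + b)) with hH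
  have k1 : ∀ n d, ∑ a, ∑ b, H a b n d ≤ (p : ℝ) ^ 2 * (P n d + if d = 0 then 2 else 0) := by
    intro n d
    by_cases hd : d = 0
    · rw [if_pos hd]
      have : ∑ a, ∑ b, H a b n d ≤ ∑ a : ZMod p, ∑ b : ZMod p, (1 : ℝ) :=
        sum_le_sum fun a _ => sum_le_sum fun b _ => (prod3_mem (hh a b _) (hh a b _) (hh a b _)).2
      refine this.trans ?_
      have h3 : ∑ a : ZMod p, ∑ b : ZMod p, (1 : ℝ) = (p : ℝ) ^ 2 * 1 := by simp [ZMod.card, sq]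
      rw [h3]
      refine mul_le_mul_of_nonneg_left ?_ (by positivity)
      have q1 : 0 ≤ g n * g (n + d) * g (n + 2 * d) := mul_nonneg (mul_nonneg (hg _) (hg _)) (hg _)
      have q2 := prod3_mem (hη n) (hη (n + d)) (hη (n + 2 * d))
      have q3 : η n * η (n + d) * η (n + 2 * d) * Lam p w ≤ η n * η (n + d) * η (n + 2 * d) * 1 :=
        mul_le_mul_of_nonneg_left hL0 q2.1
      have := q2.2
      simp only [hP]
      linarith
    · rw [if_neg hd, add_zero]
      have e := affine_sum (fun x e => (g n - η n * w x) * (g (n + d) - η (n + d) * w (x + e)) *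
        (g (n + 2 * d) - η (n + 2 * d) * w (x + 2 * e))) n d hd
      rw [expand3 hp2 w hw] at e
      refine le_of_eq (Eq.trans ?_ e)
      refine sum_congr rfl fun a _ => sum_congr rfl fun b _ => ?_
      simp only [hH]
      rw [show a * (n + d) + b = a * n + b + a * d by ring, show a * (n + 2 * d) + b = a * n + b + 2 * (a * d) by ring]
  have e0 : ∑ a, ∑ b, Lam p (fun n => g n - η n * w (a * n + b)) =
      ((p : ℝ) ^ 2)⁻¹ * ∑ n, ∑ d, ∑ a, ∑ b, H a b n d := by
    simp only [Lam]
    simp_rw [← mul_sum]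
    congr 1
    calc _ = ∑ a, ∑ b, ∑ n, ∑ d, H a b n d := rfl
      _ = ∑ a, ∑ n, ∑ d, ∑ b, H a b n d := by
          refine sum_congr rfl fun a _ => ?_
          rw [sum_comm]
          refine sum_congr rfl fun n _ => ?_
          rw [sum_comm]
      _ = _ := by
          rw [sum_comm]
          refine sum_congr rfl fun n _ => ?_
          rw [sum_comm]
  rw [e0]
  have e1 : ∑ n, ∑ d, ∑ a, ∑ b, H a b n d ≤ ∑ n, ∑ d, (p : ℝ) ^ 2 * (P n d + if d = 0 then 2 else 0) :=
    sum_le_sum fun n _ => sum_le_sum fun d _ => k1 n d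
  refine (mul_le_mul_of_nonneg_left e1 (by positivity)).trans (le_of_eq ?_)
  simp_rw [← mul_sum, sum_add_distrib]
  rw [inv_mul_cancel_left₀ (by positivity)]
  simp only [hP, sum_sub_distrib, ← sum_mul, sum_ite_eq', mem_univ, if_true, sum_const, card_univ, ZMod.card,
    nsmul_eq_mul]
  have lg : Lam p g = ((p : ℝ) ^ 2)⁻¹ * ∑ n, ∑ d, g n * g (n + d) * g (n + 2 * d) := rfl
  have lη : Lam p η = ((p : ℝ) ^ 2)⁻¹ * ∑ n, ∑ d, η n * η (n + d) * η (n + 2 * d) := rfl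
  rw [lg, lη]
  generalize ∑ n, ∑ d, g n * g (n + d) * g (n + 2 * d) = Sg
  generalize ∑ n, ∑ d, η n * η (n + d) * η (n + 2 * d) = Sη
  field_simp

lemma avg_sigma {p : ℕ} [Fact p.Prime] (η w : ZMod p → ℝ) (hw : ∑ x, w x = 0)
    (hη : ∀ n, η n ∈ Set.Icc (0 : ℝ) 1) (hw1 : ∀ x, |w x| ≤ 1) :
    ∑ a, ∑ b, |Ex p (fun n => η n * w (a * n + b))| ≤ (p : ℝ) ^ 2 * (1 / √p) := by
  classical
  have hp : (0 : ℝ) < p := by exact_mod_cast NeZero.pos p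
  set S : ZMod p → ZMod p → ℝ := fun a b => ∑ n, η n * w (a * n + b) with hS
  have e1 : ∑ a, ∑ b, (S a b) ^ 2 = ∑ n, ∑ m, η n * η m * ∑ a, ∑ b, w (a * n + b) * w (a * m + b) := by
    calc _ = ∑ a, ∑ b, ∑ n, ∑ m, η n * η m * (w (a * n + b) * w (a * m + b)) := by
          refine sum_congr rfl fun a _ => sum_congr rfl fun b _ => ?_
          rw [sq, hS, sum_mul_sum]
          refine sum_congr rfl fun n _ => sum_congr rfl fun m _ => ?_
          ring
      _ = ∑ a, ∑ n, ∑ m, ∑ b, η n * η m * (w (a * n + b) * w (a * m + b)) := by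
          refine sum_congr rfl fun a _ => ?_
          rw [sum_comm]
          refine sum_congr rfl fun n _ => ?_
          rw [sum_comm]
      _ = ∑ n, ∑ m, ∑ a, ∑ b, η n * η m * (w (a * n + b) * w (a * m + b)) := by
          rw [sum_comm]
          refine sum_congr rfl fun n _ => ?_
          rw [sum_comm]
      _ = _ := by simp_rw [mul_sum]
  have k : ∀ n m, η n * η m * ∑ a, ∑ b, w (a * n + b) * w (a * m + b) ≤ if n = m then (p : ℝ) ^ 2 else 0 := by
    intro n m
    by_cases h : n = m
    · rw [if_pos h, ← h]
      have h1 : ∑ a, ∑ b, w (a * n + b) * w (a * n + b) ≤ ∑ a : ZMod p, ∑ b : ZMod p, (1 : ℝ) := by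
        refine sum_le_sum fun a _ => sum_le_sum fun b _ => ?_
        rw [← sq, ← sq_abs]
        exact pow_le_one₀ (abs_nonneg _) (hw1 _)
      have h2 : ∑ a : ZMod p, ∑ b : ZMod p, (1 : ℝ) = (p : ℝ) ^ 2 := by simp [ZMod.card, sq]
      have h3 : η n * η n ≤ 1 := mul_le_one₀ (hη n).2 (hη n).1 (hη n).2
      have h4 : 0 ≤ ∑ a, ∑ b, w (a * n + b) * w (a * n + b) :=
        sum_nonneg fun a _ => sum_nonneg fun b _ => mul_self_nonneg _
      calc _ ≤ 1 * ∑ a, ∑ b, w (a * n + b) * w (a * n + b) := mul_le_mul_of_nonneg_right h3 h4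
        _ ≤ _ := by rw [one_mul, ← h2]; exact h1
    · rw [if_neg h, expand2 w hw n m h, mul_zero]
  have e2 : ∑ a, ∑ b, (S a b) ^ 2 ≤ (p : ℝ) ^ 3 := by
    rw [e1]
    refine (sum_le_sum fun n _ => sum_le_sum fun m _ => k n m).trans (le_of_eq ?_)
    simp [ZMod.card]
    ring
  have e3 : (∑ a, ∑ b, |S a b|) ^ 2 ≤ (p : ℝ) ^ 2 * (p : ℝ) ^ 3 := by
    have h1 := sq_sum_le_card_mul_sum_sq (s := (univ : Finset (ZMod p × ZMod p))) (f := fun x => |S x.1 x.2|)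
    rw [Fintype.sum_prod_type, Fintype.sum_prod_type] at h1
    simp only [card_univ, Fintype.card_prod, ZMod.card, sq_abs] at h1
    refine h1.trans ?_
    push_cast
    rw [← sq]
    exact mul_le_mul_of_nonneg_left e2 (by positivity)
  have e4 : ∑ a, ∑ b, |S a b| ≤ (p : ℝ) ^ 3 * (1 / √p) := by
    refine abs_le_of_sq_le_sq' ?_ (by positivity) |>.2
    refine e3.trans (le_of_eq ?_)
    rw [mul_pow, div_pow, one_pow, Real.sq_sqrt hp.le]
    field_simp
  have e5 : ∀ a b, |Ex p (fun n => η n * w (a * n + b))| = (p : ℝ)⁻¹ * |S a b| := by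
    intro a b
    rw [Ex, abs_mul, abs_of_pos (inv_pos.mpr hp)]
  simp_rw [e5, ← mul_sum]
  rw [inv_mul_le_iff₀ hp]
  refine e4.trans (le_of_eq (by ring))

lemma perturb {p : ℕ} [Fact p.Prime] (hp2 : p ≠ 2) (θ ℓ : ℝ) (f g η : ZMod p → ℝ)
    (hf : ∀ n, f n ∈ Set.Icc (0 : ℝ) 1)
    (hmin : ∀ h : ZMod p → ℝ, (∀ n, h n ∈ Set.Icc (0 : ℝ) 1) → Ex p h ≥ θ → Lam p f ≤ Lam p h)
    (hg : θ ≤ Ex p g) (hη0 : ∀ n, 0 ≤ η n) (hη1 : ∀ n, η n ≤ g n) (hη2 : ∀ n, η n ≤ 1 - g n)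
    (hℓ : 0 < ℓ) (hℓη : ℓ ≤ Ex p η) :
    Lam p f ≤ Lam p g - 1 / 64 * Lam p η + 2 / p + 3 * (1 / √p) / ℓ := by
  have hp : (0 : ℝ) < p := by exact_mod_cast NeZero.pos p
  set w : ZMod p → ℝ := wt with hwd
  have hw := wt_sum hp2
  have hηm : ∀ n, η n ∈ Set.Icc (0 : ℝ) 1 := fun n => ⟨hη0 n, by linarith [hη0 n, hη1 n, hη2 n]⟩
  have hw1 : ∀ x, |w x| ≤ 1 := wt_abs
  have hh : ∀ a b n, g n - η n * w (a * n + b) ∈ Set.Icc (0 : ℝ) 1 := by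
    intro a b n
    have h1 := abs_le.mp (hw1 (a * n + b))
    have h2 : η n * w (a * n + b) ≤ η n * 1 := mul_le_mul_of_nonneg_left h1.2 (hη0 n)
    have h3 : η n * (-1) ≤ η n * w (a * n + b) := mul_le_mul_of_nonneg_left h1.1 (hη0 n)
    constructor <;> linarith [hη1 n, hη2 n]
  have hgℓ : ℓ ≤ 1 - Ex p g := by
    refine hℓη.trans ?_
    have h1 : ∑ n, η n ≤ ∑ n, (1 - g n) := sum_le_sum fun n _ => hη2 n
    unfold Ex
    rw [sum_sub_distrib] at h1
    simp only [sum_const, card_univ, ZMod.card, nsmul_eq_mul, mul_one] at h1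
    rw [inv_mul_le_iff₀ hp, mul_sub, mul_inv_cancel_left₀ hp.ne']
    linarith
  have hL1 : Lam p w ≤ 1 := by
    unfold Lam
    rw [inv_mul_le_iff₀ (by positivity), mul_one]
    calc _ ≤ ∑ n : ZMod p, ∑ d : ZMod p, (1 : ℝ) := by
          refine sum_le_sum fun n _ => sum_le_sum fun d _ => ?_
          refine (le_abs_self _).trans ?_
          rw [abs_mul, abs_mul]
          exact mul_le_one₀ (mul_le_one₀ (hw1 _) (abs_nonneg _) (hw1 _)) (abs_nonneg _) (hw1 _)
      _ = _ := by simp [ZMod.card, sq]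
  have a1 := avg_lam hp2 g η w hw (fun n => (hη0 n).trans (hη1 n)) hηm hL1 hh
  have a2 := avg_sigma η w hw hηm hw1
  have a3 : ∀ a b, Lam p f ≤ Lam p (fun n => g n - η n * w (a * n + b)) +
      3 / ℓ * |Ex p (fun n => η n * w (a * n + b))| := by
    intro a b
    have := adjust θ (Ex p (fun n => η n * w (a * n + b))) ℓ f g _ hf hmin hg (hh a b)
      (by unfold Ex; rw [sum_sub_distrib, mul_sub]) hℓ hgℓ
    refine this.trans (le_of_eq ?_)
    ring
  have a4 := sum_le_sum fun (a : ZMod p) (_ : a ∈ univ) => sum_le_sum fun (b : ZMod p) (_ : b ∈ univ) => a3 a b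
  simp only [sum_add_distrib, ← mul_sum, sum_const, card_univ, ZMod.card, nsmul_eq_mul] at a4
  have a5 : (p : ℝ) ^ 2 * Lam p f ≤ (p : ℝ) ^ 2 * ((Lam p g - Lam p w * Lam p η + 2 / p) + 3 / ℓ * (1 / √p)) := by
    have := mul_le_mul_of_nonneg_left a2 (by positivity : 0 ≤ 3 / ℓ)
    calc _ = (p : ℝ) * (p * Lam p f) := by ring
      _ ≤ _ := a4
      _ ≤ (p : ℝ) ^ 2 * (Lam p g - Lam p w * Lam p η + 2 / p) + 3 / ℓ * ((p : ℝ) ^ 2 * (1 / √p)) := by linarith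
      _ = _ := by ring
  have a6 := le_of_mul_le_mul_left a5 (by positivity)
  have a7 : 1 / 64 * Lam p η ≤ Lam p w * Lam p η := mul_le_mul_of_nonneg_right (wt_lam hp2) (lam_mem η hηm).1
  have a8 : 3 / ℓ * (1 / √p) = 3 * (1 / √p) / ℓ := by ring
  linarith

lemma roth_fun {p : ℕ} [Fact p.Prime] (C q : ℕ)
    (hC : ∀ A : Finset (ZMod p), (1 / 2 : ℝ) ^ q * p ≤ A.card → (1 / 2 : ℝ) ^ (C * q ^ 19) * (p : ℝ) ^ 2 ≤ aps A)
    (η : ZMod p → ℝ) (hη : ∀ n, η n ∈ Set.Icc (0 : ℝ) 1) (δ : ℝ) (hδ : 0 < δ) (hE : δ ≤ Ex p η)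
    (hq : (1 / 2 : ℝ) ^ q ≤ δ / 2) : (δ / 2) ^ 3 * (1 / 2 : ℝ) ^ (C * q ^ 19) ≤ Lam p η := by
  classical
  have hp : (0 : ℝ) < p := by exact_mod_cast NeZero.pos p
  set A : Finset (ZMod p) := univ.filter fun n => δ / 2 ≤ η n with hA
  have h1 : ∀ n, η n ≤ ic A n + δ / 2 := by
    intro n
    unfold ic
    by_cases h : δ / 2 ≤ η n
    · rw [if_pos (by simp [hA, h])]
      linarith [(hη n).2]
    · rw [if_neg (by simp [hA, h])]
      linarith
  have h2 : δ * p ≤ ∑ n, η n := by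
    unfold Ex at hE
    rw [inv_mul_eq_div, le_div_iff₀ hp] at hE
    exact hE
  have h3 : ∑ n, η n ≤ A.card + p * (δ / 2) := by
    refine (sum_le_sum fun n _ => h1 n).trans (le_of_eq ?_)
    rw [sum_add_distrib, ic_sum]
    simp [ZMod.card]
  have h4 : (1 / 2 : ℝ) ^ q * p ≤ A.card := by
    have := mul_le_mul_of_nonneg_right hq hp.le
    linarith
  have h5 := hC A h4
  have h6 : ∀ n, δ / 2 * ic A n ≤ η n := by
    intro n
    unfold ic
    by_cases h : δ / 2 ≤ η n
    · rw [if_pos (by simp [hA, h])]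
      linarith
    · rw [if_neg (by simp [hA, h])]
      linarith [(hη n).1]
  have h7 : (δ / 2) ^ 3 * aps A ≤ ∑ n, ∑ d, η n * η (n + d) * η (n + 2 * d) := by
    unfold aps
    rw [mul_sum]
    simp_rw [mul_sum]
    refine sum_le_sum fun n _ => sum_le_sum fun d _ => ?_
    have z : ∀ m, 0 ≤ δ / 2 * ic A m := fun m => mul_nonneg (by positivity) (ic_nonneg _ _)
    calc _ = (δ / 2 * ic A n) * (δ / 2 * ic A (n + d)) * (δ / 2 * ic A (n + 2 * d)) := by ring
      _ ≤ _ := by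
          refine mul_le_mul (mul_le_mul (h6 _) (h6 _) (z _) (hη _).1) (h6 _) (z _) (mul_nonneg (hη _).1 (hη _).1)
  unfold Lam
  rw [inv_mul_eq_div, le_div_iff₀ (by positivity), mul_assoc]
  exact (mul_le_mul_of_nonneg_left h5 (by positivity)).trans h7

lemma ic_round {p : ℕ} (f : ZMod p → ℝ) (hf : ∀ n, f n ∈ Set.Icc (0 : ℝ) 1) (C : Finset (ZMod p))
    (hC : ∀ n, n ∈ C ↔ f n ≥ 1 / 2) (e : ℝ) (he : e = 0 ∨ e = 1) (x : ZMod p) : |ic C x - e| ≤ 2 * |f x - e| := by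
  have h0 := (hf x).1
  have h1 := (hf x).2
  unfold ic
  by_cases h : x ∈ C
  · have := (hC x).mp h
    rw [if_pos h]
    rcases he with rfl | rfl
    · rw [sub_zero, sub_zero, abs_one, abs_of_nonneg h0]; linarith
    · rw [sub_self, abs_zero]; positivity
  · have : f x < 1 / 2 := by
      by_contra hc
      exact h ((hC x).mpr (not_lt.mp hc))
    rw [if_neg h]
    rcases he with rfl | rfl
    · rw [sub_self, abs_zero]; positivity
    · rw [zero_sub, abs_neg, abs_one, abs_of_nonpos (by linarith)]; linarith

lemma finish {p : ℕ} [Fact p.Prime] (f : ZMod p → ℝ) (hf : ∀ n, f n ∈ Set.Icc (0 : ℝ) 1) (C B : Finset (ZMod p))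
    (hC : ∀ n, n ∈ C ↔ f n ≥ 1 / 2) (hB : B.Nonempty) (L : ℝ)
    (hL : Ex p (fun n => min (sm B f n) (1 - sm B f n)) ≤ L) :
    ∃ B' : Finset (ZMod p), B'.card = B.card ∧
      ∑ n, |conv p (ind p C) (ind p B') n - (B'.card : ℝ) * ind p C n| ≤ 4 * p * B'.card * L := by
  classical
  have hp : (0 : ℝ) < p := by exact_mod_cast NeZero.pos p
  have hc : (0 : ℝ) < B.card := by exact_mod_cast hB.card_pos
  set g := sm B f with hg
  set r : ZMod p → ℝ := fun n => if 1 / 2 ≤ g n then 1 else 0 with hr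
  have hr01 : ∀ n, r n = 0 ∨ r n = 1 := by
    intro n
    simp only [hr]
    split_ifs
    · exact Or.inr rfl
    · exact Or.inl rfl
  have hsum : ∀ n, ∑ b ∈ B, f (n - b) = B.card * g n := by
    intro n
    rw [hg, sm, mul_inv_cancel_left₀ hc.ne']
  have h1 : ∀ n, ∑ b ∈ B, |f (n - b) - r n| ≤ B.card * min (g n) (1 - g n) := by
    intro n
    by_cases h : 1 / 2 ≤ g n
    · have e : r n = 1 := by simp only [hr]; rw [if_pos h]
      rw [min_eq_right (by linarith), e]
      have : ∀ b ∈ B, |f (n - b) - 1| = 1 - f (n - b) := by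
        intro b _
        rw [abs_of_nonpos (by linarith [(hf (n - b)).2])]; ring
      rw [sum_congr rfl this, sum_sub_distrib, hsum]
      simp [mul_sub]
    · have e : r n = 0 := by simp only [hr]; rw [if_neg h]
      push Not at h
      rw [min_eq_left (by linarith), e, ← hsum]
      refine le_of_eq (sum_congr rfl fun b _ => ?_)
      rw [sub_zero, abs_of_nonneg (hf _).1]
  have h2 : ∑ n, ∑ b ∈ B, |ic C (n - b) - r n| ≤ B.card * (2 * p * L) := by
    have h3 : ∑ n, min (g n) (1 - g n) ≤ p * L := by
      rw [Ex, inv_mul_le_iff₀ hp] at hL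
      exact hL
    calc _ ≤ ∑ n, ∑ b ∈ B, 2 * |f (n - b) - r n| :=
          sum_le_sum fun n _ => sum_le_sum fun b _ => ic_round f hf C hC _ (hr01 n) _
      _ = ∑ n, 2 * ∑ b ∈ B, |f (n - b) - r n| := by simp_rw [mul_sum]
      _ ≤ ∑ n, 2 * (B.card * min (g n) (1 - g n)) :=
          sum_le_sum fun n _ => mul_le_mul_of_nonneg_left (h1 n) (by norm_num)
      _ = 2 * (B.card * ∑ n, min (g n) (1 - g n)) := by simp_rw [mul_sum]
      _ ≤ 2 * (B.card * (p * L)) := by gcongr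
      _ = _ := by ring
  obtain ⟨b0, hb0, hb⟩ : ∃ b0 ∈ B, ∑ n, |ic C (n - b0) - r n| ≤ 2 * p * L := by
    by_contra hcon
    push Not at hcon
    have := sum_lt_sum_of_nonempty hB hcon
    rw [sum_comm] at this
    simp only [sum_const, nsmul_eq_mul] at this
    linarith
  have hinj : Function.Injective (fun b : ZMod p => b - b0) := sub_left_injective
  refine ⟨B.image fun b => b - b0, card_image_of_injective _ hinj, ?_⟩
  rw [card_image_of_injective _ hinj]
  have hcv : ∀ n, conv p (ind p C) (ind p (B.image fun b => b - b0)) n = ∑ b ∈ B, ic C (n + b0 - b) := by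
    intro n
    have e1 : conv p (ind p C) (ind p (B.image fun b => b - b0)) n =
        ∑ y, ic (B.image fun b => b - b0) y * ic C (n - y) := by
      unfold conv
      rw [← Equiv.sum_comp (Equiv.subLeft n)]
      refine sum_congr rfl fun y _ => ?_
      simp only [Equiv.subLeft_apply, sub_sub_cancel]
      rw [mul_comm]
      simp only [ind, ic]
    rw [e1, ic_mul_sum, sum_image (fun x _ y _ h => hinj h)]
    refine sum_congr rfl fun b _ => ?_
    congr 1; ring
  have hi : ∀ n, ind p C n = ic C n := by
    intro n; simp only [ind, ic]
  simp_rw [hcv, hi]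
  rw [← Equiv.sum_comp (Equiv.subRight b0)]
  simp only [Equiv.subRight_apply, sub_add_cancel]
  calc _ ≤ ∑ n, (∑ b ∈ B, |ic C (n - b) - r n| + B.card * |ic C (n - b0) - r n|) := by
        refine sum_le_sum fun n _ => ?_
        have e : ∑ b ∈ B, ic C (n - b) - B.card * ic C (n - b0) =
            ∑ b ∈ B, (ic C (n - b) - r n) - B.card * (ic C (n - b0) - r n) := by
          rw [sum_sub_distrib, sum_const, nsmul_eq_mul]; ring
        rw [e]
        refine (abs_sub _ _).trans ?_
        rw [abs_mul, Nat.abs_cast]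
        have := abs_sum_le_sum_abs (fun b => ic C (n - b) - r n) B
        linarith
    _ = ∑ n, ∑ b ∈ B, |ic C (n - b) - r n| + B.card * ∑ n, |ic C (n - b0) - r n| := by
        rw [sum_add_distrib, ← mul_sum]
    _ ≤ B.card * (2 * p * L) + B.card * (2 * p * L) := by gcongr
    _ = _ := by ring

lemma asym (C : ℕ) (t L : ℝ) (ht : 20000 + C * 2 ^ 19 ≤ t) (hL : 1 / t ^ 40 ≤ L) :
    ∃ q j : ℕ, 1 ≤ q ∧ (1 / 2 : ℝ) ^ q ≤ L / 2 ∧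
      64 * (6 * (2 / 2 ^ j) + 2 / Real.exp (Real.exp (t ^ 40)) + 3 * (1 / Real.exp (Real.exp (t ^ 40) / 2)) / L) <
        (L / 2) ^ 3 * (1 / 2 : ℝ) ^ (C * q ^ 19) ∧
      (49 : ℝ) ^ (4 ^ j * j) < Real.exp (Real.exp (t ^ 40) / 2) := by
  have hC0 : (0 : ℝ) ≤ C * 2 ^ 19 := by positivity
  have ht1 : 20000 ≤ t := by linarith
  have ht0 : 0 < t := by linarith
  have hL0 : 0 < L := lt_of_lt_of_le (by positivity) hL
  set y := t ^ 40 with hy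
  have hyt : t ≤ y := le_self_pow₀ (by linarith) (by norm_num)
  have he1 : (2.7 : ℝ) ≤ Real.exp 1 := by linarith [Real.exp_one_gt_d9]
  have he2 : Real.exp 1 ≤ 4 := by linarith [Real.exp_one_lt_d9]
  have het : t ≤ Real.exp t := by linarith [Real.add_one_le_exp t]
  have hhalf : Real.exp (-1) ≤ 1 / 2 := by
    rw [Real.exp_neg, one_div]
    exact inv_anti₀ (by norm_num) (by linarith)
  -- lower bound for powers of two
  have h2 : ∀ k : ℕ, Real.exp (k / 2 : ℝ) ≤ 2 ^ k := by
    intro k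
    have : Real.exp (1 / 2) ≤ 2 := by
      have h : Real.exp (1 / 2) ^ 2 ≤ 2 ^ 2 := by
        rw [← Real.exp_nat_mul]
        norm_num
        linarith
      exact (abs_le_of_sq_le_sq' h (by norm_num)).2
    calc Real.exp (k / 2 : ℝ) = Real.exp (1 / 2) ^ k := by rw [← Real.exp_nat_mul]; congr 1; ring
      _ ≤ 2 ^ k := pow_le_pow_left₀ (Real.exp_pos _).le this _
  set q := ⌈t ^ 2⌉₊ with hq
  set j := ⌊y / 6⌋₊ with hj
  have hq1 : t ^ 2 ≤ q := Nat.le_ceil _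
  have hq2 : (q : ℝ) ≤ 2 * t ^ 2 := by
    have := (Nat.ceil_lt_add_one (by positivity : 0 ≤ t ^ 2)).le
    have h3 : 1 ≤ t ^ 2 := one_le_pow₀ (by linarith)
    linarith
  have hj1 : (j : ℝ) ≤ y / 6 := Nat.floor_le (by positivity)
  have hj2 : y / 6 < j + 1 := Nat.lt_floor_add_one _
  have hqr : (1 : ℝ) ≤ q := (one_le_pow₀ (by linarith)).trans hq1
  refine ⟨q, j, by exact_mod_cast hqr, ?_, ?_, ?_⟩
  · have h3 : 2 * t ^ 40 ≤ 2 ^ q := by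
      calc 2 * t ^ 40 ≤ t * t ^ 40 := by gcongr; linarith
        _ = t ^ 41 := by ring
        _ ≤ Real.exp t ^ 41 := pow_le_pow_left₀ ht0.le het _
        _ = Real.exp (41 * t) := by rw [← Real.exp_nat_mul]; norm_num
        _ ≤ Real.exp (q / 2 : ℝ) := by
            refine Real.exp_le_exp.mpr ?_
            have : 82 * t ≤ t * t := by gcongr; linarith
            have h4 : t * t = t ^ 2 := by ring
            linarith
        _ ≤ 2 ^ q := h2 q
    calc (1 / 2 : ℝ) ^ q = 1 / 2 ^ q := by rw [div_pow, one_pow]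
      _ ≤ 1 / (2 * t ^ 40) := one_div_le_one_div_of_le (by positivity) h3
      _ = (1 / t ^ 40) / 2 := by field_simp
      _ ≤ L / 2 := by linarith
  · have g1 : 2 / (2 : ℝ) ^ j ≤ 4 * Real.exp (-(y / 12)) := by
      have h3 : Real.exp (y / 12) ≤ 2 * 2 ^ j := by
        calc Real.exp (y / 12) ≤ Real.exp (((j + 1 : ℕ) : ℝ) / 2) := by
              refine Real.exp_le_exp.mpr ?_
              push_cast; linarith
          _ ≤ 2 ^ (j + 1) := h2 _
          _ = 2 * 2 ^ j := by ring
      rw [Real.exp_neg, div_le_iff₀ (by positivity)]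
      have h4 : 0 < Real.exp (y / 12) := Real.exp_pos _
      have h5 : 1 ≤ (Real.exp (y / 12))⁻¹ * (2 * 2 ^ j) := by
        rw [← div_eq_inv_mul, le_div_iff₀ h4]; linarith
      linarith
    have hey : y ≤ Real.exp y := by linarith [Real.add_one_le_exp y]
    have hy0 : 0 < y := by linarith
    have g2 : 1 / Real.exp (Real.exp y / 2) ≤ Real.exp (-(y / 12)) := by
      rw [one_div, ← Real.exp_neg]
      refine Real.exp_le_exp.mpr ?_
      linarith
    have g3 : 1 / Real.exp (Real.exp y) ≤ Real.exp (-(y / 12)) := by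
      rw [one_div, ← Real.exp_neg]
      refine Real.exp_le_exp.mpr ?_
      linarith
    have hLi : 1 / L ≤ y := by
      rw [div_le_iff₀ hL0]
      have := mul_le_mul_of_nonneg_left hL hy0.le
      rw [mul_one_div_cancel hy0.ne'] at this
      exact this
    have hexp0 : 0 < Real.exp (-(y / 12)) := Real.exp_pos _
    have g4 : 3 * (1 / Real.exp (Real.exp y / 2)) / L ≤ 3 * Real.exp (-(y / 12)) * y := by
      rw [div_eq_mul_one_div (3 * (1 / Real.exp (Real.exp y / 2))) L]
      gcongr
    have g5 : 64 * (6 * (2 / 2 ^ j) + 2 / Real.exp (Real.exp y) + 3 * (1 / Real.exp (Real.exp y / 2)) / L)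
        ≤ 1856 * y * Real.exp (-(y / 12)) := by
      have e1 : 2 / Real.exp (Real.exp y) = 2 * (1 / Real.exp (Real.exp y)) := by ring
      rw [e1]
      have e2 : 1 * Real.exp (-(y / 12)) ≤ y * Real.exp (-(y / 12)) := by gcongr; linarith
      linarith
    have g6 : (1 / (8 * y ^ 3)) * Real.exp (-(C * 2 ^ 19 * t ^ 38)) ≤ (L / 2) ^ 3 * (1 / 2 : ℝ) ^ (C * q ^ 19) := by
      have e1 : 1 / (8 * y ^ 3) ≤ (L / 2) ^ 3 := by
        calc 1 / (8 * y ^ 3) = ((1 / y) / 2) ^ 3 := by field_simp; norm_num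
          _ ≤ (L / 2) ^ 3 := by gcongr
      have e2 : Real.exp (-(C * 2 ^ 19 * t ^ 38)) ≤ (1 / 2 : ℝ) ^ (C * q ^ 19) := by
        have e3 : ((C * q ^ 19 : ℕ) : ℝ) ≤ C * 2 ^ 19 * t ^ 38 := by
          push_cast
          calc (C : ℝ) * q ^ 19 ≤ C * (2 * t ^ 2) ^ 19 := by gcongr
            _ = _ := by ring
        calc Real.exp (-(C * 2 ^ 19 * t ^ 38)) ≤ Real.exp (((C * q ^ 19 : ℕ) : ℝ) * (1 / 2 - 3 / 2)) := by
              refine Real.exp_le_exp.mpr ?_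
              linarith
          _ = Real.exp (-1) ^ (C * q ^ 19) := by rw [← Real.exp_nat_mul]; norm_num
          _ ≤ _ := pow_le_pow_left₀ (Real.exp_pos _).le (by norm_num; linarith) _
      gcongr
    refine lt_of_le_of_lt g5 (lt_of_lt_of_le ?_ g6)
    have k1 : 14848 * y ^ 4 * Real.exp (C * 2 ^ 19 * t ^ 38) < Real.exp (y / 12) := by
      calc 14848 * y ^ 4 * Real.exp (C * 2 ^ 19 * t ^ 38) ≤ t * y ^ 4 * Real.exp (C * 2 ^ 19 * t ^ 38) := by
            gcongr; linarith
        _ = t ^ 161 * Real.exp (C * 2 ^ 19 * t ^ 38) := by rw [hy]; ring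
        _ ≤ Real.exp t ^ 161 * Real.exp (C * 2 ^ 19 * t ^ 38) := by gcongr
        _ = Real.exp (161 * t + C * 2 ^ 19 * t ^ 38) := by rw [Real.exp_add, ← Real.exp_nat_mul]; norm_num
        _ < Real.exp (y / 12) := by
            refine Real.exp_lt_exp.mpr ?_
            have m1 : t ≤ t ^ 38 := le_self_pow₀ (by linarith) (by norm_num)
            have m2 : 0 < t ^ 38 := by positivity
            have m3 : (C * 2 ^ 19 + 20000) * t ^ 38 ≤ t * t ^ 38 := by gcongr; linarith
            have m4 : 12 * (t * t ^ 38) ≤ t * (t * t ^ 38) := by gcongr; linarith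
            have m5 : y = t * (t * t ^ 38) := by rw [hy]; ring
            linarith
    rw [Real.exp_neg, Real.exp_neg]
    have hE1 : 0 < Real.exp (C * 2 ^ 19 * t ^ 38) := Real.exp_pos _
    have hE2 : 0 < Real.exp (y / 12) := Real.exp_pos _
    generalize Real.exp (C * 2 ^ 19 * t ^ 38) = E1 at k1 hE1 ⊢
    generalize Real.exp (y / 12) = E2 at k1 hE2 ⊢
    rw [← div_eq_mul_inv, ← div_eq_mul_inv, div_div, div_lt_div_iff₀ hE2 (by positivity)]
    linarith
  · have h3 : (49 : ℝ) ≤ Real.exp 4 := by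
      calc (49 : ℝ) ≤ 2.7 ^ 4 := by norm_num
        _ ≤ Real.exp 1 ^ 4 := by gcongr
        _ = _ := by rw [← Real.exp_nat_mul]; norm_num
    have h4 : (8 : ℝ) ≤ Real.exp 3 := by
      calc (8 : ℝ) ≤ 2.7 ^ 3 := by norm_num
        _ ≤ Real.exp 1 ^ 3 := by gcongr
        _ = _ := by rw [← Real.exp_nat_mul]; norm_num
    have h5 : ((4 ^ j * j : ℕ) : ℝ) ≤ Real.exp (y / 2) := by
      have : (j : ℝ) ≤ 2 ^ j := by exact_mod_cast Nat.lt_two_pow_self.le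
      push_cast
      calc (4 : ℝ) ^ j * j ≤ 4 ^ j * 2 ^ j := by gcongr
        _ = 8 ^ j := by rw [← mul_pow]; norm_num
        _ ≤ Real.exp 3 ^ j := by gcongr
        _ = Real.exp (j * 3) := by rw [← Real.exp_nat_mul]
        _ ≤ _ := Real.exp_le_exp.mpr (by linarith)
    calc (49 : ℝ) ^ (4 ^ j * j) ≤ Real.exp 4 ^ (4 ^ j * j) := by gcongr
      _ = Real.exp ((4 ^ j * j : ℕ) * 4) := by rw [← Real.exp_nat_mul]
      _ < _ := by
          refine Real.exp_lt_exp.mpr ?_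
          have e1 : Real.exp y = Real.exp (y / 2) * Real.exp (y / 2) := by rw [← Real.exp_add]; congr 1; ring
          have e2 : 9 ≤ Real.exp (y / 2) := by linarith [Real.add_one_le_exp (y / 2)]
          have e3 : 9 * Real.exp (y / 2) ≤ Real.exp (y / 2) * Real.exp (y / 2) := by gcongr
          have e4 : 0 < Real.exp (y / 2) := Real.exp_pos _
          linarith

lemma sm_mem {p : ℕ} [NeZero p] (f : ZMod p → ℝ) (hf : ∀ n, f n ∈ Set.Icc (0 : ℝ) 1) (B : Finset (ZMod p))
    (hB : B.Nonempty) (n : ZMod p) : sm B f n ∈ Set.Icc (0 : ℝ) 1 := by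
  have hc : (0 : ℝ) < B.card := by exact_mod_cast hB.card_pos
  unfold sm
  constructor
  · exact mul_nonneg (by positivity) (sum_nonneg fun b _ => (hf _).1)
  · rw [inv_mul_le_iff₀ hc, mul_one]
    refine (sum_le_sum fun b _ => (hf (n - b)).2).trans (le_of_eq ?_)
    simp

lemma sm_ex {p : ℕ} [NeZero p] (f : ZMod p → ℝ) (B : Finset (ZMod p))
    (hB : B.Nonempty) : Ex p (sm B f) = Ex p f := by
  have hc : (0 : ℝ) < B.card := by exact_mod_cast hB.card_pos
  unfold Ex sm
  congr 1
  rw [← mul_sum, sum_comm]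
  have : ∀ b : ZMod p, ∑ n, f (n - b) = ∑ n, f n := fun b => Equiv.sum_comp (Equiv.subRight b) f
  simp_rw [this]
  rw [sum_const, nsmul_eq_mul, inv_mul_cancel_left₀ hc.ne']

theorem main_aux (C0 : ℕ) (hC0 : ∀ (p : ℕ) [Fact p.Prime], p ≠ 2 → ∀ q : ℕ, 1 ≤ q → ∀ A : Finset (ZMod p),
    (1 / 2 : ℝ) ^ q * p ≤ A.card → (1 / 2 : ℝ) ^ (C0 * q ^ 19) * (p : ℝ) ^ 2 ≤ aps A)
    (p : ℕ) [Fact p.Prime] (hp2 : p ≠ 2) (t L θ : ℝ) (ht : 20000 + C0 * 2 ^ 19 ≤ t) (hL : 1 / t ^ 40 ≤ L)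
    (hpt : (p : ℝ) = Real.exp (Real.exp (t ^ 40)))
    (f : ZMod p → ℝ) (hf : ∀ n, f n ∈ Set.Icc (0 : ℝ) 1) (hfθ : θ ≤ Ex p f)
    (hmin : ∀ h : ZMod p → ℝ, (∀ n, h n ∈ Set.Icc (0 : ℝ) 1) → Ex p h ≥ θ → Lam p f ≤ Lam p h)
    (C : Finset (ZMod p)) (hC : ∀ n, n ∈ C ↔ f n ≥ 1 / 2) :
    ∃ B : Finset (ZMod p), (B.card : ℝ) > √p ∧
      ∑ n, |conv p (ind p C) (ind p B) n - (B.card : ℝ) * ind p C n| ≤ 4 * p * B.card * L := by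
  have hp : (0 : ℝ) < p := by exact_mod_cast NeZero.pos p
  have ht0 : 0 < t := lt_of_lt_of_le (by positivity) ht
  have hL0 : 0 < L := lt_of_lt_of_le (by positivity) hL
  obtain ⟨q, j, hq1, hq2, hq3, hq4⟩ := asym C0 t L ht hL
  have hsq : √(p : ℝ) = Real.exp (Real.exp (t ^ 40) / 2) := by rw [hpt, Real.exp_half]
  rw [← hpt, ← hsq] at hq3
  rw [← hsq] at hq4
  have hρ : (0 : ℝ) < 2 / 2 ^ j := by positivity
  obtain ⟨Γ, hΓ, hsm⟩ := smoothing hp2 f hf (2 / 2 ^ j) (2 / 2 ^ j) hρ hρ.le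
  set B := bohr Γ (2 / 2 ^ j) with hB
  have hBn : B.Nonempty := ⟨0, zero_mem_bohr hρ.le⟩
  have hΓ4 : Γ.card ≤ 4 ^ j := by
    have e : ((2 : ℝ) / 2 ^ j) ^ 2 = 4 / 4 ^ j := by
      rw [div_pow, ← pow_mul, mul_comm j 2, pow_mul]; norm_num
    rw [e, mul_div_assoc', div_le_one (by positivity)] at hΓ
    have : (Γ.card : ℝ) ≤ 4 ^ j := by
      have : (0 : ℝ) ≤ Γ.card := by positivity
      linarith
    exact_mod_cast this
  have hcard : √(p : ℝ) < B.card := by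
    have h1 : p ≤ 49 ^ (Γ.card * j) * B.card := bohr_lower Γ j
    have h2 : (p : ℝ) ≤ 49 ^ (Γ.card * j) * B.card := by exact_mod_cast h1
    have h3 : (49 : ℝ) ^ (Γ.card * j) < √p :=
      lt_of_le_of_lt (pow_le_pow_right₀ (by norm_num) (Nat.mul_le_mul_right _ hΓ4)) hq4
    have hb : (0 : ℝ) < B.card := by exact_mod_cast hBn.card_pos
    have h4 : √(p : ℝ) * √p < √p * B.card := by
      rw [Real.mul_self_sqrt hp.le]
      exact lt_of_le_of_lt h2 (mul_lt_mul_of_pos_right h3 hb)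
    exact lt_of_mul_lt_mul_left h4 (Real.sqrt_nonneg _)
  have hE : Ex p (fun n => min (sm B f n) (1 - sm B f n)) ≤ L := by
    by_contra hcon
    push Not at hcon
    set η : ZMod p → ℝ := fun n => min (sm B f n) (1 - sm B f n) with hη
    have hg := sm_mem f hf B hBn
    have n0 : ∀ n, 0 ≤ η n := fun n => le_min (hg n).1 (by linarith [(hg n).2])
    have n1 : ∀ n, η n ≤ sm B f n := fun n => min_le_left _ _
    have n2 : ∀ n, η n ≤ 1 - sm B f n := fun n => min_le_right _ _
    have a1 := perturb hp2 θ L f (sm B f) η hf hmin (by rw [sm_ex f B hBn]; exact hfθ) n0 n1 n2 hL0 hcon.le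
    have a2 := roth_fun C0 q (hC0 p hp2 q hq1) η (fun n => ⟨n0 n, (n1 n).trans (hg n).2⟩) L hL0 hcon.le hq2
    linarith
  obtain ⟨B', hB'c, hB'⟩ := finish f hf C B hC hBn L hE
  exact ⟨B', by rw [hB'c]; exact hcard, hB'⟩

theorem final_thm :
    ∃ K : ℝ, 0 < K ∧ ∃ p₀ : ℕ,
      ∀ (p : ℕ) [Fact p.Prime], p₀ ≤ p →
        ∀ θ : ℝ, θ ∈ Set.Ioc (0 : ℝ) 1 → θ > (Real.log (Real.log p)) ^ (-(2 : ℝ)/3) →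
          ∀ f : ZMod p → ℝ, (∀ n, f n ∈ Set.Icc (0 : ℝ) 1) →
            Ex p f ≥ θ →
            (∀ h : ZMod p → ℝ, (∀ n, h n ∈ Set.Icc (0 : ℝ) 1) → Ex p h ≥ θ →
              Lam p f ≤ Lam p h) →
            ∀ C : Finset (ZMod p), (∀ n, n ∈ C ↔ f n ≥ 1/2) →
              ∃ B : Finset (ZMod p), (B.card : ℝ) > Real.sqrt p ∧
                ∑ n : ZMod p, |conv p (ind p C) (ind p B) n - (B.card : ℝ) * ind p C n| ≤
                  K * p * B.card * (Real.log (Real.log p)) ^ (-(2 : ℝ)/3) := by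
  obtain ⟨C0, hC0⟩ := roth
  set T : ℝ := 20000 + C0 * 2 ^ 19 with hT
  have hT1 : 20000 ≤ T := by
    have : (0 : ℝ) ≤ C0 * 2 ^ 19 := by positivity
    linarith
  refine ⟨4, by norm_num, max 3 ⌈Real.exp (Real.exp (T ^ 40))⌉₊, ?_⟩
  intro p _ hp0 θ _ _ f hf hE hmin C hC
  have hp3 : 3 ≤ p := (le_max_left _ _).trans hp0
  have hp : (0 : ℝ) < p := by exact_mod_cast NeZero.pos p
  have h1 : Real.exp (Real.exp (T ^ 40)) ≤ p :=
    (Nat.le_ceil _).trans (by exact_mod_cast (le_max_right _ _).trans hp0)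
  have h2 : Real.exp (T ^ 40) ≤ Real.log p := (Real.le_log_iff_exp_le hp).mpr h1
  have hlp : 0 < Real.log p := lt_of_lt_of_le (Real.exp_pos _) h2
  have h3 : T ^ 40 ≤ Real.log (Real.log p) := (Real.le_log_iff_exp_le hlp).mpr h2
  set y := Real.log (Real.log p) with hy
  have hTy : 1 ≤ T ^ 40 := one_le_pow₀ (by linarith)
  have hy0 : 0 ≤ y := by linarith
  have e40 : (y ^ ((1 : ℝ) / 40)) ^ 40 = y := by
    rw [← Real.rpow_natCast, ← Real.rpow_mul hy0]
    norm_num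
  refine main_aux C0 hC0 p (by omega) (y ^ ((1 : ℝ) / 40)) (y ^ (-(2 : ℝ) / 3)) θ ?_ ?_ ?_ f hf hE hmin C hC
  · by_contra hcon
    push Not at hcon
    have h5 : (y ^ ((1 : ℝ) / 40)) ^ 40 < T ^ 40 :=
      pow_lt_pow_left₀ hcon (Real.rpow_nonneg hy0 _) (by norm_num)
    rw [e40] at h5
    linarith
  · rw [e40, one_div, ← Real.rpow_neg_one]
    exact Real.rpow_le_rpow_of_exponent_le (by linarith) (by norm_num)
  · rw [e40, hy, Real.exp_log hlp, Real.exp_log hp]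

end Roth3

theorem stmt_3 :
    ∃ K : ℝ, 0 < K ∧ ∃ p₀ : ℕ,
      ∀ (p : ℕ) [Fact p.Prime], p₀ ≤ p →
        ∀ θ : ℝ, θ ∈ Set.Ioc (0 : ℝ) 1 → θ > (Real.log (Real.log p)) ^ (-(2 : ℝ)/3) →
          ∀ f : ZMod p → ℝ, (∀ n, f n ∈ Set.Icc (0 : ℝ) 1) →
            Ex p f ≥ θ →
            (∀ h : ZMod p → ℝ, (∀ n, h n ∈ Set.Icc (0 : ℝ) 1) → Ex p h ≥ θ →
              Lam p f ≤ Lam p h) →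
            ∀ C : Finset (ZMod p), (∀ n, n ∈ C ↔ f n ≥ 1/2) →
              ∃ B : Finset (ZMod p), (B.card : ℝ) > Real.sqrt p ∧
                ∑ n : ZMod p, |conv p (ind p C) (ind p B) n - (B.card : ℝ) * ind p C n| ≤
                  K * p * B.card * (Real.log (Real.log p)) ^ (-(2 : ℝ)/3) := by
  exact Roth3.final_thm
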